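/- arXiv:1708.02222 — 8 statements merged into one kernel-verified Lean document; each statement's English description precedes it below -/
import Mathlib

section
/- Let E be a finite set with |E| = m ≥ 1 and let w : E → {1, 2, …, 2m} be a weight function chosen uniformly at random (each value w(e) independent and uniform). Then for any nonempty family B ⊆ 2^E, with probability at least 1/2 the minimum-weight set in B is unique, i.e., there is exactly one S ∈ B attaining min_{T ∈ B} w(T). Equivalently, the number of functions w : E → {1,…,2m} for which the minimizer is not unique is at most half of (2m)^m. -/
/-- The weight of a finite set `S` under a weight function `w`. -/
def setWeight {E : Type*} [DecidableEq E] (w : E → ℕ) (S : Finset E) : ℕ :=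
  ∑ e ∈ S, w e

/-- A weight function `w` is isolating for a family `B` if there is a unique
minimum-weight member of `B`. -/
def IsIsolatingNat {E : Type*} [DecidableEq E] (B : Finset (Finset E)) (w : E → ℕ) : Prop :=
  ∃! S, S ∈ B ∧ ∀ T ∈ B, setWeight w S ≤ setWeight w T

/-- `S` is a member of `B` of minimum weight. -/
def IsMinWeight {E : Type*} [DecidableEq E] (B : Finset (Finset E)) (w : E → ℕ)
    (S : Finset E) : Prop :=
  S ∈ B ∧ ∀ T ∈ B, setWeight w S ≤ setWeight w T

/-- The element `e` lies in some minimum-weight member of `B`, but not in all of them. -/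
def IsAmbiguous {E : Type*} [DecidableEq E] (B : Finset (Finset E)) (w : E → ℕ) (e : E) : Prop :=
  ∃ S T, IsMinWeight B w S ∧ IsMinWeight B w T ∧ e ∈ S ∧ e ∉ T

section

variable {E : Type*} [DecidableEq E] {B : Finset (Finset E)} {w w' : E → ℕ} {e : E}

theorem exists_isAmbiguous_of_not_isIsolatingNat (hB : B.Nonempty)
    (h : ¬ IsIsolatingNat B w) : ∃ e, IsAmbiguous B w e := by
  obtain ⟨S, hS, hmin⟩ := B.exists_min_image (setWeight w) hB
  by_contra! hamb
  refine h ⟨S, ⟨hS, hmin⟩, fun T hT => ?_⟩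
  ext e
  by_contra! he
  rcases he with ⟨h1, h2⟩ | ⟨h1, h2⟩
  · exact hamb e ⟨T, S, hT, ⟨hS, hmin⟩, h1, h2⟩
  · exact hamb e ⟨S, T, ⟨hS, hmin⟩, hT, h2, h1⟩

theorem setWeight_congr_of_notMem (h : ∀ x, x ≠ e → w x = w' x) {S : Finset E} (he : e ∉ S) :
    setWeight w S = setWeight w' S :=
  Finset.sum_congr rfl fun x hx => h x (ne_of_mem_of_not_mem hx he)

theorem setWeight_add_of_mem (h : ∀ x, x ≠ e → w x = w' x) {S : Finset E} (he : e ∈ S) :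
    setWeight w S + w' e = setWeight w' S + w e := by
  have hrest := setWeight_congr_of_notMem h (Finset.notMem_erase e S)
  have h1 := Finset.add_sum_erase S w he
  have h2 := Finset.add_sum_erase S w' he
  unfold setWeight at *
  omega

/-- If `e` is ambiguous, then the weights of the other elements determine the weight of `e`. -/
theorem IsAmbiguous.apply_eq (hw : IsAmbiguous B w e) (hw' : IsAmbiguous B w' e)
    (h : ∀ x, x ≠ e → w x = w' x) : w e = w' e := by
  obtain ⟨S, T, hS, hT, heS, heT⟩ := hw
  obtain ⟨S', T', hS', hT', heS', heT'⟩ := hw'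
  have h1 := setWeight_congr_of_notMem h heT
  have h2 := setWeight_congr_of_notMem h heT'
  have h3 := setWeight_add_of_mem h heS
  have h4 := setWeight_add_of_mem h heS'
  have h5 := hS.2 T hT.1
  have h6 := hT.2 S hS.1
  have h7 := hT.2 T' hT'.1
  have h8 := hS.2 S' hS'.1
  have h9 := hS'.2 T' hT'.1
  have h10 := hT'.2 S' hS'.1
  have h11 := hT'.2 T hT.1
  have h12 := hS'.2 S hS.1
  omega

open Classical in
theorem card_isAmbiguous_le [Fintype E] (B : Finset (Finset E)) (W : Finset ℕ) (e : E) :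
    Finset.card {w : E → W | IsAmbiguous B (fun x => (w x : ℕ)) e} ≤
      W.card ^ (Fintype.card E - 1) := by
  have hcard : Fintype.card ({x // x ≠ e} → W) = W.card ^ (Fintype.card E - 1) := by
    simp [Fintype.card_subtype_compl]
  rw [← hcard, ← Finset.card_univ]
  refine Finset.card_le_card_of_injOn (fun w x => w x)
    (fun _ _ => Finset.mem_coe.2 (Finset.mem_univ _)) ?_
  intro w hw w' hw' heq
  simp only [Finset.coe_filter, Finset.mem_univ, true_and, Set.mem_ofPred_eq] at hw hw'
  have hoff (x : E) (hx : x ≠ e) : w x = w' x := congrFun heq ⟨x, hx⟩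
  funext x
  by_cases hx : x = e
  · subst hx
    exact Subtype.ext (hw.apply_eq hw' fun y hy => congrArg Subtype.val (hoff y hy))
  · exact hoff x hx

end

/-- **Isolation Lemma** (Mulmuley–Vazirani–Vazirani): for a ground set `E` of size `m ≥ 1`
and weights chosen from `{1, …, 2m}`, for any nonempty family `B ⊆ 2^E` the number of weight
functions that are *not* isolating is at most half of `(2m)^m`. -/
theorem isolation_lemma {E : Type*} [Fintype E] [DecidableEq E] (m : ℕ) (hm : 1 ≤ m)
    (hE : Fintype.card E = m) (B : Finset (Finset E)) (hB : B.Nonempty) :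
    2 * Nat.card {w : E → (Finset.Icc 1 (2 * m)) //
        ¬ IsIsolatingNat B (fun e => (w e : ℕ))} ≤ (2 * m) ^ m := by
  classical
  rw [Nat.card_eq_fintype_card, Fintype.card_subtype]
  have hsub : ({w : E → Finset.Icc 1 (2 * m) | ¬ IsIsolatingNat B (fun e => (w e : ℕ))} :
      Finset _) ⊆ Finset.univ.biUnion fun e =>
        {w : E → Finset.Icc 1 (2 * m) | IsAmbiguous B (fun x => (w x : ℕ)) e} := by
    intro w hw
    simpa using exists_isAmbiguous_of_not_isIsolatingNat hB (Finset.mem_filter.1 hw).2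
  have hle := (Finset.card_le_card hsub).trans
    (Finset.card_biUnion_le_card_mul _ _ _ fun e _ => card_isAmbiguous_le B _ e)
  rw [Finset.card_univ, hE, Nat.card_Icc, Nat.add_sub_cancel] at hle
  calc _ ≤ 2 * (m * (2 * m) ^ (m - 1)) := Nat.mul_le_mul_left 2 hle
    _ = (2 * m) ^ m := by rw [← mul_assoc, mul_pow_sub_one (by omega)]
end

section
/- There is an absolute constant c > 0 with the following property. For every finite set E with |E| = m ≥ 2, there exists a set W of at most m^{c·log m} weight functions w : E → {0, 1, …, ⌈m^{c·log m}⌉} such that: for every nonempty family B ⊆ 2^E with the property that for every face F of the polytope P(B) there exist some n, a totally unimodular matrix A_F ∈ ℝ^{n×m} and a vector b_F ∈ ℝ^n such that the affine hull of F equals {x ∈ ℝ^E : A_F x = b_F}, at least one weight function in W is isolating for B. -/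
/-- The indicator vector of a finite subset `S ⊆ E`, as a point of `ℝ^E`. -/
noncomputable def indVec {E : Type*} [DecidableEq E] (S : Finset E) : E → ℝ :=
  fun e => if e ∈ S then 1 else 0

/-- The polytope `P(B)`: the convex hull of the indicator vectors of the members of `B`. -/
noncomputable def polytopeOf {E : Type*} [Fintype E] [DecidableEq E]
    (B : Finset (Finset E)) : Set (E → ℝ) :=
  convexHull ℝ { x | ∃ S ∈ B, x = indVec S }

/-- `F` is a face of `P`: the set of minimizers over `P` of some linear functional. -/
def IsFaceOf {E : Type*} [Fintype E] (P F : Set (E → ℝ)) : Prop :=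
  ∃ c : E → ℝ, F = { x ∈ P | ∀ y ∈ P, ∑ e, c e * x e ≤ ∑ e, c e * y e }

/-- The lattice `L_F` of all integer vectors parallel to the face `F`. -/
def faceLattice {E : Type*} (F : Set (E → ℝ)) : Set (E → ℤ) :=
  { v | ∃ x₁ ∈ F, ∃ x₂ ∈ F, ∃ α : ℝ, (fun e => (v e : ℝ)) = α • (x₁ - x₂) }

/-- The `ℓ₁`-norm of an integer vector. -/
def l1norm {E : Type*} [Fintype E] (v : E → ℤ) : ℕ := ∑ e, (v e).natAbs

/-- `λ(L)`: the minimum `ℓ₁`-norm of a nonzero vector of `L` (`0` if there is none). -/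
noncomputable def lambda1 {E : Type*} [Fintype E] (L : Set (E → ℤ)) : ℕ :=
  sInf { k | ∃ v ∈ L, v ≠ 0 ∧ l1norm v = k }

/-- A weight function `w : E → ℕ` is isolating for a family `B` if there is a unique
minimum-weight member of `B`. -/
def IsIsolating {E : Type*} [DecidableEq E] (B : Finset (Finset E)) (w : E → ℕ) : Prop :=
  ∃! S, S ∈ B ∧ ∀ T ∈ B, ∑ e ∈ S, w e ≤ ∑ e ∈ T, w e

open Finset in
/-- A polynomial form of the Sauer–Shelah lemma for families of subsets of a finite set `I`. -/
theorem card_le_of_forall_shatters {α : Type*} [DecidableEq α] {𝒜 : Finset (Finset α)}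
    {I : Finset α} {k : ℕ} (hI : ∀ s ∈ 𝒜, s ⊆ I) (hk : ∀ s, 𝒜.Shatters s → s.card ≤ k) :
    𝒜.card ≤ (I.card + 1) ^ k := by
  have hsub : 𝒜.shatterer ⊆ (range (k + 1)).biUnion fun j => I.powersetCard j := by
    intro s hs
    rw [mem_shatterer] at hs
    obtain ⟨t, ht, hst⟩ := hs.exists_superset
    simp only [mem_biUnion, mem_range, mem_powersetCard]
    exact ⟨s.card, Nat.lt_succ_of_le (hk s hs), hst.trans (hI t ht), rfl⟩
  calc 𝒜.card ≤ 𝒜.shatterer.card := card_le_card_shatterer 𝒜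
    _ ≤ _ := card_le_card hsub
    _ ≤ ∑ j ∈ range (k + 1), (I.powersetCard j).card := card_biUnion_le
    _ ≤ ∑ j ∈ range (k + 1), I.card ^ j * 1 ^ (k - j) * k.choose j := by
        refine sum_le_sum fun j hj => ?_
        rw [card_powersetCard, one_pow, mul_one]
        exact (Nat.choose_le_pow _ _).trans
          (Nat.le_mul_of_pos_right _ (Nat.choose_pos (Nat.lt_succ_iff.1 (mem_range.1 hj))))
    _ = (I.card + 1) ^ k := (add_pow _ _ _).symm

open Finset in
/-- Greedily chosen points separate the members of a family whose pairwise symmetric differences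
are large: each new point separates a proportion `1 / q` of the pairs left. -/
theorem exists_few_unseparated {ι α : Type*} [DecidableEq ι] [DecidableEq α] {J : Finset ι}
    {R : ι → Finset α} {Z : Finset α} {g q : ℕ} (hg : 0 < g) (hZ : Z.card ≤ q * g)
    (hR : ∀ i ∈ J, R i ⊆ Z)
    (hsep : ∀ i ∈ J, ∀ j ∈ J, i ≠ j → g ≤ (symmDiff (R i) (R j)).card) (t : ℕ) :
    ∃ T ⊆ Z, T.card ≤ t ∧
      (J.offDiag.filter fun p => R p.1 ∩ T = R p.2 ∩ T).card * q ^ t ≤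
        (q - 1) ^ t * J.card ^ 2 := by
  induction t with
  | zero =>
    refine ⟨∅, empty_subset _, by simp, ?_⟩
    have := card_filter_le J.offDiag fun p => R p.1 ∩ ∅ = R p.2 ∩ ∅
    rw [offDiag_card] at this
    simp only [pow_zero, mul_one, one_mul, sq]
    omega
  | succ t ih =>
    obtain ⟨T, hTZ, hTt, hT⟩ := ih
    set U := J.offDiag.filter fun p => R p.1 ∩ T = R p.2 ∩ T with hU
    rcases U.eq_empty_or_nonempty with hUe | hUe
    · exact ⟨T, hTZ, by omega, by rw [← hU, hUe]; simp⟩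
    have hΔ : ∀ p ∈ U, symmDiff (R p.1) (R p.2) ⊆ Z ∧ g ≤ (symmDiff (R p.1) (R p.2)).card := by
      intro p hp
      obtain ⟨h1, h2, h3⟩ := mem_offDiag.1 (mem_filter.1 hp).1
      refine ⟨fun e he => ?_, hsep _ h1 _ h2 h3⟩
      rcases mem_symmDiff.1 he with h | h
      exacts [hR _ h1 h.1, hR _ h2 h.1]
    have hstep : ∃ e ∈ Z,
        U.card ≤ (U.filter fun p => e ∈ symmDiff (R p.1) (R p.2)).card * q := by
      by_contra! hcon
      have hZne : Z.Nonempty := by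
        obtain ⟨p, hp⟩ := hUe
        exact (card_pos.1 (hg.trans_le (hΔ p hp).2)).mono (hΔ p hp).1
      have h1 := sum_lt_sum_of_nonempty hZne hcon
      have h2 : ∑ e ∈ Z, (U.filter fun p => e ∈ symmDiff (R p.1) (R p.2)).card =
          ∑ p ∈ U, (symmDiff (R p.1) (R p.2)).card := by
        simp_rw [card_filter]
        rw [sum_comm]
        refine sum_congr rfl fun p hp => ?_
        rw [← card_filter, filter_mem_eq_inter, inter_eq_right.2 (hΔ p hp).1]
      have h3 : U.card * g ≤ ∑ p ∈ U, (symmDiff (R p.1) (R p.2)).card := by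
        rw [← smul_eq_mul]
        exact card_nsmul_le_sum _ _ _ fun p hp => (hΔ p hp).2
      rw [← sum_mul, h2, sum_const, smul_eq_mul] at h1
      nlinarith
    obtain ⟨e, heZ, he⟩ := hstep
    refine ⟨insert e T, insert_subset heZ hTZ, (card_insert_le _ _).trans (by omega), ?_⟩
    have hsub : (J.offDiag.filter fun p => R p.1 ∩ insert e T = R p.2 ∩ insert e T) ⊆
        U.filter fun p => e ∉ symmDiff (R p.1) (R p.2) := by
      intro p hp
      obtain ⟨hp1, hp2⟩ := mem_filter.1 hp
      have key : ∀ a ∈ insert e T, a ∈ R p.1 ↔ a ∈ R p.2 := fun a ha => by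
        have := congrArg (a ∈ ·) hp2
        simpa [ha, -mem_insert] using this
      refine mem_filter.2 ⟨mem_filter.2 ⟨hp1, ?_⟩, ?_⟩
      · ext a
        simp only [mem_inter]
        exact and_congr_left fun ha => key a (mem_insert_of_mem ha)
      · have := key e (mem_insert_self _ _)
        rw [mem_symmDiff]
        tauto
    have hle := card_le_card hsub
    have hsplit := card_filter_add_card_filter_not (s := U)
      (fun p => e ∈ symmDiff (R p.1) (R p.2))
    obtain ⟨r, rfl⟩ : ∃ r, q = r + 1 := by
      cases q with
      | zero =>
        have := card_pos.2 hUe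
        omega
      | succ r => exact ⟨r, rfl⟩
    simp only [Nat.add_sub_cancel] at hT ⊢
    set x := (U.filter fun p => e ∈ symmDiff (R p.1) (R p.2)).card
    set y := (U.filter fun p => e ∉ symmDiff (R p.1) (R p.2)).card
    have hy : y * (r + 1) ≤ r * U.card := by nlinarith
    calc _ ≤ y * (r + 1) ^ (t + 1) := Nat.mul_le_mul_right _ hle
      _ = y * (r + 1) * (r + 1) ^ t := by ring
      _ ≤ r * U.card * (r + 1) ^ t := Nat.mul_le_mul_right _ hy
      _ = r * (U.card * (r + 1) ^ t) := by ring
      _ ≤ r * (r ^ t * J.card ^ 2) := Nat.mul_le_mul_left _ hT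
      _ = r ^ (t + 1) * J.card ^ 2 := by ring

open Finset in
/-- A family of sets in which no three-element set is shattered, whose members are pairwise far
apart relative to the size of the ground set, is small. -/
theorem card_lt_of_separated {ι α : Type*} [DecidableEq ι] [DecidableEq α] {J : Finset ι}
    {R : ι → Finset α} {Z : Finset α} {g : ℕ} (hg : 0 < g) (hZ : Z.card ≤ 128 * g)
    (hR : ∀ i ∈ J, R i ⊆ Z)
    (hsep : ∀ i ∈ J, ∀ j ∈ J, i ≠ j → g ≤ (symmDiff (R i) (R j)).card)
    (hsh : ∀ s, (J.image R).Shatters s → s.card ≤ 2) : J.card < 2 ^ 31 := by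
  by_contra! hJ
  obtain ⟨K, hKJ, hK⟩ := exists_subset_card_eq hJ
  obtain ⟨n, hn⟩ : ∃ n, n = 63 := ⟨63, rfl⟩
  obtain ⟨T, hTZ, hTt, hT⟩ := exists_few_unseparated hg hZ (fun i hi => hR i (hKJ hi))
    (fun i hi j hj => hsep i (hKJ hi) j (hKJ hj)) (128 * n)
  have hempty : (K.offDiag.filter fun p => R p.1 ∩ T = R p.2 ∩ T) = ∅ := by
    by_contra hne
    have hpos := card_pos.2 (nonempty_iff_ne_empty.2 hne)
    have h1 : (2 * 127 ^ 128) ^ n ≤ (128 ^ 128) ^ n := Nat.pow_le_pow_left (by norm_num) n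
    have h2 : 2 ^ n * 127 ^ (128 * n) ≤ 128 ^ (128 * n) := by
      rwa [mul_pow, ← pow_mul, ← pow_mul] at h1
    rw [hK] at hT
    have h3 : 128 ^ (128 * n) ≤ 127 ^ (128 * n) * (2 ^ 31) ^ 2 :=
      (Nat.le_mul_of_pos_left _ hpos).trans hT
    have h4 : 0 < 127 ^ (128 * n) := by positivity
    have h5 : 2 ^ n ≤ (2 ^ 31) ^ 2 := by
      refine Nat.le_of_mul_le_mul_right (c := 127 ^ (128 * n)) ?_ h4
      rw [mul_comm ((2 ^ 31) ^ 2)]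
      exact h2.trans h3
    rw [hn] at h5
    norm_num at h5
  have hinj : Set.InjOn (fun i => R i ∩ T) K := by
    intro i hi j hj hij
    by_contra hne
    have : (i, j) ∈ K.offDiag.filter fun p => R p.1 ∩ T = R p.2 ∩ T :=
      mem_filter.2 ⟨mem_offDiag.2 ⟨hi, hj, hne⟩, hij⟩
    rw [hempty] at this
    simp at this
  have hcard : (K.image fun i => R i ∩ T).card ≤ (T.card + 1) ^ 2 := by
    refine card_le_of_forall_shatters (fun s hs => ?_) fun s hs => hsh s fun t ht => ?_
    · obtain ⟨i, -, rfl⟩ := mem_image.1 hs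
      exact inter_subset_right
    · obtain ⟨u, hu, hut⟩ := hs ht
      obtain ⟨i, hi, rfl⟩ := mem_image.1 hu
      refine ⟨R i, mem_image_of_mem _ (hKJ hi), ?_⟩
      obtain ⟨u', hu', hsu'⟩ := hs.exists_superset
      obtain ⟨i', -, rfl⟩ := mem_image.1 hu'
      rw [← hut, inter_comm (R i), ← inter_assoc, inter_eq_left.2 (hsu'.trans inter_subset_right)]
  rw [card_image_of_injOn hinj, hK] at hcard
  have : (T.card + 1) ^ 2 ≤ (128 * 63 + 1) ^ 2 := Nat.pow_le_pow_left (by omega) 2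
  norm_num at this hcard
  omega

/-- The support of a vector. -/
noncomputable def vecSupport {E : Type*} [Fintype E] (v : E → ℝ) : Finset E :=
  Finset.univ.filter fun e => v e ≠ 0

@[simp] theorem mem_vecSupport {E : Type*} [Fintype E] {v : E → ℝ} {e : E} :
    e ∈ vecSupport v ↔ v e ≠ 0 := by
  simp [vecSupport]

/-- A vector of a subspace is elementary if it spans the vectors of the subspace whose support
lies inside its own. -/
def IsElementary {E : Type*} (V : Submodule ℝ (E → ℝ)) (v : E → ℝ) : Prop :=
  v ∈ V ∧ ∀ w ∈ V, (∀ e, v e = 0 → w e = 0) → ∃ c : ℝ, w = c • v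

/-- A subspace is unimodular if the nonzero entries of each of its elementary vectors have the
same absolute value. -/
def IsUnimodularSubspace {E : Type*} (V : Submodule ℝ (E → ℝ)) : Prop :=
  ∀ v, IsElementary V v → ∀ e f, v e ≠ 0 → v f ≠ 0 → |v e| = |v f|

/-- A matrix over a field with linearly independent columns has an invertible square submatrix
formed by all the columns. -/
theorem exists_submatrix_det_ne_zero {m n K : Type*} [Fintype m] [Fintype n] [DecidableEq n]
    [Field K] {A : Matrix m n K} (hA : LinearIndependent K A.col) :
    ∃ s : n → m, (A.submatrix s id).det ≠ 0 := by
  obtain ⟨κ, a, -, hspan, hli⟩ := exists_linearIndependent' K A.row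
  have hκ : Finite κ := hli.finite
  have := Fintype.ofFinite κ
  have hcard : Fintype.card κ = Fintype.card n := by
    rw [← finrank_span_eq_card hli, hspan, ← Matrix.rank_eq_finrank_span_row]
    rw [← Matrix.rank_transpose]
    exact hA.rank_matrix
  obtain ⟨e⟩ := Fintype.card_eq.1 hcard
  refine ⟨a ∘ e.symm, ?_⟩
  rw [← isUnit_iff_ne_zero, ← Matrix.isUnit_iff_isUnit_det,
    ← Matrix.linearIndependent_rows_iff_isUnit]
  exact hli.comp e.symm e.symm.injective

theorem Matrix.IsTotallyUnimodular.abs_det_submatrix {m n k : Type*} [Fintype k] [DecidableEq k]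
    {A : Matrix m n ℝ} (hA : A.IsTotallyUnimodular) (r : k → m) (s : k → n)
    (h : (A.submatrix r s).det ≠ 0) : |(A.submatrix r s).det| = 1 := by
  obtain ⟨σ, hσ⟩ := A.isTotallyUnimodular_iff_fintype.1 hA k r s
  rw [← hσ] at h ⊢
  revert h
  cases σ <;> simp

/-- The kernel of a totally unimodular matrix is a unimodular subspace. -/
theorem Matrix.IsTotallyUnimodular.isUnimodularSubspace_ker {m E : Type*} [Fintype m] [Fintype E]
    [DecidableEq E] {A : Matrix m E ℝ} (hA : A.IsTotallyUnimodular) :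
    IsUnimodularSubspace (LinearMap.ker A.mulVecLin) := by
  rintro v ⟨hv, hmin⟩ e f he hf
  rcases eq_or_ne f e with rfl | hfe
  · rfl
  let X := {x : E // v x ≠ 0 ∧ x ≠ e}
  let B : Matrix m X ℝ := A.submatrix id Subtype.val
  have hsum : ∀ g : E → ℝ, (∀ x, ¬(v x ≠ 0 ∧ x ≠ e) → g x = 0) → ∑ x : X, g x = ∑ x, g x := by
    intro g hg
    refine Fintype.sum_of_injective Subtype.val Subtype.val_injective _ _ (fun x hx => hg x ?_)
      fun _ => rfl
    intro h
    exact hx ⟨⟨x, h⟩, rfl⟩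
  have hker : ∀ w : E → ℝ, w ∈ LinearMap.ker A.mulVecLin ↔ ∀ i, ∑ x, A i x * w x = 0 := by
    intro w
    rw [LinearMap.mem_ker, Matrix.mulVecLin_apply, funext_iff]
    rfl
  have hB : LinearIndependent ℝ B.col := by
    rw [Fintype.linearIndependent_iff]
    intro c hc
    let w : E → ℝ := fun x => if h : v x ≠ 0 ∧ x ≠ e then c ⟨x, h⟩ else 0
    have hwX : ∀ x : X, w x = c x := fun x => dif_pos x.2
    have hw0 : ∀ x, ¬(v x ≠ 0 ∧ x ≠ e) → w x = 0 := fun x hx => dif_neg hx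
    have hw : w ∈ LinearMap.ker A.mulVecLin := by
      rw [hker]
      intro i
      rw [← hsum (fun x => A i x * w x) fun x hx => by simp [hw0 x hx]]
      have := congrFun hc i
      rw [Finset.sum_apply] at this
      refine Eq.trans (Finset.sum_congr rfl fun x _ => ?_) this
      rw [hwX, mul_comm]
      rfl
    obtain ⟨t, ht⟩ := hmin w hw fun x hx => hw0 x (by tauto)
    have h0 : t * v e = 0 := by
      rw [← smul_eq_mul, ← Pi.smul_apply, ← ht]
      exact hw0 e (by tauto)
    have ht0 : t = 0 := (mul_eq_zero.1 h0).resolve_right he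
    intro x
    rw [← hwX, ht, ht0]
    simp
  obtain ⟨s, hs⟩ := exists_submatrix_det_ne_zero hB
  have hs1 := hA.abs_det_submatrix s (fun x : X => x.1) hs
  change |(B.submatrix s id).det| = 1 at hs1
  have heq : (B.submatrix s id).mulVec (fun x : X => v x) = (-v e) • fun x => A (s x) e := by
    ext i
    have h1 := (hker v).1 hv (s i)
    rw [← Finset.add_sum_erase _ _ (Finset.mem_univ e)] at h1
    have h2 : ∑ x : X, A (s i) x * v x = ∑ x ∈ Finset.univ.erase e, A (s i) x * v x := by
      have h3 := hsum (fun x => if x = e then 0 else A (s i) x * v x) fun x hx => by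
        by_cases hxe : x = e <;> simp_all
      rw [← Finset.add_sum_erase _ _ (Finset.mem_univ e), if_pos rfl, zero_add] at h3
      refine Eq.trans (Finset.sum_congr rfl fun x _ => ?_)
        (h3.trans (Finset.sum_congr rfl fun x hx => ?_))
      · rw [if_neg x.2.2]
      · rw [if_neg (Finset.ne_of_mem_erase hx)]
    change ∑ x : X, A (s i) x * v x = -v e * A (s i) e
    rw [h2]
    linarith
  have hcr := congrFun (congrArg (Matrix.cramer (B.submatrix s id)) heq) ⟨f, hf, hfe⟩
  rw [Matrix.cramer_eq_adjugate_mulVec, Matrix.mulVec_mulVec, Matrix.adjugate_mul,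
    Matrix.smul_mulVec, Matrix.one_mulVec, map_smul, Pi.smul_apply, Pi.smul_apply,
    Matrix.cramer_apply, smul_eq_mul, smul_eq_mul] at hcr
  have hupd : (B.submatrix s id).updateCol ⟨f, hf, hfe⟩ (fun x => A (s x) e) =
      A.submatrix s (fun x : X => if x = ⟨f, hf, hfe⟩ then e else x.1) := by
    ext i x
    by_cases hx : x = ⟨f, hf, hfe⟩
    · subst hx
      simp
    · rw [Matrix.updateCol_ne hx, Matrix.submatrix_apply _ _ _ _ _, Matrix.submatrix_apply,
        if_neg hx]
      rfl
  rw [hupd] at hcr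
  have habs := congrArg abs hcr
  rw [abs_mul, abs_mul, abs_neg, hs1, one_mul] at habs
  have hne : (A.submatrix s (fun x : X => if x = ⟨f, hf, hfe⟩ then e else x.1)).det ≠ 0 := by
    intro h0
    rw [h0, abs_zero, mul_zero, abs_eq_zero] at habs
    exact hf habs
  rw [hA.abs_det_submatrix _ _ hne, mul_one] at habs
  exact habs.symm

/-- Vectors `x i` of the subspace `V` dual to a set `I` of coordinates that determine `V`. -/
structure IsFundamentalSystem {E : Type*} (V : Submodule ℝ (E → ℝ)) (I : Finset E)
    (x : E → E → ℝ) : Prop where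
  mem : ∀ i ∈ I, x i ∈ V
  self : ∀ i ∈ I, x i i = 1
  off : ∀ i ∈ I, ∀ j ∈ I, i ≠ j → x i j = 0
  eq_zero : ∀ v ∈ V, (∀ i ∈ I, v i = 0) → v = 0

theorem exists_isFundamentalSystem {E : Type*} [Fintype E] [DecidableEq E]
    (V : Submodule ℝ (E → ℝ)) : ∃ I x, IsFundamentalSystem V I x := by
  have hex : ∃ n, ∃ I : Finset E, I.card = n ∧ ∀ v ∈ V, (∀ i ∈ I, v i = 0) → v = 0 :=
    ⟨_, Finset.univ, rfl, fun v _ h => funext fun i => h i (Finset.mem_univ i)⟩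
  classical
  obtain ⟨I, hI, hdet⟩ := Nat.find_spec hex
  have hx : ∀ i, ∃ x : E → ℝ, i ∈ I → x ∈ V ∧ x i = 1 ∧ ∀ j ∈ I, i ≠ j → x j = 0 := by
    intro i
    by_cases hi : i ∈ I
    swap
    · exact ⟨0, fun h => absurd h hi⟩
    have hnot := Nat.find_min hex (m := (I.erase i).card)
      (by rw [← hI]; exact Finset.card_erase_lt_of_mem hi)
    push Not at hnot
    obtain ⟨v, hv, hv0, hvne⟩ := hnot _ rfl
    have hvi : v i ≠ 0 := fun h => hvne (hdet v hv fun j hj => by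
      rcases eq_or_ne j i with rfl | hji
      · exact h
      · exact hv0 j (Finset.mem_erase.2 ⟨hji, hj⟩))
    refine ⟨(v i)⁻¹ • v, fun _ => ⟨V.smul_mem _ hv, by simp [hvi], fun j hj hij => ?_⟩⟩
    simp [hv0 j (Finset.mem_erase.2 ⟨hij.symm, hj⟩)]
  choose x hx using hx
  exact ⟨I, x, fun i hi => (hx i hi).1, fun i hi => (hx i hi).2.1, fun i hi => (hx i hi).2.2, hdet⟩

namespace IsFundamentalSystem

variable {E : Type*} {V : Submodule ℝ (E → ℝ)} {I : Finset E} {x : E → E → ℝ}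

theorem eq_sum [DecidableEq E] (hx : IsFundamentalSystem V I x) {J : Finset E} (hJ : J ⊆ I)
    {v : E → ℝ} (hv : v ∈ V) (hvJ : ∀ i ∈ I, i ∉ J → v i = 0) : v = ∑ i ∈ J, v i • x i := by
  rw [← sub_eq_zero]
  refine hx.eq_zero _ (V.sub_mem hv (V.sum_mem fun i hi => V.smul_mem _ (hx.mem i (hJ hi)))) ?_
  intro j hj
  rw [Pi.sub_apply, Finset.sum_apply, sub_eq_zero]
  by_cases hjJ : j ∈ J
  · rw [Finset.sum_eq_single_of_mem j hjJ fun i hi hij => ?_]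
    · simp [hx.self j hj]
    · simp [hx.off i (hJ hi) j hj hij]
  · rw [hvJ j hj hjJ, Finset.sum_eq_zero fun i hi => ?_]
    have : i ≠ j := fun h => hjJ (h ▸ hi)
    simp [hx.off i (hJ hi) j hj this]

theorem abs_eq_one [DecidableEq E] (hx : IsFundamentalSystem V I x) (hV : IsUnimodularSubspace V)
    {i e : E} (hi : i ∈ I) (he : x i e ≠ 0) : |x i e| = 1 := by
  have hel : IsElementary V (x i) := by
    refine ⟨hx.mem i hi, fun w hw h0 => ⟨w i, ?_⟩⟩
    have := hx.eq_sum (J := {i}) (by simpa using hi) hw fun j hj hji =>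
      h0 j (hx.off i hi j hj fun h => hji (by simp [h]))
    simpa using this
  rw [hV _ hel e i he (by simp [hx.self i hi]), hx.self i hi, abs_one]

/-- The `2 × 2` submatrices without zeros are singular. -/
theorem mul_eq_mul [DecidableEq E] (hx : IsFundamentalSystem V I x) (hV : IsUnimodularSubspace V)
    {i j e f : E} (hi : i ∈ I) (hj : j ∈ I) (hie : x i e ≠ 0) (hif : x i f ≠ 0) (hje : x j e ≠ 0)
    (hjf : x j f ≠ 0) : x i e * x j f = x i f * x j e := by
  rcases eq_or_ne i j with rfl | hij
  · ring
  have aie := hx.abs_eq_one hV hi hie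
  have aif := hx.abs_eq_one hV hi hif
  have aje := hx.abs_eq_one hV hj hje
  have ajf := hx.abs_eq_one hV hj hjf
  let v : E → ℝ := x j f • x i - x i f • x j
  have hvi : v i = x j f := by simp [v, hx.self i hi, hx.off j hj i hi hij.symm]
  have hvf : v f = 0 := by simp [v]; ring
  have hel : IsElementary V v := by
    refine ⟨V.sub_mem (V.smul_mem _ (hx.mem i hi)) (V.smul_mem _ (hx.mem j hj)),
      fun w hw h0 => ?_⟩
    have hw2 := hx.eq_sum (J := {i, j}) (by simp [Finset.insert_subset_iff, hi, hj]) hw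
      fun k hk hkij => h0 k (by
        simp only [Finset.mem_insert, Finset.mem_singleton, not_or] at hkij
        simp [v, hx.off i hi k hk (Ne.symm hkij.1), hx.off j hj k hk (Ne.symm hkij.2)])
    rw [Finset.sum_pair hij] at hw2
    have hwf := h0 f hvf
    rw [hw2] at hwf
    simp only [Pi.add_apply, Pi.smul_apply, smul_eq_mul] at hwf
    refine ⟨w i / x j f, ?_⟩
    have hwj : w j = -(w i / x j f * x i f) := by
      field_simp
      linarith
    calc w = w i • x i + w j • x j := hw2
      _ = (w i / x j f) • v := by
        rw [hwj]
        ext l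
        simp only [v, Pi.add_apply, Pi.smul_apply, Pi.sub_apply, smul_eq_mul]
        field_simp
        ring
  have hve : v e = x j f * x i e - x i f * x j e := by simp [v]
  by_contra hne
  have h1 := hV v hel e i (by rw [hve]; intro h; exact hne (by linarith)) (by rw [hvi]; exact hjf)
  rw [hve, hvi, ajf] at h1
  rcases eq_or_eq_neg_of_abs_eq aie with h | h <;>
    rcases eq_or_eq_neg_of_abs_eq aif with h' | h' <;>
  rcases eq_or_eq_neg_of_abs_eq aje with h2 | h2 <;>
  rcases eq_or_eq_neg_of_abs_eq ajf with h3 | h3 <;> rw [h, h', h2, h3] at h1 <;> norm_num at h1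

/-- A `3 × 3` submatrix with the zero pattern of the incidence matrix of a triangle is singular. -/
theorem triangle [DecidableEq E] (hx : IsFundamentalSystem V I x) (hV : IsUnimodularSubspace V)
    {i j k e f h : E} (hi : i ∈ I) (hj : j ∈ I) (hk : k ∈ I) (hij : i ≠ j) (hik : i ≠ k)
    (hjk : j ≠ k) (hie : x i e ≠ 0) (hif : x i f ≠ 0) (hih : x i h = 0) (hje : x j e = 0)
    (hjf : x j f ≠ 0) (hjh : x j h ≠ 0) (hke : x k e ≠ 0) (hkf : x k f = 0) (hkh : x k h ≠ 0) :
    x i e * x j f * x k h + x i f * x j h * x k e = 0 := by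
  have aie := hx.abs_eq_one hV hi hie
  have aif := hx.abs_eq_one hV hi hif
  have ajf := hx.abs_eq_one hV hj hjf
  have ajh := hx.abs_eq_one hV hj hjh
  have ake := hx.abs_eq_one hV hk hke
  have akh := hx.abs_eq_one hV hk hkh
  let v : E → ℝ := x i - (x i f / x j f) • x j - (x i e / x k e) • x k
  have hvi : v i = 1 := by
    simp [v, hx.self i hi, hx.off j hj i hi hij.symm, hx.off k hk i hi hik.symm]
  have hve : v e = 0 := by simp [v, hje, hke]
  have hvf : v f = 0 := by simp [v, hkf, hjf]
  have hel : IsElementary V v := by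
    refine ⟨V.sub_mem (V.sub_mem (hx.mem i hi) (V.smul_mem _ (hx.mem j hj)))
      (V.smul_mem _ (hx.mem k hk)), fun w hw h0 => ⟨w i, ?_⟩⟩
    have hw2 := hx.eq_sum (J := {i, j, k}) (by simp [Finset.insert_subset_iff, hi, hj, hk]) hw
      fun l hl hlijk => h0 l (by
        simp only [Finset.mem_insert, Finset.mem_singleton, not_or] at hlijk
        simp [v, hx.off i hi l hl (Ne.symm hlijk.1), hx.off j hj l hl (Ne.symm hlijk.2.1),
          hx.off k hk l hl (Ne.symm hlijk.2.2)])
    rw [Finset.sum_insert (by simp [hij, hik]), Finset.sum_pair hjk] at hw2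
    have hwe := h0 e hve
    have hwf := h0 f hvf
    rw [hw2] at hwe hwf
    simp only [Pi.add_apply, Pi.smul_apply, smul_eq_mul, hje, hkf] at hwe hwf
    have hwj : w j = -(w i * (x i f / x j f)) := by
      field_simp
      linarith
    have hwk : w k = -(w i * (x i e / x k e)) := by
      field_simp
      linarith
    calc w = w i • x i + (w j • x j + w k • x k) := hw2
      _ = w i • v := by
        rw [hwj, hwk]
        ext l
        simp only [v, Pi.add_apply, Pi.smul_apply, Pi.sub_apply, smul_eq_mul]
        ring
  have hvh : v h = -(x i f / x j f) * x j h - (x i e / x k e) * x k h := by simp [v, hih]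
  by_contra hne
  have h1 : v h ≠ 0 → |v h| = 1 := fun h0 => by
    rw [hV v hel h i h0 (by simp [hvi]), hvi, abs_one]
  rw [hvh] at h1
  rcases eq_or_eq_neg_of_abs_eq aie with h | h <;>
    rcases eq_or_eq_neg_of_abs_eq aif with h' | h' <;>
  rcases eq_or_eq_neg_of_abs_eq ajf with h2 | h2 <;>
  rcases eq_or_eq_neg_of_abs_eq ajh with h3 | h3 <;>
  rcases eq_or_eq_neg_of_abs_eq ake with h4 | h4 <;>
  rcases eq_or_eq_neg_of_abs_eq akh with h5 | h5 <;> rw [h, h', h2, h3, h4, h5] at h1 hne <;>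
  first | (norm_num at hne; done) | norm_num at h1

/-- The supports of the columns of the matrix `x` shatter no three-element set. -/
theorem card_le_two_of_shatters_cols [DecidableEq E] (hx : IsFundamentalSystem V I x)
    (hV : IsUnimodularSubspace V) {X : Finset E} {s : Finset E}
    (hs : (X.image fun e => I.filter fun i => x i e ≠ 0).Shatters s) : s.card ≤ 2 := by
  by_contra! hcard
  obtain ⟨t, hts, ht⟩ := Finset.exists_subset_card_eq (Nat.succ_le_of_lt hcard)
  obtain ⟨i, j, k, hij, hik, hjk, rfl⟩ := Finset.card_eq_three.1 ht
  replace hs := hs.mono_right hts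
  have hcol : ∀ u : Finset E, u ⊆ {i, j, k} → ∃ e, ∀ l ∈ ({i, j, k} : Finset E),
      l ∈ I ∧ (x l e ≠ 0 ↔ l ∈ u) := by
    obtain ⟨w, hw, hsw⟩ := hs.exists_superset
    obtain ⟨e', -, rfl⟩ := Finset.mem_image.1 hw
    intro u hu
    obtain ⟨w, hw, hwu⟩ := hs hu
    obtain ⟨e, -, rfl⟩ := Finset.mem_image.1 hw
    refine ⟨e, fun l hl => ?_⟩
    have hlI := (Finset.mem_filter.1 (hsw hl)).1
    refine ⟨hlI, ?_⟩
    rw [← hwu, Finset.mem_inter, Finset.mem_filter]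
    tauto
  obtain ⟨p, hp⟩ := hcol {i, j, k} subset_rfl
  obtain ⟨e, he⟩ := hcol {i, k} (by grind)
  obtain ⟨f, hf⟩ := hcol {i, j} (by grind)
  obtain ⟨h, hh⟩ := hcol {j, k} (by grind)
  simp only [Finset.mem_insert, Finset.mem_singleton, forall_eq_or_imp, forall_eq] at hp he hf hh
  simp only [hij, hik, hjk, hij.symm, hik.symm, hjk.symm, or_true, or_false,
    or_self, iff_true, iff_false, not_not] at hp he hf hh
  obtain ⟨⟨hi, hip⟩, ⟨hj, hjp⟩, ⟨hk, hkp⟩⟩ := hp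
  obtain ⟨⟨-, hie⟩, ⟨-, hje⟩, ⟨-, hke⟩⟩ := he
  obtain ⟨⟨-, hif⟩, ⟨-, hjf⟩, ⟨-, hkf⟩⟩ := hf
  obtain ⟨⟨-, hih⟩, ⟨-, hjh⟩, ⟨-, hkh⟩⟩ := hh
  have ht := hx.triangle hV hi hj hk hij hik hjk hie hif hih hje hjf hjh hke hkf hkh
  have h1 := hx.mul_eq_mul hV hi hk hie hip hke hkp
  have h2 := hx.mul_eq_mul hV hi hj hif hip hjf hjp
  have h3 := hx.mul_eq_mul hV hj hk hjh hjp hkh hkp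
  have h4 : 2 * (x i e * x j f * x k h * (x i p * x j p * x k p)) = 0 := by
    linear_combination (x i p * x j p * x k p) * ht - (x j h * x k e * x i p * x k p) * h2 -
      (x i p * x j f * x k e * x i p) * h3 + (x i p * x j f * x j p * x k h) * h1
  have h5 : x i e * x j f * x k h * (x i p * x j p * x k p) ≠ 0 := by simp [*]
  exact h5 (by linarith)

/-- The supports of the rows of the matrix `x` shatter no three-element set. -/
theorem card_le_two_of_shatters_rows [Fintype E] [DecidableEq E] (hx : IsFundamentalSystem V I x)
    (hV : IsUnimodularSubspace V) {s : Finset E}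
    (hs : (I.image fun i => vecSupport (x i)).Shatters s) : s.card ≤ 2 := by
  by_contra! hcard
  obtain ⟨t, hts, ht⟩ := Finset.exists_subset_card_eq (Nat.succ_le_of_lt hcard)
  obtain ⟨e, f, h, hef, heh, hfh, rfl⟩ := Finset.card_eq_three.1 ht
  replace hs := hs.mono_right hts
  have hrow : ∀ u : Finset E, u ⊆ {e, f, h} →
      ∃ i ∈ I, ∀ l ∈ ({e, f, h} : Finset E), x i l ≠ 0 ↔ l ∈ u := by
    intro u hu
    obtain ⟨w, hw, hwu⟩ := hs hu
    obtain ⟨i, hi, rfl⟩ := Finset.mem_image.1 hw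
    refine ⟨i, hi, fun l hl => ?_⟩
    rw [← hwu, Finset.mem_inter, mem_vecSupport]
    tauto
  obtain ⟨p, hpI, hp⟩ := hrow {e, f, h} subset_rfl
  obtain ⟨i, hi, hi'⟩ := hrow {e, f} (by grind)
  obtain ⟨j, hj, hj'⟩ := hrow {f, h} (by grind)
  obtain ⟨k, hk, hk'⟩ := hrow {e, h} (by grind)
  simp only [Finset.mem_insert, Finset.mem_singleton, forall_eq_or_imp, forall_eq] at hp hi' hj' hk'
  simp only [hef, heh, hfh, hef.symm, heh.symm, hfh.symm, or_true, or_false,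
    or_self, iff_true, iff_false, not_not] at hp hi' hj' hk'
  obtain ⟨hpe, hpf, hph⟩ := hp
  obtain ⟨hie, hif, hih⟩ := hi'
  obtain ⟨hje, hjf, hjh⟩ := hj'
  obtain ⟨hke, hkf, hkh⟩ := hk'
  have ht := hx.triangle hV hi hj hk (fun hij => hie (hij ▸ hje)) (fun hik => hif (hik ▸ hkf))
    (fun hjk => hjf (hjk ▸ hkf)) hie hif hih hje hjf hjh hke hkf hkh
  have h1 := hx.mul_eq_mul hV hi hpI hie hif hpe hpf
  have h2 := hx.mul_eq_mul hV hj hpI hjf hjh hpf hph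
  have h3 := hx.mul_eq_mul hV hk hpI hke hkh hpe hph
  have h4 : 2 * (x i e * x j f * x k h * (x p e * x p f * x p h)) = 0 := by
    linear_combination (x p e * x p f * x p h) * ht + (x j h * x k e * x p f * x p h) * h1 -
      (x i e * x p f * x j h * x p f) * h3 + (x i e * x p f * x k h * x p e) * h2
  have h5 : x i e * x j f * x k h * (x p e * x p f * x p h) ≠ 0 := by simp [*]
  exact h5 (by linarith)

end IsFundamentalSystem

/-- The supports of two distinct rows differ by the support of a nonzero vector. -/
theorem IsFundamentalSystem.le_card_symmDiff {E : Type*} [Fintype E] [DecidableEq E]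
    {V : Submodule ℝ (E → ℝ)} {I : Finset E} {x : E → E → ℝ} (hx : IsFundamentalSystem V I x)
    (hV : IsUnimodularSubspace V) {g : ℕ} (hg : ∀ v ∈ V, v ≠ 0 → g ≤ (vecSupport v).card) {i j : E}
    (hi : i ∈ I) (hj : j ∈ I) (hij : i ≠ j) :
    g ≤ (symmDiff (vecSupport (x i)) (vecSupport (x j))).card := by
  obtain ⟨c, hc⟩ : ∃ c : ℝ, ∀ e, x i e ≠ 0 → x j e ≠ 0 → x i e = c * x j e := by
    by_cases hp : ∃ p, x i p ≠ 0 ∧ x j p ≠ 0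
    · obtain ⟨p, hip, hjp⟩ := hp
      refine ⟨x i p / x j p, fun e hie hje => ?_⟩
      have := hx.mul_eq_mul hV hi hj hie hip hje hjp
      field_simp
      exact this
    · push Not at hp
      exact ⟨0, fun e hie hje => absurd (hp e hie) hje⟩
  have hv : x i - c • x j ∈ V := V.sub_mem (hx.mem i hi) (V.smul_mem _ (hx.mem j hj))
  refine (hg _ hv fun h0 => ?_).trans (Finset.card_le_card fun e he => ?_)
  · have := congrFun h0 i
    simp [hx.self i hi, hx.off j hj i hi hij.symm] at this
  · rw [mem_vecSupport] at he
    rw [Finset.mem_symmDiff, mem_vecSupport, mem_vecSupport]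
    by_contra hcon
    apply he
    by_cases hie : x i e = 0 <;> by_cases hje : x j e = 0
    · simp [hie, hje]
    · tauto
    · tauto
    · simp [hc e hie hje]

/-- The vectors of `V` supported in `Z`. -/
def Submodule.supportedIn {E : Type*} (V : Submodule ℝ (E → ℝ)) (Z : Finset E) :
    Submodule ℝ (E → ℝ) where
  carrier := {v | v ∈ V ∧ ∀ e ∉ Z, v e = 0}
  add_mem' ha hb := ⟨V.add_mem ha.1 hb.1, fun e he => by simp [ha.2 e he, hb.2 e he]⟩
  zero_mem' := ⟨V.zero_mem, fun _ _ => rfl⟩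
  smul_mem' c _ ha := ⟨V.smul_mem c ha.1, fun e he => by simp [ha.2 e he]⟩

theorem IsUnimodularSubspace.supportedIn {E : Type*} {V : Submodule ℝ (E → ℝ)}
    (hV : IsUnimodularSubspace V) (Z : Finset E) : IsUnimodularSubspace (V.supportedIn Z) :=
  fun v hv => hV v ⟨hv.1.1, fun w hw h0 => hv.2 w ⟨hw, fun e he => h0 e (hv.1.2 e he)⟩ h0⟩

/-- In a unimodular subspace, coordinates in a set `Z` of size at most a constant times the girth
have a bounded number of different zero patterns. -/
theorem card_lt_of_zero_patterns {E : Type*} [Fintype E] [DecidableEq E]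
    {V : Submodule ℝ (E → ℝ)} (hV : IsUnimodularSubspace V) {g : ℕ} (hg0 : 0 < g)
    (hg : ∀ v ∈ V, v ≠ 0 → g ≤ (vecSupport v).card) {Z X : Finset E} (hZ : Z.card ≤ 128 * g)
    (hX : ∀ e ∈ X, ∀ f ∈ X, e ≠ f → ∃ v ∈ V, vecSupport v ⊆ Z ∧ ¬(v e = 0 ↔ v f = 0)) :
    X.card < 2 ^ 64 := by
  obtain ⟨I, x, hx⟩ := exists_isFundamentalSystem (V.supportedIn Z)
  have hU := hV.supportedIn Z
  have hI : I.card < 2 ^ 31 := by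
    refine card_lt_of_separated (R := fun i => vecSupport (x i)) hg0 hZ (fun i hi e he => ?_)
      (fun i hi j hj hij => hx.le_card_symmDiff hU (fun v hv => hg v hv.1) hi hj hij)
      fun s hs => hx.card_le_two_of_shatters_rows hU hs
    by_contra heZ
    exact mem_vecSupport.1 he ((hx.mem i hi).2 e heZ)
  have hinj : Set.InjOn (fun e => I.filter fun i => x i e ≠ 0) X := by
    intro e he f hf hef
    by_contra hne
    obtain ⟨v, hv, hvZ, hvef⟩ := hX e he f hf hne
    have hvm : v ∈ V.supportedIn Z := ⟨hv, fun a ha => by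
      by_contra h
      exact ha (hvZ (mem_vecSupport.2 h))⟩
    have hpat : ∀ i ∈ I, x i e = 0 ↔ x i f = 0 := fun i hi => by
      have := congrArg (i ∈ ·) hef
      simp only [Finset.mem_filter, hi, true_and, eq_iff_iff] at this
      exact not_iff_not.1 this
    obtain ⟨c, hc0, hc⟩ : ∃ c : ℝ, c ≠ 0 ∧ ∀ i ∈ I, x i e = c * x i f := by
      by_cases hp : ∃ p ∈ I, x p f ≠ 0
      · obtain ⟨p, hpI, hpf⟩ := hp
        have hpe : x p e ≠ 0 := fun h => hpf ((hpat p hpI).1 h)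
        refine ⟨x p e / x p f, div_ne_zero hpe hpf, fun i hi => ?_⟩
        by_cases hif : x i f = 0
        · rw [hif, (hpat i hi).2 hif, mul_zero]
        · have := hx.mul_eq_mul hU hi hpI (fun h => hif ((hpat i hi).1 h)) hif hpe hpf
          field_simp
          linarith
      · push Not at hp
        exact ⟨1, one_ne_zero, fun i hi => by rw [hp i hi, (hpat i hi).2 (hp i hi), mul_zero]⟩
    have hve : v e = c * v f := by
      rw [hx.eq_sum subset_rfl hvm fun i hi hi' => absurd hi hi']
      simp only [Finset.sum_apply, Pi.smul_apply, smul_eq_mul, Finset.mul_sum]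
      exact Finset.sum_congr rfl fun i hi => by rw [hc i hi]; ring
    exact hvef (by rw [hve]; simp [hc0])
  have hcard : (X.image fun e => I.filter fun i => x i e ≠ 0).card ≤ (I.card + 1) ^ 2 := by
    refine card_le_of_forall_shatters (fun s hs => ?_) fun s hs =>
      hx.card_le_two_of_shatters_cols hU hs
    obtain ⟨e, -, rfl⟩ := Finset.mem_image.1 hs
    exact Finset.filter_subset _ _
  rw [Finset.card_image_of_injOn hinj] at hcard
  have : (I.card + 1) ^ 2 ≤ (2 ^ 31) ^ 2 := Nat.pow_le_pow_left hI 2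
  norm_num at this ⊢
  omega

/-- The supports of short vectors in a unimodular subspace have bounded VC dimension. -/
theorem card_lt_of_shatters_short {E : Type*} [Fintype E] [DecidableEq E]
    {V : Submodule ℝ (E → ℝ)} (hV : IsUnimodularSubspace V) {g : ℕ} (hg0 : 0 < g)
    (hg : ∀ v ∈ V, v ≠ 0 → g ≤ (vecSupport v).card) {𝒜 : Finset (Finset E)}
    (h𝒜 : ∀ s ∈ 𝒜, s.card ≤ 2 * g ∧ ∃ v ∈ V, vecSupport v = s) {X : Finset E}
    (hX : 𝒜.Shatters X) : X.card < 2 ^ 64 := by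
  by_contra! hcard
  obtain ⟨Y, hYX, hY⟩ := Finset.exists_subset_card_eq hcard
  replace hX := hX.mono_right hYX
  let φ := Y.equivFinOfCardEq hY
  have hex : ∀ b : ℕ, ∃ v ∈ V, (vecSupport v).card ≤ 2 * g ∧
      ∀ e : Y, v e ≠ 0 ↔ (φ e).1.testBit b = true := by
    intro b
    obtain ⟨u, hu, hYu⟩ := hX (Finset.filter_subset
      (fun e => ∃ h : e ∈ Y, (φ ⟨e, h⟩).1.testBit b = true) Y)
    obtain ⟨hu2, v, hv, rfl⟩ := h𝒜 u hu
    refine ⟨v, hv, hu2, fun e => ?_⟩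
    have := congrArg (e.1 ∈ ·) hYu
    simpa [e.2] using this
  choose v hvV hv2 hvb using hex
  refine absurd hY (card_lt_of_zero_patterns hV hg0 hg
    (Z := (Finset.range 64).biUnion fun b => vecSupport (v b)) ?_ ?_).ne
  · refine Finset.card_biUnion_le.trans ((Finset.sum_le_card_nsmul _ _ _ fun b _ => hv2 b).trans ?_)
    rw [Finset.card_range, smul_eq_mul]
    omega
  · intro e he f hf hef
    have hne : (φ ⟨e, he⟩).1 ≠ (φ ⟨f, hf⟩).1 := fun h => hef (by
      simpa using φ.injective (Fin.ext h))
    obtain ⟨b, hb⟩ := Nat.exists_testBit_ne_of_ne hne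
    have hb64 : b < 64 := by
      by_contra! hle
      have h64 := Nat.pow_le_pow_right (n := 2) (by norm_num) hle
      rw [Nat.testBit_lt_two_pow ((φ ⟨e, he⟩).2.trans_le h64),
        Nat.testBit_lt_two_pow ((φ ⟨f, hf⟩).2.trans_le h64)] at hb
      exact hb rfl
    refine ⟨v b, hvV b, Finset.subset_biUnion_of_mem (fun b => vecSupport (v b))
      (Finset.mem_range.2 hb64), fun h => hb ?_⟩
    rw [Bool.eq_iff_iff, ← hvb b ⟨e, he⟩, ← hvb b ⟨f, hf⟩]
    exact not_congr h

/-- A unimodular subspace without nonzero vectors of support smaller than `g` has few sign vectors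
of support smaller than `2 * g`. -/
theorem card_short_signVectors_le {E : Type*} [Fintype E] [DecidableEq E]
    {V : Submodule ℝ (E → ℝ)} (hV : IsUnimodularSubspace V) {g : ℕ} (hg0 : 0 < g)
    (hg : ∀ v ∈ V, v ≠ 0 → g ≤ (vecSupport v).card) {D : ℕ} (hD : 2 ^ 64 ≤ D)
    {S : Finset (E → ℤ)} (hsign : ∀ u ∈ S, ∀ e, u e = -1 ∨ u e = 0 ∨ u e = 1)
    (hS : ∀ u ∈ S, (fun e => (u e : ℝ)) ∈ V ∧ (vecSupport fun e => (u e : ℝ)).card < 2 * g) :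
    S.card ≤ 2 * (Fintype.card E + 1) ^ D := by
  refine (Finset.card_le_mul_card_image (f := fun u => vecSupport fun e => (u e : ℝ)) S 2
    ?_).trans (Nat.mul_le_mul_left 2 (card_le_of_forall_shatters (I := Finset.univ)
      (fun s _ => s.subset_univ) fun X hX => ?_))
  · rintro s -
    have hmain : ∀ u ∈ S, ∀ v ∈ S,
        (vecSupport fun e => (u e : ℝ)) = vecSupport (fun e => (v e : ℝ)) →
        v = u ∨ v = -u := by
      intro u hu v hv huv
      by_contra! hne
      have hzero : ∀ e, u e = 0 ↔ v e = 0 := fun e => by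
        have := congrArg (e ∈ ·) huv
        simpa [not_iff_not] using this
      have h1 := hg _ (V.sub_mem (hS v hv).1 (hS u hu).1) (by
        intro h
        refine hne.1 (funext fun e => ?_)
        have := congrFun h e
        simp only [Pi.sub_apply, Pi.zero_apply, sub_eq_zero, Int.cast_inj] at this
        exact this)
      have h2 := hg _ (V.add_mem (hS v hv).1 (hS u hu).1) (by
        intro h
        refine hne.2 (funext fun e => ?_)
        have := congrFun h e
        simp only [Pi.add_apply, Pi.zero_apply, ← Int.cast_add, Int.cast_eq_zero] at this
        simp only [Pi.neg_apply]
        omega)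
      have hdisj : Disjoint (vecSupport ((fun e => (v e : ℝ)) - fun e => (u e : ℝ)))
          (vecSupport ((fun e => (v e : ℝ)) + fun e => (u e : ℝ))) := by
        rw [Finset.disjoint_left]
        intro e he hf
        simp only [mem_vecSupport, Pi.sub_apply, Pi.add_apply, ← Int.cast_add, ← Int.cast_sub,
          Int.cast_ne_zero] at he hf
        have := hzero e
        rcases hsign u hu e with h | h | h <;> rcases hsign v hv e with h' | h' | h' <;>
          simp [h, h'] at he hf this
      have hsub : vecSupport ((fun e => (v e : ℝ)) - fun e => (u e : ℝ)) ∪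
          vecSupport ((fun e => (v e : ℝ)) + fun e => (u e : ℝ)) ⊆
          vecSupport fun e => (u e : ℝ) := by
        intro e he
        simp only [Finset.mem_union, mem_vecSupport, Pi.sub_apply, Pi.add_apply, ← Int.cast_add,
          ← Int.cast_sub, Int.cast_ne_zero] at he ⊢
        intro h
        have := (hzero e).1 h
        omega
      have := Finset.card_le_card hsub
      rw [Finset.card_union_of_disjoint hdisj] at this
      have := (hS u hu).2
      omega
    rcases (S.filter fun u => (vecSupport fun e => (u e : ℝ)) = s).eq_empty_or_nonempty with
      h | ⟨u, hu⟩
    · simp [h]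
    · rw [Finset.mem_filter] at hu
      refine (Finset.card_le_card (t := {u, -u}) fun v hv => ?_).trans Finset.card_le_two
      rw [Finset.mem_filter] at hv
      simpa using hmain u hu.1 v hv.1 (hu.2.trans hv.2.symm)
  · refine (card_lt_of_shatters_short hV hg0 hg (fun s hs => ?_) hX).le.trans hD
    obtain ⟨u, hu, rfl⟩ := Finset.mem_image.1 hs
    exact ⟨(hS u hu).2.le, _, (hS u hu).1, rfl⟩

open Polynomial in
/-- Among the power weights modulo `p`, one does not vanish on any of few nonzero sign vectors. -/
theorem exists_power_weight {E : Type*} [Fintype E] [DecidableEq E] {p : ℕ} [Fact p.Prime]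
    {ix : E → ℕ} (hix : Function.Injective ix) (hlt : ∀ e, ix e < Fintype.card E)
    {S : Finset (E → ℤ)} (hsign : ∀ u ∈ S, ∀ e, u e = -1 ∨ u e = 0 ∨ u e = 1)
    (hS : ∀ u ∈ S, u ≠ 0) (hp : S.card * Fintype.card E < p) :
    ∃ a : ZMod p, ∀ u ∈ S, ∑ e, ((a ^ ix e).val : ℤ) * u e ≠ 0 := by
  let q : (E → ℤ) → (ZMod p)[X] := fun u => ∑ e, C (u e : ZMod p) * X ^ ix e
  have hq : ∀ u ∈ S, q u ≠ 0 := by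
    intro u hu h
    obtain ⟨e, he⟩ := Function.ne_iff.1 (hS u hu)
    have hc : (q u).coeff (ix e) = u e := by
      simp only [q, finsetSum_coeff, coeff_C_mul, coeff_X_pow, hix.eq_iff]
      simp
    rw [h, coeff_zero] at hc
    rcases hsign u hu e with h' | h' | h'
    · simp [h'] at hc
    · exact he h'
    · simp [h'] at hc
  have hdeg : ∀ u, (q u).natDegree ≤ Fintype.card E := fun u =>
    natDegree_sum_le_of_forall_le _ _ fun e _ => (natDegree_C_mul_X_pow_le _ _).trans (hlt e).le
  have hcard : (S.biUnion fun u => (q u).roots.toFinset).card <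
      (Finset.univ : Finset (ZMod p)).card := by
    rw [Finset.card_univ, ZMod.card]
    refine lt_of_le_of_lt (Finset.card_biUnion_le_card_mul _ _ _ fun u _ => ?_) hp
    exact (Multiset.toFinset_card_le _).trans ((card_roots' _).trans (hdeg u))
  obtain ⟨a, -, ha⟩ := Finset.exists_mem_notMem_of_card_lt_card hcard
  refine ⟨a, fun u hu h => ha (Finset.mem_biUnion.2 ⟨u, hu, ?_⟩)⟩
  rw [Multiset.mem_toFinset, mem_roots (hq u hu), IsRoot.def]
  have := congrArg (Int.cast : ℤ → ZMod p) h
  simp only [Int.cast_sum, Int.cast_mul, Int.cast_natCast, ZMod.natCast_zmod_val,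
    Int.cast_zero] at this
  simp only [q, eval_finsetSum, eval_mul, eval_C, eval_pow, eval_X]
  rw [← this]
  exact Finset.sum_congr rfl fun e _ => mul_comm _ _

/-- The members of `B` of minimum weight. -/
def minimizers {E : Type*} [DecidableEq E] (B : Finset (Finset E)) (w : E → ℕ) :
    Finset (Finset E) :=
  B.filter fun S => ∀ T ∈ B, ∑ e ∈ S, w e ≤ ∑ e ∈ T, w e

theorem mem_minimizers {E : Type*} [DecidableEq E] {B : Finset (Finset E)} {w : E → ℕ}
    {S : Finset E} :
    S ∈ minimizers B w ↔ S ∈ B ∧ ∀ T ∈ B, ∑ e ∈ S, w e ≤ ∑ e ∈ T, w e :=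
  Finset.mem_filter

theorem minimizers_nonempty {E : Type*} [DecidableEq E] {B : Finset (Finset E)}
    (hB : B.Nonempty) (w : E → ℕ) : (minimizers B w).Nonempty := by
  obtain ⟨S, hS, h⟩ := B.exists_min_image (fun S => ∑ e ∈ S, w e) hB
  exact ⟨S, mem_minimizers.2 ⟨hS, h⟩⟩

/-- The space of directions of the indicator vectors of a family. -/
noncomputable def directionSpace {E : Type*} [DecidableEq E] (B : Finset (Finset E)) :
    Submodule ℝ (E → ℝ) :=
  vectorSpan ℝ (indVec '' (B : Set (Finset E)))

theorem sum_mul_indVec {E : Type*} [Fintype E] [DecidableEq E] (w : E → ℕ) (S : Finset E) :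
    ∑ e, (w e : ℝ) * indVec S e = ((∑ e ∈ S, w e : ℕ) : ℝ) := by
  simp [indVec, Finset.sum_ite_mem]

theorem polytopeOf_eq {E : Type*} [Fintype E] [DecidableEq E] (B : Finset (Finset E)) :
    polytopeOf B = convexHull ℝ (indVec '' (B : Set (Finset E))) := by
  rw [polytopeOf]
  congr 1
  ext x
  simp [eq_comm]

/-- The minimizers of a weight function span the affine hull of a face. -/
theorem exists_face_affineSpan_eq {E : Type*} [Fintype E] [DecidableEq E]
    {B : Finset (Finset E)} (hB : B.Nonempty) (w : E → ℕ) :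
    ∃ F, IsFaceOf (polytopeOf B) F ∧
      affineSpan ℝ F = affineSpan ℝ (indVec '' (minimizers B w : Set (Finset E))) := by
  refine ⟨_, ⟨fun e => (w e : ℝ), rfl⟩, ?_⟩
  obtain ⟨S₀, hS₀⟩ := minimizers_nonempty hB w
  rw [polytopeOf_eq]
  let L : (E → ℝ) →ₗ[ℝ] ℝ := ∑ e, (w e : ℝ) • LinearMap.proj e
  have hL : ∀ x, ∑ e, (w e : ℝ) * x e = L x := fun x => by simp [L]
  have hLS : ∀ S, L (indVec S) = ((∑ e ∈ S, w e : ℕ) : ℝ) := fun S => by rw [← hL, sum_mul_indVec]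
  simp only [hL]
  have hle : ∀ S ∈ B, L (indVec S₀) ≤ L (indVec S) := fun S hS => by
    rw [hLS, hLS]
    exact_mod_cast (mem_minimizers.1 hS₀).2 S hS
  apply le_antisymm
  · refine affineSpan_le.2 fun x hx => ?_
    obtain ⟨hx, hmin⟩ := hx
    apply convexHull_subset_affineSpan
    have hxS := hmin _ (subset_convexHull ℝ _ ⟨S₀, (mem_minimizers.1 hS₀).1, rfl⟩)
    rw [← Finset.coe_image, Finset.mem_convexHull'] at hx ⊢
    obtain ⟨c, hc, hc1, rfl⟩ := hx
    have hsub : (minimizers B w).image indVec ⊆ B.image indVec :=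
      Finset.image_subset_image fun S hS => (mem_minimizers.1 hS).1
    have hsum : ∑ y ∈ B.image indVec, c y * (L y - L (indVec S₀)) ≤ 0 := by
      simp only [mul_sub, Finset.sum_sub_distrib, ← Finset.sum_mul, hc1, one_mul, sub_nonpos]
      simpa [map_sum] using hxS
    have hzero : ∀ y ∈ B.image indVec, y ∉ (minimizers B w).image indVec → c y = 0 := by
      intro y hy hy'
      have hnn : ∀ y ∈ B.image indVec, 0 ≤ c y * (L y - L (indVec S₀)) := by
        intro y hy
        obtain ⟨S, hS, rfl⟩ := Finset.mem_image.1 hy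
        exact mul_nonneg (hc _ hy) (sub_nonneg.2 (hle S hS))
      have h0 := (Finset.sum_eq_zero_iff_of_nonneg hnn).1
        (le_antisymm hsum (Finset.sum_nonneg hnn)) y hy
      refine (mul_eq_zero.1 h0).resolve_right fun h => hy' ?_
      obtain ⟨S, hS, rfl⟩ := Finset.mem_image.1 hy
      refine Finset.mem_image_of_mem _ (mem_minimizers.2 ⟨hS, fun T hT => ?_⟩)
      have := hle T hT
      rw [← sub_eq_zero.1 h, hLS, hLS] at this
      exact_mod_cast this
    refine ⟨c, fun y hy => hc y (hsub hy), ?_, ?_⟩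
    · rw [← hc1]
      exact Finset.sum_subset hsub hzero
    · exact Finset.sum_subset hsub fun y hy hy' => by rw [hzero y hy hy', zero_smul]
  · refine affineSpan_mono ℝ ?_
    rintro _ ⟨S, hS, rfl⟩
    have hS := mem_minimizers.1 hS
    refine ⟨subset_convexHull ℝ _ ⟨S, hS.1, rfl⟩, fun y hy => ?_⟩
    refine convexHull_min (t := {y | L (indVec S) ≤ L y}) ?_
      (convex_halfSpace_ge L.isLinear _) hy
    rintro _ ⟨T, hT, rfl⟩
    rw [Set.mem_ofPred_eq, hLS, hLS]
    exact_mod_cast hS.2 T hT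

/-- If all faces are cut out by totally unimodular systems, the minimizers of every weight function
have a unimodular direction space. -/
theorem isUnimodularSubspace_directionSpace {E : Type*} [Fintype E] [DecidableEq E]
    {B : Finset (Finset E)} (hB : B.Nonempty)
    (hTU : ∀ F : Set (E → ℝ), IsFaceOf (polytopeOf B) F →
      ∃ (n : ℕ) (A : Matrix (Fin n) E ℝ) (b : Fin n → ℝ), A.IsTotallyUnimodular ∧
        (affineSpan ℝ F : Set (E → ℝ)) = { x | A.mulVec x = b }) (w : E → ℕ) :
    IsUnimodularSubspace (directionSpace (minimizers B w)) := by
  obtain ⟨F, hF, hspan⟩ := exists_face_affineSpan_eq hB w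
  obtain ⟨n, A, b, hA, hAb⟩ := hTU F hF
  obtain ⟨S₀, hS₀⟩ := minimizers_nonempty hB w
  have hmem : ∀ x, x ∈ affineSpan ℝ (indVec '' (minimizers B w : Set (Finset E))) ↔
      A.mulVec x = b := fun x => by
    rw [← hspan, ← SetLike.mem_coe, hAb, Set.mem_ofPred_eq]
  have hS₀' := subset_affineSpan ℝ _ (Set.mem_image_of_mem indVec hS₀)
  have : directionSpace (minimizers B w) = LinearMap.ker A.mulVecLin := by
    ext v
    rw [directionSpace, ← direction_affineSpan,
      ← AffineSubspace.vadd_mem_iff_mem_direction v hS₀', hmem, vadd_eq_add, Matrix.mulVec_add,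
      (hmem _).1 hS₀', LinearMap.mem_ker, Matrix.mulVecLin_apply, add_eq_right]
  rw [this]
  exact hA.isUnimodularSubspace_ker

/-- A nonzero unimodular subspace contains a sign vector of minimum support. -/
theorem IsUnimodularSubspace.exists_signVector {E : Type*} [Fintype E] [DecidableEq E]
    {V : Submodule ℝ (E → ℝ)} (hV : IsUnimodularSubspace V) (hne : V ≠ ⊥) :
    ∃ u : E → ℤ, (∀ e, u e = -1 ∨ u e = 0 ∨ u e = 1) ∧ u ≠ 0 ∧ (fun e => (u e : ℝ)) ∈ V ∧
      ∀ v ∈ V, v ≠ 0 → (vecSupport fun e => (u e : ℝ)).card ≤ (vecSupport v).card := by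
  classical
  obtain ⟨v₀, hv₀, hv₀0⟩ := V.exists_mem_ne_zero_of_ne_bot hne
  obtain ⟨v, ⟨hv, hv0⟩, hmin⟩ := exists_minimalFor_of_wellFoundedLT
    (fun v : E → ℝ => v ∈ V ∧ v ≠ 0) (fun v => (vecSupport v).card) ⟨v₀, hv₀, hv₀0⟩
  obtain ⟨f, hf⟩ := Function.ne_iff.1 hv0
  rw [Pi.zero_apply] at hf
  have hel : IsElementary V v := by
    refine ⟨hv, fun w hw hvw => ⟨w f / v f, ?_⟩⟩
    by_contra hne
    have hz : w - (w f / v f) • v ≠ 0 := sub_ne_zero.2 hne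
    have hss : vecSupport (w - (w f / v f) • v) ⊂ vecSupport v := by
      refine Finset.ssubset_iff_of_subset (fun e he => ?_) |>.2 ⟨f, by simpa using hf, by simp [hf]⟩
      rw [mem_vecSupport] at he ⊢
      intro h
      exact he (by simp [h, hvw e h])
    have hlt := Finset.card_lt_card hss
    exact absurd (hmin ⟨V.sub_mem hw (V.smul_mem _ hv), hz⟩ hlt.le) (not_le.2 hlt)
  have habs : ∀ e, v e = 0 ∨ v e = v f ∨ v e = -v f := fun e => by
    by_cases he : v e = 0
    · exact Or.inl he
    · exact Or.inr (abs_eq_abs.1 (hV v hel e f he hf))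
  let u : E → ℤ := fun e => if v e = 0 then 0 else if v e = v f then 1 else -1
  have hu : (fun e => (u e : ℝ)) = (v f)⁻¹ • v := by
    funext e
    simp only [u, Pi.smul_apply, smul_eq_mul]
    rcases habs e with h | h | h
    · simp [h]
    · simp [h, hf]
    · have : -v f ≠ v f := fun h => hf (by linarith)
      simp [h, hf, this]
  have hsupp : vecSupport (fun e => (u e : ℝ)) = vecSupport v := by
    rw [hu]
    ext e
    simp [hf]
  refine ⟨u, fun e => ?_, fun h => ?_, hu ▸ V.smul_mem _ hv, fun w hw hw0 => ?_⟩
  · simp only [u]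
    split_ifs <;> simp
  · have := congrFun h f
    simp [u, hf] at this
  · rw [hsupp]
    rcases le_total (vecSupport v).card (vecSupport w).card with h | h
    · exact h
    · exact hmin ⟨hw, hw0⟩ h

theorem minimizers_mul_add_subset {E : Type*} [Fintype E] [DecidableEq E] {B : Finset (Finset E)}
    {W w : E → ℕ} {N : ℕ} (hN : ∑ e, w e < N) :
    minimizers B (fun e => N * W e + w e) ⊆ minimizers B W := by
  intro S hS
  rw [mem_minimizers] at hS ⊢
  refine ⟨hS.1, fun T hT => ?_⟩
  have h := hS.2 T hT
  simp only [Finset.sum_add_distrib, ← Finset.mul_sum] at h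
  have hTN : ∑ e ∈ T, w e < N :=
    (Finset.sum_le_univ_sum_of_nonneg fun _ => Nat.zero_le _).trans_lt hN
  have : N * ∑ e ∈ S, W e < N * (∑ e ∈ T, W e + 1) := by
    rw [mul_add, mul_one]
    omega
  exact Nat.lt_succ_iff.1 (Nat.lt_of_mul_lt_mul_left this)

theorem sum_eq_of_mem_minimizers_mul_add {E : Type*} [Fintype E] [DecidableEq E]
    {B : Finset (Finset E)} {W w : E → ℕ} {N : ℕ} (hN : ∑ e, w e < N) {S T : Finset E}
    (hS : S ∈ minimizers B fun e => N * W e + w e) (hT : T ∈ minimizers B fun e => N * W e + w e) :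
    ∑ e ∈ S, w e = ∑ e ∈ T, w e := by
  have hS' := mem_minimizers.1 (minimizers_mul_add_subset hN hS)
  have hT' := mem_minimizers.1 (minimizers_mul_add_subset hN hT)
  have hW := le_antisymm (hS'.2 T hT'.1) (hT'.2 S hS'.1)
  rw [mem_minimizers] at hS hT
  have h := le_antisymm (hS.2 T hT.1) (hT.2 S hS.1)
  simp only [Finset.sum_add_distrib, ← Finset.mul_sum, hW] at h
  omega

theorem sum_mul_eq_zero_of_mem_directionSpace {E : Type*} [Fintype E] [DecidableEq E]
    {B : Finset (Finset E)} {w : E → ℕ} (hw : ∀ S ∈ B, ∀ T ∈ B, ∑ e ∈ S, w e = ∑ e ∈ T, w e)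
    {v : E → ℝ} (hv : v ∈ directionSpace B) : ∑ e, (w e : ℝ) * v e = 0 := by
  let L : (E → ℝ) →ₗ[ℝ] ℝ := ∑ e, (w e : ℝ) • LinearMap.proj e
  have hL : ∀ x, ∑ e, (w e : ℝ) * x e = L x := fun x => by simp [L]
  have hle : directionSpace B ≤ LinearMap.ker L := by
    refine Submodule.span_le.2 ?_
    rintro _ ⟨_, ⟨S, hS, rfl⟩, _, ⟨T, hT, rfl⟩, rfl⟩
    simp only [SetLike.mem_coe, LinearMap.mem_ker, vsub_eq_sub, map_sub]
    rw [← hL, ← hL, sum_mul_indVec, sum_mul_indVec, hw S hS T hT, sub_self]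
  rw [hL]
  exact hle hv

theorem isIsolating_of_directionSpace_eq_bot {E : Type*} [DecidableEq E]
    {B : Finset (Finset E)} (hB : B.Nonempty) {w : E → ℕ}
    (h : directionSpace (minimizers B w) = ⊥) : IsIsolating B w := by
  obtain ⟨S, hS⟩ := minimizers_nonempty hB w
  refine ⟨S, mem_minimizers.1 hS, fun T hT => ?_⟩
  have hmem : indVec T - indVec S ∈ directionSpace (minimizers B w) :=
    vsub_mem_vectorSpan ℝ (Set.mem_image_of_mem _ (mem_minimizers.2 hT)) (Set.mem_image_of_mem _ hS)
  rw [h, Submodule.mem_bot, sub_eq_zero] at hmem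
  ext e
  have := congrFun hmem e
  by_cases h1 : e ∈ T <;> by_cases h2 : e ∈ S <;> simp_all [indVec]

/-- All lexicographic combinations, in base `N`, of `i` weight functions from `P`. -/
def iteratedWeights {E : Type*} [Fintype E] [DecidableEq E] (N : ℕ) (P : Finset (E → ℕ)) :
    ℕ → Finset (E → ℕ)
  | 0 => {0}
  | i + 1 => Finset.image₂ (fun W w e => N * W e + w e) (iteratedWeights N P i) P

theorem card_iteratedWeights_le {E : Type*} [Fintype E] [DecidableEq E] (N : ℕ)
    (P : Finset (E → ℕ)) (i : ℕ) : (iteratedWeights N P i).card ≤ P.card ^ i := by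
  induction i with
  | zero => simp [iteratedWeights]
  | succ i ih =>
    rw [pow_succ]
    exact (Finset.card_image₂_le _ _ _).trans (Nat.mul_le_mul_right _ ih)

theorem lt_of_mem_iteratedWeights {E : Type*} [Fintype E] [DecidableEq E] {N : ℕ}
    {P : Finset (E → ℕ)} (hP : ∀ w ∈ P, ∀ e, w e < N) {i : ℕ} {W : E → ℕ}
    (hW : W ∈ iteratedWeights N P i) (e : E) : W e < N ^ i := by
  induction i generalizing W with
  | zero => simp_all [iteratedWeights]
  | succ i ih =>
    obtain ⟨W', hW', w, hw, rfl⟩ := Finset.mem_image₂.1 hW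
    calc N * W' e + w e < N * (W' e + 1) := by
          rw [mul_add, mul_one]
          exact Nat.add_lt_add_left (hP w hw e) _
      _ ≤ N * N ^ i := Nat.mul_le_mul_left _ (ih hW')
      _ = N ^ (i + 1) := (pow_succ' _ _).symm

/-- Each further weight function can be chosen so as to double the minimum support size of the
directions that remain. -/
theorem exists_mem_iteratedWeights {E : Type*} [Fintype E] [DecidableEq E] {D : ℕ}
    (hD : 2 ^ 64 ≤ D) {N : ℕ} {P : Finset (E → ℕ)} (hN : ∀ w ∈ P, ∑ e, w e < N)
    (hP : ∀ S : Finset (E → ℤ), (∀ u ∈ S, ∀ e, u e = -1 ∨ u e = 0 ∨ u e = 1) →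
      (∀ u ∈ S, u ≠ 0) → S.card ≤ 2 * (Fintype.card E + 1) ^ D →
      ∃ w ∈ P, ∀ u ∈ S, ∑ e, (w e : ℤ) * u e ≠ 0)
    {B : Finset (Finset E)}
    (hB : ∀ w, IsUnimodularSubspace (directionSpace (minimizers B w))) (i : ℕ) :
    ∃ W ∈ iteratedWeights N P i, ∀ v ∈ directionSpace (minimizers B W), v ≠ 0 →
      2 ^ i ≤ (vecSupport v).card := by
  classical
  induction i with
  | zero =>
    refine ⟨0, by simp [iteratedWeights], fun v _ hv => ?_⟩
    obtain ⟨e, he⟩ := Function.ne_iff.1 hv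
    exact Finset.card_pos.2 ⟨e, mem_vecSupport.2 he⟩
  | succ i ih =>
    obtain ⟨W, hW, hWi⟩ := ih
    set V := directionSpace (minimizers B W) with hV
    let S : Finset (E → ℤ) := (Fintype.piFinset fun _ => ({-1, 0, 1} : Finset ℤ)).filter fun u =>
      u ≠ 0 ∧ (fun e => (u e : ℝ)) ∈ V ∧ (vecSupport fun e => (u e : ℝ)).card < 2 * 2 ^ i
    have hmem : ∀ u, u ∈ S ↔ (∀ e, u e = -1 ∨ u e = 0 ∨ u e = 1) ∧ u ≠ 0 ∧
        (fun e => (u e : ℝ)) ∈ V ∧ (vecSupport fun e => (u e : ℝ)).card < 2 * 2 ^ i := fun u => by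
      simp [S, Fintype.mem_piFinset]
    obtain ⟨w, hw, hwS⟩ := hP S (fun u hu => ((hmem u).1 hu).1) (fun u hu => ((hmem u).1 hu).2.1)
      (card_short_signVectors_le (hB W) (by positivity) hWi hD (fun u hu => ((hmem u).1 hu).1)
        fun u hu => ((hmem u).1 hu).2.2)
    refine ⟨fun e => N * W e + w e, Finset.mem_image₂_of_mem hW hw, fun v hv hv0 => ?_⟩
    obtain ⟨u, husign, hu0, hu, humin⟩ := (hB _).exists_signVector
      ((Submodule.ne_bot_iff _).2 ⟨v, hv, hv0⟩)
    refine le_trans ?_ (humin v hv hv0)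
    by_contra! hlt
    rw [pow_succ'] at hlt
    have hle : directionSpace (minimizers B fun e => N * W e + w e) ≤ V :=
      vectorSpan_mono ℝ (Set.image_mono (Finset.coe_subset.2 (minimizers_mul_add_subset (hN w hw))))
    refine hwS u ((hmem u).2 ⟨husign, hu0, hle hu, hlt⟩) ?_
    have := sum_mul_eq_zero_of_mem_directionSpace
      (fun S hS T hT => sum_eq_of_mem_minimizers_mul_add (hN w hw) hS hT) hu
    exact_mod_cast this

/-- There is a small family of small weight functions that separates few sign vectors. -/
theorem exists_separating_weights (E : Type*) [Fintype E] [DecidableEq E] (k : ℕ) :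
    ∃ p : ℕ, p ≤ 2 * (k * Fintype.card E + 1) ∧ ∃ P : Finset (E → ℕ), P.card ≤ p ∧
      (∀ w ∈ P, ∀ e, w e < p) ∧
      ∀ S : Finset (E → ℤ), (∀ u ∈ S, ∀ e, u e = -1 ∨ u e = 0 ∨ u e = 1) →
        (∀ u ∈ S, u ≠ 0) → S.card ≤ k → ∃ w ∈ P, ∀ u ∈ S, ∑ e, (w e : ℤ) * u e ≠ 0 := by
  obtain ⟨p, hp, hlt, hle⟩ := Nat.exists_prime_lt_and_le_two_mul (k * Fintype.card E + 1)
    (Nat.succ_ne_zero _)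
  have := Fact.mk hp
  have ix := Fintype.equivFin E
  refine ⟨p, hle, (Finset.univ : Finset (ZMod p)).image fun a e => (a ^ (ix e).1).val, ?_, ?_, ?_⟩
  · exact Finset.card_image_le.trans (by rw [Finset.card_univ, ZMod.card])
  · intro w hw e
    obtain ⟨a, -, rfl⟩ := Finset.mem_image.1 hw
    exact ZMod.val_lt _
  · intro S hsign h0 hS
    obtain ⟨a, ha⟩ := exists_power_weight (p := p) (ix := fun e => (ix e).1)
      (Fin.val_injective.comp ix.injective) (fun e => (ix e).2) hsign h0
      (((Nat.mul_le_mul_right _ hS).trans (Nat.le_succ _)).trans_lt hlt)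
    exact ⟨_, Finset.mem_image_of_mem _ (Finset.mem_univ a), ha⟩

theorem mul_add_one_le_pow {m D p : ℕ} (hm : 2 ≤ m)
    (hp : p ≤ 2 * (2 * (m + 1) ^ D * m + 1)) : p * m + 1 ≤ m ^ (2 * D + 6) := by
  have h1 : (m + 1) ^ D ≤ m ^ (2 * D) := by
    rw [pow_mul]
    exact Nat.pow_le_pow_left (by nlinarith) _
  have hpos : 1 ≤ m ^ (2 * D) := Nat.one_le_pow _ _ (by omega)
  have h2 : p ≤ m ^ (2 * D) * (4 * m + 2) := by nlinarith
  calc p * m + 1 ≤ m ^ (2 * D) * (4 * m + 2) * m + m ^ (2 * D) :=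
        Nat.add_le_add (Nat.mul_le_mul_right _ h2) hpos
    _ = m ^ (2 * D) * (4 * m ^ 2 + 2 * m + 1) := by ring
    _ ≤ m ^ (2 * D) * m ^ 6 := by
        refine Nat.mul_le_mul_left _ ?_
        have h4 : 2 ^ 4 ≤ m ^ 4 := Nat.pow_le_pow_left hm 4
        calc 4 * m ^ 2 + 2 * m + 1 ≤ 2 ^ 4 * m ^ 2 := by nlinarith
          _ ≤ m ^ 4 * m ^ 2 := Nat.mul_le_mul_right _ h4
          _ = m ^ 6 := by ring
    _ = m ^ (2 * D + 6) := (pow_add _ _ _).symm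

theorem cast_pow_natLog_le_rpow {m : ℕ} (hm : 2 ≤ m) (a : ℕ) :
    (m : ℝ) ^ (a * (Nat.log 2 m + 1)) ≤ (m : ℝ) ^ (3 * (a : ℝ) * Real.log m) := by
  have hm1 : (1 : ℝ) ≤ m := by exact_mod_cast (by omega : 1 ≤ m)
  have hm2 : (2 : ℝ) ≤ m := by exact_mod_cast hm
  rw [← Real.rpow_natCast]
  refine Real.rpow_le_rpow_of_exponent_le hm1 ?_
  have h2 := Real.log_two_gt_d9
  have h3 : Real.log 2 ≤ Real.log m := Real.log_le_log two_pos hm2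
  have h4 : (Nat.log 2 m : ℝ) * Real.log 2 ≤ Real.log m := by
    rw [← Real.log_pow]
    refine Real.log_le_log (by positivity) ?_
    exact_mod_cast Nat.pow_log_le_self 2 (by omega : m ≠ 0)
  have h5 : (Nat.log 2 m : ℝ) + 1 ≤ 3 * Real.log m := by
    have : (0 : ℝ) ≤ Nat.log 2 m := Nat.cast_nonneg _
    nlinarith
  push_cast
  rw [mul_comm (3 : ℝ), mul_assoc]
  exact mul_le_mul_of_nonneg_left h5 (Nat.cast_nonneg a)

/-- **Main Result** (isolation for polytopes with totally unimodular faces):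
there is an absolute constant `c > 0` such that for every ground set `E` of size `m ≥ 2`
one can find at most `m^(c log m)` weight functions with weights in `{0, …, ⌈m^(c log m)⌉}`
such that for every nonempty family `B ⊆ 2^E` for which the affine hull of every face of
`P(B)` is the solution set of a totally unimodular linear system, at least one of the
weight functions is isolating for `B`. -/
theorem isolation_for_TU_faces :
    ∃ c : ℝ, 0 < c ∧
      ∀ (E : Type) [Fintype E] [DecidableEq E], ∀ m : ℕ, Fintype.card E = m → 2 ≤ m →
        ∃ W : Finset (E → ℕ),
          (W.card : ℝ) ≤ (m : ℝ) ^ (c * Real.log m) ∧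
          (∀ w ∈ W, ∀ e : E, w e ≤ ⌈(m : ℝ) ^ (c * Real.log m)⌉₊) ∧
          ∀ B : Finset (Finset E), B.Nonempty →
            (∀ F : Set (E → ℝ), IsFaceOf (polytopeOf B) F →
              ∃ (n : ℕ) (A : Matrix (Fin n) E ℝ) (b : Fin n → ℝ),
                A.IsTotallyUnimodular ∧
                (affineSpan ℝ F : Set (E → ℝ)) = { x | A.mulVec x = b }) →
            ∃ w ∈ W, IsIsolating B w := by
  obtain ⟨D, hD⟩ : ∃ D, 2 ^ 64 ≤ D := ⟨2 ^ 64, le_rfl⟩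
  refine ⟨3 * (2 * D + 6), by positivity, fun E _ _ m hm hm2 => ?_⟩
  obtain ⟨p, hp, P, hPp, hPlt, hPsep⟩ :=
    exists_separating_weights E (2 * (Fintype.card E + 1) ^ D)
  rw [hm] at hp
  have hN := mul_add_one_le_pow hm2 hp
  have hlog := cast_pow_natLog_le_rpow hm2 (2 * D + 6)
  push_cast at hlog
  have hbound : (p * m + 1) ^ (Nat.log 2 m + 1) ≤ m ^ ((2 * D + 6) * (Nat.log 2 m + 1)) := by
    rw [pow_mul]
    exact Nat.pow_le_pow_left hN _
  have hbound' : (((p * m + 1) ^ (Nat.log 2 m + 1) : ℕ) : ℝ) ≤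
      (m : ℝ) ^ (3 * (2 * D + 6) * Real.log m) := by
    refine le_trans ?_ hlog
    exact_mod_cast hbound
  have hpN : p ≤ p * m + 1 := (Nat.le_mul_of_pos_right p (by omega)).trans (Nat.le_succ _)
  refine ⟨iteratedWeights (p * m + 1) P (Nat.log 2 m + 1), ?_, fun w hw e => ?_, fun B hB hTU => ?_⟩
  · refine le_trans ?_ hbound'
    exact_mod_cast (card_iteratedWeights_le _ _ _).trans (Nat.pow_le_pow_left (hPp.trans hpN) _)
  · have := lt_of_mem_iteratedWeights (fun w hw e => (hPlt w hw e).trans_le hpN) hw e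
    exact_mod_cast (Nat.cast_le.2 this.le).trans (hbound'.trans (Nat.le_ceil _))
  · obtain ⟨W, hW, hWsupp⟩ := exists_mem_iteratedWeights hD (N := p * m + 1) (fun w hw => by
      have : ∑ e, w e ≤ _ :=
        Finset.sum_le_card_nsmul Finset.univ _ p fun e _ => (hPlt w hw e).le
      rw [Finset.card_univ, hm, smul_eq_mul, mul_comm] at this
      omega) hPsep (isUnimodularSubspace_directionSpace hB hTU) (Nat.log 2 m + 1)
    refine ⟨W, hW, isIsolating_of_directionSpace_eq_bot hB
      ((Submodule.eq_bot_iff _).2 fun v hv => ?_)⟩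
    by_contra hv0
    refine absurd (Nat.lt_pow_succ_log_self one_lt_two m) (not_lt.2 ?_)
    exact (hWsupp v hv hv0).trans ((Finset.card_le_univ _).trans hm.le)
end

section
/- For every real constant c > 1 and every natural number d there is a constant c' > 0 with the following property. For every finite set E with |E| = m ≥ 2 there exists a set W of at most m^{c'·log m} weight functions w : E → {0, 1, …, ⌈m^{c'·log m}⌉} (depending only on m, c, d) such that: for every nonempty family B ⊆ 2^E satisfying that for every face F of P(B) the number of nonzero vectors v ∈ L_F with ‖v‖₁ < c·λ(L_F) is at most m^d, at least one weight function in W is isolating for B. -/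
/-- The members of `B` of minimum `w`-weight. -/
def argminFamily {E : Type*} [DecidableEq E] (B : Finset (Finset E)) (w : E → ℕ) :
    Finset (Finset E) :=
  B.filter fun S => ∀ T ∈ B, ∑ e ∈ S, w e ≤ ∑ e ∈ T, w e

lemma mem_argminFamily {E : Type*} [DecidableEq E] {B : Finset (Finset E)} {w : E → ℕ}
    {S : Finset E} :
    S ∈ argminFamily B w ↔ S ∈ B ∧ ∀ T ∈ B, ∑ e ∈ S, w e ≤ ∑ e ∈ T, w e :=
  Finset.mem_filter

/-- The linear functional `x ↦ ∑ e, w e * x e`. -/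
noncomputable def weightFunctional {E : Type*} [Fintype E] (w : E → ℝ) : (E → ℝ) →ₗ[ℝ] ℝ :=
  ∑ e, w e • LinearMap.proj e

lemma weightFunctional_apply {E : Type*} [Fintype E] (w x : E → ℝ) :
    weightFunctional w x = ∑ e, w e * x e := by
  simp [weightFunctional]

lemma weightFunctional_indVec {E : Type*} [Fintype E] [DecidableEq E] (w : E → ℕ)
    (S : Finset E) :
    weightFunctional (fun e => (w e : ℝ)) (indVec S) = ((∑ e ∈ S, w e : ℕ) : ℝ) := by
  simp [weightFunctional_apply, indVec]

lemma mem_convexHull_of_eq_lower_bound {V : Type*} [AddCommGroup V] [Module ℝ V] {A : Set V}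
    (f : V →ₗ[ℝ] ℝ) {μ : ℝ} (h : ∀ a ∈ A, μ ≤ f a) {x : V} (hx : x ∈ convexHull ℝ A)
    (hfx : f x = μ) : x ∈ convexHull ℝ {a ∈ A | f a = μ} := by
  have key : convexHull ℝ A ⊆
      {x | μ ≤ f x ∧ (f x = μ → x ∈ convexHull ℝ {a ∈ A | f a = μ})} := by
    refine convexHull_min (fun a ha => ⟨h a ha, fun hf => subset_convexHull ℝ _ ⟨ha, hf⟩⟩) ?_
    refine convex_iff_forall_pos.2 fun y hy z hz a b ha hb hab => ?_
    obtain ⟨hy1, hy2⟩ := hy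
    obtain ⟨hz1, hz2⟩ := hz
    have hb' : b = 1 - a := by linarith
    refine ⟨?_, fun hf => ?_⟩
    · simp only [map_add, map_smul, smul_eq_mul]
      subst hb'
      nlinarith
    · simp only [map_add, map_smul, smul_eq_mul] at hf
      have h1 : a * (f y - μ) + b * (f z - μ) = 0 := by
        subst hb'
        linarith
      have h2 := mul_nonneg ha.le (sub_nonneg.2 hy1)
      have h3 := mul_nonneg hb.le (sub_nonneg.2 hz1)
      have h4 : a * (f y - μ) = 0 := by linarith
      have h5 : b * (f z - μ) = 0 := by linarith
      have hfy : f y = μ := by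
        rcases mul_eq_zero.1 h4 with h | h <;> linarith
      have hfz : f z = μ := by
        rcases mul_eq_zero.1 h5 with h | h <;> linarith
      exact convex_convexHull ℝ _ (hy2 hfy) (hz2 hfz) ha.le hb.le hab
  exact (key hx).2 hfx

lemma argminFamily_nonempty {E : Type*} [DecidableEq E] {B : Finset (Finset E)}
    (hB : B.Nonempty) (w : E → ℕ) : (argminFamily B w).Nonempty := by
  obtain ⟨S, hS, hmin⟩ := B.exists_min_image (fun S => ∑ e ∈ S, w e) hB
  exact ⟨S, mem_argminFamily.2 ⟨hS, hmin⟩⟩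

lemma polytopeOf_mono {E : Type*} [Fintype E] [DecidableEq E] {A B : Finset (Finset E)}
    (h : A ⊆ B) : polytopeOf A ⊆ polytopeOf B :=
  convexHull_mono fun _ ⟨S, hS, hx⟩ => ⟨S, h hS, hx⟩

lemma faceLattice_mono {E : Type*} {F G : Set (E → ℝ)} (h : F ⊆ G) :
    faceLattice F ⊆ faceLattice G :=
  fun _ ⟨x₁, h₁, x₂, h₂, hv⟩ => ⟨x₁, h h₁, x₂, h h₂, hv⟩

lemma isFaceOf_argminFamily {E : Type*} [Fintype E] [DecidableEq E] {B : Finset (Finset E)}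
    (hB : B.Nonempty) (w : E → ℕ) :
    IsFaceOf (polytopeOf B) (polytopeOf (argminFamily B w)) := by
  obtain ⟨S₀, hS₀⟩ := argminFamily_nonempty hB w
  obtain ⟨hS₀B, hS₀min⟩ := mem_argminFamily.1 hS₀
  set f := weightFunctional (fun e => (w e : ℝ)) with hf
  set μ : ℝ := ((∑ e ∈ S₀, w e : ℕ) : ℝ) with hμ
  have hlow : ∀ x ∈ polytopeOf B, μ ≤ f x := by
    refine convexHull_min ?_ (convex_halfSpace_ge f.isLinear μ)
    rintro _ ⟨T, hT, rfl⟩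
    change μ ≤ f (indVec T)
    rw [hf, weightFunctional_indVec, hμ]
    exact_mod_cast hS₀min T hT
  refine ⟨fun e => (w e : ℝ), ?_⟩
  simp only [← weightFunctional_apply, ← hf]
  ext x
  constructor
  · intro hx
    refine ⟨polytopeOf_mono (fun S hS => (mem_argminFamily.1 hS).1) hx, fun y hy => le_trans ?_ (hlow y hy)⟩
    refine convexHull_min ?_ (convex_halfSpace_le f.isLinear μ) hx
    rintro _ ⟨T, hT, rfl⟩
    change f (indVec T) ≤ μ
    rw [hf, weightFunctional_indVec, hμ]
    exact_mod_cast (mem_argminFamily.1 hT).2 S₀ hS₀B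
  · rintro ⟨hx, hmin⟩
    have hxμ : f x = μ := by
      refine le_antisymm ?_ (hlow x hx)
      have := hmin (indVec S₀) (subset_convexHull ℝ _ ⟨S₀, hS₀B, rfl⟩)
      rwa [hf, weightFunctional_indVec] at this
    refine convexHull_mono ?_ (mem_convexHull_of_eq_lower_bound f
      (fun a ha => hlow a (subset_convexHull ℝ _ ha)) hx hxμ)
    rintro _ ⟨⟨S, hS, rfl⟩, hSμ⟩
    refine ⟨S, mem_argminFamily.2 ⟨hS, fun T hT => ?_⟩, rfl⟩
    rw [hf, weightFunctional_indVec, hμ] at hSμ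
    exact (Nat.cast_injective hSμ).le.trans (hS₀min T hT)

lemma sum_mul_eq_zero_of_mem_faceLattice {E : Type*} [Fintype E] [DecidableEq E]
    {A : Finset (Finset E)} {w : E → ℕ}
    (hw : ∀ S ∈ A, ∀ T ∈ A, ∑ e ∈ S, w e = ∑ e ∈ T, w e) {v : E → ℤ}
    (hv : v ∈ faceLattice (polytopeOf A)) : ∑ e, v e * (w e : ℤ) = 0 := by
  obtain ⟨x₁, h₁, x₂, h₂, α, hα⟩ := hv
  set f := weightFunctional (fun e => (w e : ℝ)) with hf
  have hne : A.Nonempty := by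
    obtain ⟨_, S, hS, -⟩ := convexHull_nonempty_iff.1 ⟨x₁, h₁⟩
    exact ⟨S, hS⟩
  obtain ⟨S₀, hS₀⟩ := hne
  have hconst : ∀ x ∈ polytopeOf A, f x = ((∑ e ∈ S₀, w e : ℕ) : ℝ) := by
    refine convexHull_min ?_ (convex_hyperplane f.isLinear _)
    rintro _ ⟨T, hT, rfl⟩
    change f (indVec T) = _
    rw [hf, weightFunctional_indVec, hw T hT S₀ hS₀]
  have h : f (fun e => (v e : ℝ)) = 0 := by
    rw [hα, map_smul, map_sub, hconst x₁ h₁, hconst x₂ h₂, sub_self, smul_zero]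
  rw [hf, weightFunctional_apply] at h
  have h' : ((∑ e, v e * (w e : ℤ) : ℤ) : ℝ) = 0 := by
    rw [← h]
    push_cast
    exact Finset.sum_congr rfl fun e _ => mul_comm _ _
  exact_mod_cast h'

lemma argminFamily_lex {E : Type*} [Fintype E] [DecidableEq E] {B : Finset (Finset E)}
    {u w : E → ℕ} {N : ℕ} (hN : ∑ e, w e < N) {S : Finset E}
    (hS : S ∈ argminFamily B fun e => N * u e + w e) :
    S ∈ argminFamily B u ∧ ∀ T ∈ argminFamily B u, ∑ e ∈ S, w e ≤ ∑ e ∈ T, w e := by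
  obtain ⟨hSB, hmin⟩ := mem_argminFamily.1 hS
  simp only [Finset.sum_add_distrib, ← Finset.mul_sum] at hmin
  have hSu : S ∈ argminFamily B u := by
    refine mem_argminFamily.2 ⟨hSB, fun T hT => ?_⟩
    by_contra! hlt
    have h1 := hmin T hT
    have h2 : ∑ e ∈ T, w e ≤ ∑ e, w e :=
      Finset.sum_le_sum_of_subset (Finset.subset_univ T)
    have h3 := Nat.mul_le_mul_left N (Nat.succ_le_of_lt hlt)
    rw [Nat.mul_succ] at h3
    omega
  refine ⟨hSu, fun T hT => ?_⟩
  obtain ⟨hTB, hTmin⟩ := mem_argminFamily.1 hT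
  have h1 := hmin T hTB
  have h2 : ∑ e ∈ S, u e = ∑ e ∈ T, u e :=
    le_antisymm ((mem_argminFamily.1 hSu).2 T hTB) (hTmin S hSB)
  rw [h2] at h1
  omega

lemma isIsolating_of_subsingleton {E : Type*} [DecidableEq E] {B : Finset (Finset E)}
    (hB : B.Nonempty) {w : E → ℕ}
    (h : ∀ S ∈ argminFamily B w, ∀ T ∈ argminFamily B w, S = T) : IsIsolating B w := by
  obtain ⟨S, hS⟩ := argminFamily_nonempty hB w
  exact ⟨S, mem_argminFamily.1 hS, fun T hT => h T (mem_argminFamily.2 hT) S hS⟩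

/-- Two distinct members of `A` give a short nonzero vector in the lattice of its polytope. -/
lemma exists_mem_faceLattice_l1norm_le {E : Type*} [Fintype E] [DecidableEq E]
    {A : Finset (Finset E)} {S T : Finset E} (hS : S ∈ A) (hT : T ∈ A) (hST : S ≠ T) :
    ∃ v ∈ faceLattice (polytopeOf A), v ≠ 0 ∧ l1norm v ≤ Fintype.card E := by
  refine ⟨fun e => (if e ∈ S then 1 else 0) - (if e ∈ T then 1 else 0),
    ⟨indVec S, subset_convexHull ℝ _ ⟨S, hS, rfl⟩, indVec T,
      subset_convexHull ℝ _ ⟨T, hT, rfl⟩, 1, ?_⟩, fun h => hST ?_, ?_⟩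
  · ext e
    simp [indVec]
  · ext e
    have := congrFun h e
    by_cases h1 : e ∈ S <;> by_cases h2 : e ∈ T <;> simp_all
  · rw [l1norm, ← Finset.card_univ, Finset.card_eq_sum_ones]
    refine Finset.sum_le_sum fun e _ => ?_
    split_ifs <;> simp

lemma exists_ne_of_mem_faceLattice {E : Type*} [Fintype E] [DecidableEq E]
    {A : Finset (Finset E)} {v : E → ℤ} (hv : v ∈ faceLattice (polytopeOf A)) (h0 : v ≠ 0) :
    ∃ S ∈ A, ∃ T ∈ A, S ≠ T := by
  by_contra! h
  obtain ⟨x₁, h₁, x₂, h₂, α, hα⟩ := hv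
  have hsub : {x | ∃ S ∈ A, x = indVec S}.Subsingleton := by
    rintro _ ⟨S, hS, rfl⟩ _ ⟨T, hT, rfl⟩
    rw [h S hS T hT]
  have hx : x₁ = x₂ := by
    obtain ⟨a, ha⟩ := convexHull_nonempty_iff.1 ⟨x₁, h₁⟩
    rw [polytopeOf, hsub.eq_singleton_of_mem ha, convexHull_singleton] at h₁ h₂
    exact h₁.trans h₂.symm
  refine h0 (funext fun e => ?_)
  have := congrFun hα e
  simpa [hx] using this

lemma lambda1_le {E : Type*} [Fintype E] {L : Set (E → ℤ)} {v : E → ℤ} (hv : v ∈ L)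
    (h0 : v ≠ 0) : lambda1 L ≤ l1norm v :=
  Nat.sInf_le ⟨v, hv, h0, rfl⟩

lemma exists_l1norm_eq_lambda1 {E : Type*} [Fintype E] {L : Set (E → ℤ)} {v : E → ℤ}
    (hv : v ∈ L) (h0 : v ≠ 0) : ∃ u ∈ L, u ≠ 0 ∧ l1norm u = lambda1 L :=
  Nat.sInf_mem (s := {k | ∃ v ∈ L, v ≠ 0 ∧ l1norm v = k}) ⟨_, v, hv, h0, rfl⟩

lemma natAbs_le_l1norm {E : Type*} [Fintype E] (v : E → ℤ) (e : E) :
    (v e).natAbs ≤ l1norm v :=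
  Finset.single_le_sum (f := fun e => (v e).natAbs) (fun _ _ => Nat.zero_le _)
    (Finset.mem_univ e)

lemma finite_of_l1norm_le {E : Type*} [Fintype E] {V : Set (E → ℤ)} (n : ℕ)
    (hV : ∀ v ∈ V, l1norm v ≤ n) : V.Finite := by
  classical
  refine (Set.finite_Icc (fun _ : E => -(n : ℤ)) (fun _ => (n : ℤ))).subset fun v hv => ?_
  have h := fun e => (natAbs_le_l1norm v e).trans (hV v hv)
  exact ⟨fun e => by have := h e; dsimp only; omega, fun e => by have := h e; dsimp only; omega⟩

/-- The weight function of powers of `a` modulo `p`. -/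
def powerWeight {E : Type*} {m : ℕ} (idx : E ≃ Fin m) (p : ℕ) (a : ZMod p) (e : E) : ℕ :=
  (a ^ (idx e : ℕ)).val

open Polynomial in
/-- Fewer than `p / m` small nonzero vectors are simultaneously avoided by the orthogonal
hyperplane of some power weight modulo `p`. -/
lemma exists_powerWeight_sum_ne_zero {E : Type*} [Fintype E] {m : ℕ} (idx : E ≃ Fin m) (p : ℕ)
    [Fact p.Prime] {V : Set (E → ℤ)} (hfin : V.Finite) (hcard : V.ncard * m < p)
    (h0 : ∀ v ∈ V, v ≠ 0) (hlt : ∀ v ∈ V, ∀ e, (v e).natAbs < p) :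
    ∃ a : ZMod p, ∀ v ∈ V, ∑ e, v e * (powerWeight idx p a e : ℤ) ≠ 0 := by
  classical
  let P : (E → ℤ) → (ZMod p)[X] := fun v => ∑ e, C (v e : ZMod p) * X ^ (idx e : ℕ)
  have hPne : ∀ v ∈ V, P v ≠ 0 := by
    intro v hv hP
    obtain ⟨e, he⟩ := Function.ne_iff.1 (h0 v hv)
    have hc : (P v).coeff (idx e) = (v e : ZMod p) := by
      simp only [P, finsetSum_coeff, coeff_C_mul, coeff_X_pow]
      rw [Finset.sum_eq_single e]
      · simp
      · intro b _ hb
        rw [if_neg, mul_zero]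
        exact fun h => hb (idx.injective (Fin.ext h)).symm
      · simp
    rw [hP, coeff_zero] at hc
    have hd := Int.natAbs_dvd_natAbs.2 ((ZMod.intCast_zmod_eq_zero_iff_dvd _ p).1 hc.symm)
    rw [Int.natAbs_natCast] at hd
    exact he (Int.natAbs_eq_zero.1 (Nat.eq_zero_of_dvd_of_lt hd (hlt v hv e)))
  have hdeg : ∀ v, (P v).natDegree ≤ m := fun v =>
    natDegree_sum_le_of_forall_le _ _ fun e _ =>
      (natDegree_C_mul_X_pow_le _ _).trans (idx e).2.le
  let bad : Finset (ZMod p) := hfin.toFinset.biUnion fun v => (P v).roots.toFinset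
  have hbad : bad.card < Fintype.card (ZMod p) := by
    rw [ZMod.card]
    refine lt_of_le_of_lt ?_ hcard
    rw [Set.ncard_eq_toFinset_card V hfin]
    exact Finset.card_biUnion_le_card_mul _ _ _ fun v _ =>
      (Multiset.toFinset_card_le _).trans ((card_roots' _).trans (hdeg v))
  obtain ⟨a, ha⟩ := Finset.exists_mem_notMem_of_card_lt_card
    (s := bad) (t := Finset.univ) (by rwa [Finset.card_univ])
  refine ⟨a, fun v hv hsum => ha.2 ?_⟩
  refine Finset.mem_biUnion.2 ⟨v, hfin.mem_toFinset.2 hv, Multiset.mem_toFinset.2 ?_⟩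
  rw [mem_roots (hPne v hv), IsRoot.def]
  have := congrArg (Int.cast : ℤ → ZMod p) hsum
  simpa [P, eval_finsetSum, powerWeight] using this

/-- All base-`N` combinations of `k` power weights modulo `p`. -/
def combinedWeights {E : Type*} [Fintype E] [DecidableEq E] {m : ℕ} (idx : E ≃ Fin m) (p : ℕ)
    [NeZero p] (N : ℕ) : ℕ → Finset (E → ℕ)
  | 0 => {0}
  | k + 1 => Finset.image₂ (fun u a e => N * u e + powerWeight idx p a e)
      (combinedWeights idx p N k) Finset.univ

lemma card_combinedWeights_le {E : Type*} [Fintype E] [DecidableEq E] {m : ℕ}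
    (idx : E ≃ Fin m) (p : ℕ) [NeZero p] (N k : ℕ) :
    (combinedWeights idx p N k).card ≤ p ^ k := by
  induction k with
  | zero => simp [combinedWeights]
  | succ k ih =>
    refine (Finset.card_image₂_le _ _ _).trans ?_
    rw [Finset.card_univ, ZMod.card, pow_succ]
    exact Nat.mul_le_mul_right _ ih

lemma combinedWeights_lt {E : Type*} [Fintype E] [DecidableEq E] {m : ℕ}
    (idx : E ≃ Fin m) (p : ℕ) [NeZero p] {N : ℕ} (hN : p ≤ N) (k : ℕ) :
    ∀ w ∈ combinedWeights idx p N k, ∀ e, w e < N ^ k := by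
  induction k with
  | zero => simp [combinedWeights]
  | succ k ih =>
    intro w hw e
    obtain ⟨u, hu, a, -, rfl⟩ := Finset.mem_image₂.1 hw
    have h1 : powerWeight idx p a e < p := ZMod.val_lt _
    have h2 := Nat.mul_le_mul_left N (Nat.succ_le_of_lt (ih u hu e))
    rw [Nat.mul_succ] at h2
    rw [pow_succ']
    dsimp only
    omega

/-- Appending a suitable power weight multiplies the minimum norm of the face lattice by `c`. -/
lemma exists_combinedWeights_pow_le_l1norm {E : Type*} [Fintype E] [DecidableEq E] {m : ℕ}
    (idx : E ≃ Fin m) (hm : 0 < m) (p : ℕ) [Fact p.Prime] {c : ℝ} (hc : 1 < c) {n : ℕ}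
    (hcp : c * m ≤ p) (hnp : n * m < p) {B : Finset (Finset E)} (hB : B.Nonempty)
    (hF : ∀ F : Set (E → ℝ), IsFaceOf (polytopeOf B) F →
      Set.ncard { v | v ∈ faceLattice F ∧ v ≠ 0 ∧
        (l1norm v : ℝ) < c * (lambda1 (faceLattice F) : ℝ) } ≤ n) (k : ℕ) :
    ∃ w ∈ combinedWeights idx p (m * p) k,
      ∀ v ∈ faceLattice (polytopeOf (argminFamily B w)), v ≠ 0 → c ^ k ≤ (l1norm v : ℝ) := by
  have hcardE : Fintype.card E = m := by simpa using Fintype.card_congr idx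
  induction k with
  | zero =>
    refine ⟨0, by simp [combinedWeights], fun v _ h0 => ?_⟩
    obtain ⟨e, he⟩ := Function.ne_iff.1 h0
    rw [pow_zero]
    exact_mod_cast (Int.natAbs_pos.2 he).trans_le (natAbs_le_l1norm v e)
  | succ k ih =>
    obtain ⟨u, hu, hlow⟩ := ih
    set L := faceLattice (polytopeOf (argminFamily B u)) with hL
    set V := { v | v ∈ L ∧ v ≠ 0 ∧ (l1norm v : ℝ) < c * (lambda1 L : ℝ) } with hV
    have hVcard : V.ncard ≤ n := hF _ (isFaceOf_argminFamily hB u)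
    have hVp : ∀ v ∈ V, l1norm v < p := by
      rintro v ⟨hvL, hv0, hvc⟩
      obtain ⟨S, hS, T, hT, hST⟩ := exists_ne_of_mem_faceLattice hvL hv0
      obtain ⟨x, hx, hx0, hxm⟩ := exists_mem_faceLattice_l1norm_le hS hT hST
      have h1 : (lambda1 L : ℝ) ≤ m := by
        exact_mod_cast hcardE ▸ (lambda1_le hx hx0).trans hxm
      have h2 : (l1norm v : ℝ) < p :=
        hvc.trans_le ((mul_le_mul_of_nonneg_left h1 (by linarith)).trans hcp)
      exact_mod_cast h2
    obtain ⟨a, ha⟩ := exists_powerWeight_sum_ne_zero idx p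
      (finite_of_l1norm_le p fun v hv => (hVp v hv).le)
      ((Nat.mul_le_mul_right m hVcard).trans_lt hnp) (fun v hv => hv.2.1)
      (fun v hv e => (natAbs_le_l1norm v e).trans_lt (hVp v hv))
    have hsum : ∑ e, powerWeight idx p a e < m * p := by
      have : Nonempty E := ⟨idx.symm ⟨0, hm⟩⟩
      calc ∑ e, powerWeight idx p a e < ∑ _e : E, p :=
            Finset.sum_lt_sum_of_nonempty Finset.univ_nonempty fun e _ => ZMod.val_lt _
        _ = m * p := by simp [hcardE]
    refine ⟨_, Finset.mem_image₂_of_mem hu (Finset.mem_univ a), fun v hv h0 => ?_⟩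
    have hvL : v ∈ L := faceLattice_mono
      (polytopeOf_mono fun S hS => (argminFamily_lex hsum hS).1) hv
    have horth : ∑ e, v e * (powerWeight idx p a e : ℤ) = 0 := by
      refine sum_mul_eq_zero_of_mem_faceLattice (fun S hS T hT => ?_) hv
      have h1 := argminFamily_lex hsum hS
      have h2 := argminFamily_lex hsum hT
      exact le_antisymm (h1.2 T h2.1) (h2.2 S h1.1)
    obtain ⟨x, hxL, hx0, hx⟩ := exists_l1norm_eq_lambda1 hvL h0
    have hnot : c * (lambda1 L : ℝ) ≤ l1norm v := by
      by_contra! hlt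
      exact ha v ⟨hvL, h0, hlt⟩ horth
    have h1 := hlow x hxL hx0
    rw [hx] at h1
    rw [pow_succ']
    exact (mul_le_mul_of_nonneg_left h1 (by linarith)).trans hnot

lemma pow_le_rpow_log {m N D k : ℕ} {K : ℝ} (hm : 2 ≤ m) (hN : N ≤ m ^ D)
    (hk : (k : ℝ) ≤ K * Real.log m) :
    (N : ℝ) ^ k ≤ (m : ℝ) ^ (D * K * Real.log m) := by
  have hm1 : (1 : ℝ) ≤ m := by exact_mod_cast (by omega : 1 ≤ m)
  calc (N : ℝ) ^ k ≤ ((m : ℝ) ^ D) ^ k := by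
        gcongr
        exact_mod_cast hN
    _ = (m : ℝ) ^ ((D : ℝ) * k) := by
        rw [← pow_mul, ← Real.rpow_natCast]
        push_cast
        rfl
    _ ≤ (m : ℝ) ^ (D * K * Real.log m) := by
        refine Real.rpow_le_rpow_of_exponent_le hm1 ?_
        rw [mul_assoc]
        gcongr

/-- **Isolation via lattices**: for every `c > 1` and every `d` there is `c' > 0` such that
for every ground set `E` of size `m ≥ 2` there are at most `m^(c' log m)` weight functions,
with weights in `{0, …, ⌈m^(c' log m)⌉}`, such that for any nonempty family `B ⊆ 2^E` with
the property that for every face `F` of `P(B)` the number of nonzero `v ∈ L_F` with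
`‖v‖₁ < c·λ(L_F)` is at most `m^d`, one of the weight functions is isolating for `B`. -/
theorem isolation_via_lattices (c : ℝ) (hc : 1 < c) (d : ℕ) :
    ∃ c' : ℝ, 0 < c' ∧
      ∀ (E : Type) [Fintype E] [DecidableEq E], ∀ m : ℕ, Fintype.card E = m → 2 ≤ m →
        ∃ W : Finset (E → ℕ),
          (W.card : ℝ) ≤ (m : ℝ) ^ (c' * Real.log m) ∧
          (∀ w ∈ W, ∀ e : E, w e ≤ ⌈(m : ℝ) ^ (c' * Real.log m)⌉₊) ∧
          ∀ B : Finset (Finset E), B.Nonempty →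
            (∀ F : Set (E → ℝ), IsFaceOf (polytopeOf B) F →
              Set.ncard { v | v ∈ faceLattice F ∧ v ≠ 0 ∧
                  (l1norm v : ℝ) < c * (lambda1 (faceLattice F) : ℝ) } ≤ m ^ d) →
            ∃ w ∈ W, IsIsolating B w := by
  have hlogc : 0 < Real.log c := Real.log_pos hc
  have hlog2 : 0 < Real.log 2 := Real.log_pos one_lt_two
  set C := ⌈c⌉₊ with hC
  have hC1 : 1 ≤ C := Nat.one_le_ceil_iff.2 (by linarith)
  set K : ℝ := 1 / Real.log c + 1 / Real.log 2 with hK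
  refine ⟨(C + d + 3 : ℕ) * K, by positivity, ?_⟩
  intro E _ _ m hcard hm
  have hm0 : 0 < m := by omega
  have idx : E ≃ Fin m := Fintype.equivFinOfCardEq hcard
  obtain ⟨p, hp, hpl, hpu⟩ := Nat.exists_prime_lt_and_le_two_mul (C * m ^ (d + 1))
    (by positivity)
  have : Fact p.Prime := ⟨hp⟩
  have hmlog : Real.log 2 ≤ Real.log m :=
    Real.log_le_log two_pos (by exact_mod_cast hm)
  set k := ⌊Real.log m / Real.log c⌋₊ + 1 with hk
  have hkK : (k : ℝ) ≤ K * Real.log m := by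
    have h1 := Nat.floor_le (div_nonneg (hlog2.le.trans hmlog) hlogc.le)
    have h2 : 1 ≤ Real.log m / Real.log 2 := (one_le_div hlog2).2 hmlog
    have h3 : K * Real.log m = Real.log m / Real.log c + Real.log m / Real.log 2 := by
      rw [hK]
      ring
    rw [hk, h3]
    push_cast
    linarith
  have hmck : (m : ℝ) < c ^ k := by
    have h1 : Real.log m < k * Real.log c := by
      rw [← div_lt_iff₀ hlogc, hk]
      push_cast
      exact Nat.lt_floor_add_one _
    rw [← Real.log_pow] at h1
    exact (Real.log_lt_log_iff (by positivity) (by positivity)).1 h1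
  have hN : m * p ≤ m ^ (C + d + 3) := by
    have h1 : C ≤ m ^ C := (Nat.lt_pow_self (by omega)).le
    calc m * p ≤ m * (m * (m ^ C * m ^ (d + 1))) := by gcongr; exact hpu.trans (by gcongr)
      _ = m ^ (C + d + 3) := by ring
  have hbound := pow_le_rpow_log hm hN hkK
  refine ⟨combinedWeights idx p (m * p) k, ?_, ?_, ?_⟩
  · refine le_trans ?_ hbound
    have h := (card_combinedWeights_le idx p (m * p) k).trans
      (Nat.pow_le_pow_left (Nat.le_mul_of_pos_left p hm0) k)
    exact_mod_cast h
  · intro w hw e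
    have h := (combinedWeights_lt idx p (Nat.le_mul_of_pos_left p hm0) k w hw e).le
    have h' : ((w e : ℕ) : ℝ) ≤ ((m * p : ℕ) : ℝ) ^ k := by exact_mod_cast h
    exact_mod_cast (h'.trans hbound).trans (Nat.le_ceil _)
  · intro B hB hF
    have hcp : c * m ≤ p := by
      have h1 : C * m ≤ p := by
        refine le_trans ?_ hpl.le
        gcongr
        exact Nat.le_self_pow (by omega) m
      calc c * m ≤ C * m := by gcongr; exact Nat.le_ceil c
        _ ≤ p := by exact_mod_cast h1
    have hnp : m ^ d * m < p := by
      rw [← pow_succ]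
      exact (Nat.le_mul_of_pos_left _ hC1).trans_lt hpl
    obtain ⟨w, hw, hlow⟩ :=
      exists_combinedWeights_pow_le_l1norm idx hm0 p hc hcp hnp hB hF k
    refine ⟨w, hw, isIsolating_of_subsingleton hB fun S hS T hT => ?_⟩
    by_contra hST
    obtain ⟨v, hv, hv0, hvm⟩ := exists_mem_faceLattice_l1norm_le hS hT hST
    have h1 := hlow v hv hv0
    have h2 : (l1norm v : ℝ) ≤ m := by exact_mod_cast hcard ▸ hvm
    linarith
end

section
/- Let m, k, t be positive integers with t ≥ 2, and let q := ⌈m·k·log₂ t⌉; assume q ≥ 7. Then there exist weight vectors w_1, w_2, …, w_q ∈ {0, 1, 2, …, q}^m such that for every collection of nonzero vectors v_1, v_2, …, v_k ∈ ℤ^m with all coordinates of absolute value at most t − 1, there exists j ∈ {1, …, q} such that ⟨w_j, v_i⟩ ≠ 0 for all i ∈ {1, …, k}. (Concretely, one may take w_j to be the vector (1, t, t², …, t^{m−1}) with each coordinate reduced modulo j.) -/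
/-- The Kummer-type divisibility `k * (n choose k) ∣ lcm (1, …, n)`. -/
theorem mul_choose_dvd_lcmUpto {n k : ℕ} (hk : 0 < k) (hkn : k ≤ n) :
    k * n.choose k ∣ Nat.lcmUpto n := by
  have hc := Nat.choose_ne_zero hkn
  rw [← Nat.factorization_prime_le_iff_dvd (mul_ne_zero hk.ne' hc) (Nat.lcmUpto_ne_zero n)]
  intro p hp
  have hlog : Nat.log p k < Nat.log p n + 1 := Nat.lt_succ_of_le (Nat.log_mono_right hkn)
  rw [Nat.factorization_lcmUpto n hp, Nat.factorization_mul hk.ne' hc, Finsupp.add_apply,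
    Nat.factorization_choose hp hkn (Nat.lt_succ_self _),
    Nat.factorization_eq_card_pow_dvd_of_lt hp hk (Nat.lt_pow_of_log_lt hp.one_lt hlog),
    ← Finset.card_union_of_disjoint]
  · refine (Finset.card_le_card (t := Finset.Ico 1 (Nat.log p n + 1)) ?_).trans (by simp)
    exact Finset.union_subset (Finset.filter_subset _ _) (Finset.filter_subset _ _)
  · refine Finset.disjoint_filter.2 fun i _ hi => ?_
    rw [Nat.mod_eq_zero_of_dvd hi, zero_add, not_le]
    exact Nat.mod_lt _ (pow_pos hp.pos i)

theorem lcmUpto_mono : Monotone Nat.lcmUpto := fun _ b hab =>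
  Nat.le_of_dvd (Nat.lcmUpto_pos b) <|
    Finset.lcm_mono (Finset.Icc_subset_Icc_right hab)

theorem mul_four_pow_le_lcmUpto {n : ℕ} (hn : 0 < n) :
    n * 4 ^ n ≤ Nat.lcmUpto (2 * n + 1) := by
  have h₁ : n * (2 * n).choose n ∣ Nat.lcmUpto (2 * n + 1) :=
    (mul_choose_dvd_lcmUpto hn (by omega)).trans <|
      Finset.lcm_mono (Finset.Icc_subset_Icc_right (Nat.le_succ _))
  have h₂ : (2 * n + 1) * (2 * n).choose n ∣ Nat.lcmUpto (2 * n + 1) := by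
    rw [Nat.add_one_mul_choose_eq, mul_comm]
    exact mul_choose_dvd_lcmUpto n.succ_pos (by omega)
  have hcop : Nat.Coprime n (2 * n + 1) := by simp
  have h := Nat.lcm_dvd h₁ h₂
  rw [Nat.lcm_mul_right, hcop.lcm_eq_mul, mul_assoc] at h
  have hcentral := Nat.four_pow_le_two_mul_add_one_mul_central_binom n
  exact (Nat.mul_le_mul_left n hcentral).trans (Nat.le_of_dvd (Nat.lcmUpto_pos _) h)

theorem two_pow_le_lcmUpto {n : ℕ} (hn : 7 ≤ n) : 2 ^ n ≤ Nat.lcmUpto n := by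
  obtain ⟨a, rfl | rfl⟩ := n.even_or_odd'
  · obtain rfl | ha : a = 4 ∨ 5 ≤ a := by omega
    · decide
    obtain ⟨b, rfl⟩ : ∃ b, a = b + 1 := ⟨a - 1, by omega⟩
    calc 2 ^ (2 * (b + 1)) = 4 * 4 ^ b := by rw [pow_mul, pow_succ]; ring
      _ ≤ b * 4 ^ b := Nat.mul_le_mul_right _ (by omega)
      _ ≤ Nat.lcmUpto (2 * b + 1) := mul_four_pow_le_lcmUpto (by omega)
      _ ≤ Nat.lcmUpto (2 * (b + 1)) := lcmUpto_mono (by omega)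
  · calc 2 ^ (2 * a + 1) = 2 * 4 ^ a := by rw [pow_succ, pow_mul]; ring
      _ ≤ a * 4 ^ a := Nat.mul_le_mul_right _ (by omega)
      _ ≤ Nat.lcmUpto (2 * a + 1) := mul_four_pow_le_lcmUpto (by omega)

/-- Base-`t` expansions with signed digits of absolute value at most `t - 1` represent zero
only trivially. -/
theorem eq_zero_of_sum_pow_mul_eq_zero {t : ℤ} {m : ℕ} (ht : 0 < t) (v : Fin m → ℤ)
    (hv : ∀ x, |v x| ≤ t - 1) (h : ∑ x : Fin m, t ^ (x : ℕ) * v x = 0) : v = 0 := by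
  induction m with
  | zero => exact Subsingleton.elim _ _
  | succ m ih =>
    have hsum : v 0 + t * ∑ x : Fin m, t ^ (x : ℕ) * v x.succ = 0 := by
      rw [Fin.sum_univ_succ] at h
      simpa [Finset.mul_sum, pow_succ', mul_assoc] using h
    have h0 : v 0 = 0 :=
      Int.eq_zero_of_abs_lt_dvd (m := t) ⟨-∑ x : Fin m, t ^ (x : ℕ) * v x.succ, by linarith⟩
        (by linarith [hv 0])
    have hsucc := ih (fun x => v x.succ) (fun x => hv x.succ) <|
      (mul_eq_zero.1 (by simpa [h0] using hsum)).resolve_left ht.ne'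
    funext x
    exact Fin.cases h0 (congrFun hsucc) x

theorem abs_sum_pow_mul_lt {t : ℤ} {m : ℕ} (ht : 0 < t) (v : Fin m → ℤ)
    (hv : ∀ x, |v x| ≤ t - 1) : |∑ x : Fin m, t ^ (x : ℕ) * v x| < t ^ m := by
  calc |∑ x : Fin m, t ^ (x : ℕ) * v x| ≤ ∑ x : Fin m, |t ^ (x : ℕ) * v x| :=
        Finset.abs_sum_le_sum_abs _ _
    _ ≤ ∑ x : Fin m, t ^ (x : ℕ) * (t - 1) := by
        refine Finset.sum_le_sum fun x _ => ?_
        rw [abs_mul, abs_of_pos (pow_pos ht _)]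
        exact mul_le_mul_of_nonneg_left (hv x) (pow_pos ht _).le
    _ = t ^ m - 1 := by
        rw [← Finset.sum_mul, Fin.sum_univ_eq_sum_range (fun i => t ^ i), geom_sum_mul]
    _ < t ^ m := sub_one_lt _

theorem pow_le_two_pow_ceil (n t : ℕ) (ht : 0 < t) :
    t ^ n ≤ 2 ^ ⌈(n : ℝ) * Real.logb 2 t⌉₊ := by
  have ht' : (0 : ℝ) < t := by exact_mod_cast ht
  have h : ((t : ℝ) ^ n) ≤ 2 ^ ⌈(n : ℝ) * Real.logb 2 t⌉₊ := by
    rw [← Real.rpow_natCast 2, ← Real.logb_le_iff_le_rpow one_lt_two (pow_pos ht' n),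
      Real.logb_pow]
    exact Nat.le_ceil _
  exact_mod_cast h

/-- **Weight construction lemma** (Fredman–Komlós–Szemerédi style): for positive integers
`m, k, t` with `t ≥ 2` and `q := ⌈m·k·log₂ t⌉ ≥ 7`, there are `q` weight vectors in
`{0, …, q}^m` such that for any `k` nonzero integer vectors with coordinates of absolute
value at most `t − 1`, some weight vector has nonzero inner product with all of them. -/
theorem weight_vectors_exist (m k t : ℕ) (hm : 0 < m) (hk : 0 < k) (ht : 2 ≤ t)
    (q : ℕ) (hq : q = ⌈(m : ℝ) * (k : ℝ) * Real.logb 2 (t : ℝ)⌉₊) (hq7 : 7 ≤ q) :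
    ∃ W : Fin q → (Fin m → ℕ),
      (∀ j i, W j i ≤ q) ∧
      ∀ v : Fin k → (Fin m → ℤ),
        (∀ i, v i ≠ 0) → (∀ i x, |v i x| ≤ (t : ℤ) - 1) →
        ∃ j, ∀ i, ∑ x, (W j x : ℤ) * v i x ≠ 0 := by
  have ht0 : (0 : ℤ) < t := by omega
  refine ⟨fun j x => t ^ (x : ℕ) % (j + 1), fun j i => ?_, fun v hv hvt => ?_⟩
  · exact (Nat.mod_lt _ (Nat.succ_pos _)).le.trans j.2
  by_contra! hzero
  set N : ℤ := ∏ i, ∑ x : Fin m, (t : ℤ) ^ (x : ℕ) * v i x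
  have hN0 : N ≠ 0 := Finset.prod_ne_zero_iff.2 fun i _ h =>
    hv i (eq_zero_of_sum_pow_mul_eq_zero ht0 (v i) (hvt i) h)
  have hNlt : |N| < (t : ℤ) ^ (m * k) := by
    have : NeZero k := ⟨hk.ne'⟩
    calc |N| = ∏ i, |∑ x : Fin m, (t : ℤ) ^ (x : ℕ) * v i x| := Finset.abs_prod _ _
      _ < ∏ _i : Fin k, (t : ℤ) ^ m := by
        refine Finset.prod_lt_prod_of_nonempty (fun i _ => abs_pos.2 fun h => ?_)
          (fun i _ => abs_sum_pow_mul_lt ht0 (v i) (hvt i)) Finset.univ_nonempty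
        exact hv i (eq_zero_of_sum_pow_mul_eq_zero ht0 (v i) (hvt i) h)
      _ = (t : ℤ) ^ (m * k) := by simp [pow_mul]
  have hdvd : Nat.lcmUpto q ∣ N.natAbs := by
    refine Finset.lcm_dvd fun d hd => ?_
    obtain ⟨hd1, hdq⟩ := Finset.mem_Icc.1 hd
    obtain ⟨i, hi⟩ := hzero ⟨d - 1, by omega⟩
    simp only [Nat.sub_add_cancel hd1] at hi
    rw [id, ← Int.natCast_dvd]
    refine dvd_trans ?_ (Finset.dvd_prod_of_mem _ (Finset.mem_univ i))
    rw [← Int.modEq_zero_iff_dvd, ← hi]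
    refine Int.ModEq.sum fun x _ => Int.ModEq.mul_right _ ?_
    push_cast
    exact (Int.mod_modEq _ _).symm
  have hle : t ^ (m * k) ≤ N.natAbs := by
    have h := pow_le_two_pow_ceil (m * k) t (by omega)
    rw [Nat.cast_mul, ← hq] at h
    exact h.trans <| (two_pow_le_lcmUpto hq7).trans <|
      Nat.le_of_dvd (Int.natAbs_pos.2 hN0) hdvd
  have hle' : (t : ℤ) ^ (m * k) ≤ |N| := by
    rw [Int.abs_eq_natAbs]
    exact_mod_cast hle
  exact hle'.not_gt hNlt
end

section
/- Let A be an n × m totally unimodular matrix with L(A) ≠ {0}, and let λ := λ(L(A)). Then every nonzero vector v ∈ L(A) with ‖v‖₁ < 2λ is a circuit of A. -/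
/-- The lattice `L(A)` of integer vectors in the kernel of a real matrix `A`. -/
def kerLattice {n m : ℕ} (A : Matrix (Fin n) (Fin m) ℝ) : Set (Fin m → ℤ) :=
  { v | A.mulVec (fun i => (v i : ℝ)) = 0 }

/-- The support of an integer vector. -/
def suppZ {m : ℕ} (u : Fin m → ℤ) : Set (Fin m) := { i | u i ≠ 0 }

/-- A vector `u` is a *circuit* of the matrix `A` if `u ∈ L(A)`, no nonzero vector of `L(A)`
has support properly contained in the support of `u`, and the gcd of the entries of `u`
is `1`. -/
def IsMatrixCircuit {n m : ℕ} (A : Matrix (Fin n) (Fin m) ℝ) (u : Fin m → ℤ) : Prop :=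
  u ∈ kerLattice A ∧
  (¬ ∃ v ∈ kerLattice A, v ≠ 0 ∧ suppZ v ⊂ suppZ u) ∧
  Finset.univ.gcd u = 1

section SignVector

variable {n m : ℕ} {A : Matrix (Fin n) (Fin m) ℝ}

theorem injective_of_det_submatrix_ne_zero {k : ℕ} {f : Fin k → Fin n} {g : Fin k → Fin m}
    (h : (A.submatrix f g).det ≠ 0) : Function.Injective g := by
  intro i j hij
  by_contra hne
  exact h (Matrix.det_zero_of_column_eq hne fun l => by simp [hij])

/-- A largest nonsingular square submatrix among the columns of `S`. -/
theorem exists_maximal_nonsingular_submatrix (A : Matrix (Fin n) (Fin m) ℝ) (S : Set (Fin m)) :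
    ∃ (k : ℕ) (f : Fin k → Fin n) (g : Fin k → Fin m), (∀ j, g j ∈ S) ∧
      (A.submatrix f g).det ≠ 0 ∧
      ∀ (f' : Fin (k + 1) → Fin n) (g' : Fin (k + 1) → Fin m), (∀ j, g' j ∈ S) →
        (A.submatrix f' g').det = 0 := by
  by_contra! hcon
  have key : ∀ k : ℕ, ∃ (f : Fin k → Fin n) (g : Fin k → Fin m), (∀ j, g j ∈ S) ∧
      (A.submatrix f g).det ≠ 0 := by
    intro k
    induction k with
    | zero => exact ⟨Fin.elim0, Fin.elim0, fun j => j.elim0, by simp⟩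
    | succ k ih =>
      obtain ⟨f, g, hg, hd⟩ := ih
      exact hcon k f g hg hd
  obtain ⟨f, g, -, hd⟩ := key (m + 1)
  have := Fintype.card_le_of_injective g (injective_of_det_submatrix_ne_zero hd)
  simp at this

/-- Bordering a square submatrix by one row `r` and one column `e`. -/
theorem det_submatrix_border {k : ℕ} {f : Fin k → Fin n} {g : Fin k → Fin m}
    (h : (A.submatrix f g).det ≠ 0) (r : Fin n) (e : Fin m) :
    (A.submatrix (Sum.elim f fun _ : Fin 1 => r) (Sum.elim g fun _ : Fin 1 => e)).det =
      (A.submatrix f g).det * A r e -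
        ∑ j, A r (g j) * (A.submatrix f g).cramer (fun i => A (f i) e) j := by
  set M := A.submatrix f g with hM
  have hblocks : A.submatrix (Sum.elim f fun _ : Fin 1 => r) (Sum.elim g fun _ : Fin 1 => e) =
      Matrix.fromBlocks M (Matrix.of fun i _ => A (f i) e) (Matrix.of fun _ j => A r (g j))
        (Matrix.of fun _ _ => A r e) := by
    ext i j
    rcases i with i | i <;> rcases j with j | j <;> simp [hM]
  let _ : Invertible M := Matrix.invertibleOfIsUnitDet M (isUnit_iff_ne_zero.mpr h)
  have hadj : M.adjugate = M.det • ⅟M := by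
    rw [Matrix.invOf_eq_nonsing_inv, Matrix.inv_def, smul_smul,
      Ring.mul_inverse_cancel _ (isUnit_iff_ne_zero.mpr h), one_smul]
  rw [hblocks, Matrix.det_fromBlocks₁₁, Matrix.cramer_eq_adjugate_mulVec, hadj, Matrix.mul_assoc,
    Matrix.det_fin_one, Matrix.smul_mulVec]
  simp only [Matrix.sub_apply, Matrix.of_apply, Matrix.mul_apply, Matrix.mulVec, dotProduct,
    Pi.smul_apply, smul_eq_mul, mul_sub, Finset.mul_sum]
  congr 1
  refine Finset.sum_congr rfl fun j _ => Finset.sum_congr rfl fun i _ => ?_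
  ring

/-- The kernel lattice of a totally unimodular matrix contains, inside the support of any of its
nonzero vectors, a nonzero vector with entries in `{0, ±1}`. -/
theorem exists_sign_vector (hA : A.IsTotallyUnimodular) {u : Fin m → ℤ} (hu : u ∈ kerLattice A)
    (hu0 : u ≠ 0) :
    ∃ x ∈ kerLattice A, x ≠ 0 ∧ suppZ x ⊆ suppZ u ∧ ∀ i, |x i| ≤ 1 := by
  classical
  obtain ⟨k, f, g, hg, hd, hmax⟩ := exists_maximal_nonsingular_submatrix A (suppZ u)
  have hinj := injective_of_det_submatrix_ne_zero hd
  obtain ⟨e, heS, heg⟩ : ∃ e ∈ suppZ u, e ∉ Set.range g := by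
    by_contra! hcon
    have hker : (A.submatrix f g).mulVec (fun j => (u (g j) : ℝ)) = 0 := by
      ext r
      have h1 := congrFun (show A.mulVec (fun i => (u i : ℝ)) = 0 from hu) (f r)
      refine (Fintype.sum_of_injective g hinj _ _ (fun i hi => ?_) fun i => rfl).trans h1
      have : u i = 0 := by
        by_contra h
        exact hi (hcon i h)
      simp [this]
    have hz := Matrix.eq_zero_of_mulVec_eq_zero hd hker
    refine hu0 (funext fun i => ?_)
    by_contra h
    obtain ⟨j, rfl⟩ := hcon i h
    exact h (by simpa using congrFun hz j)
  have hTU := (Matrix.isTotallyUnimodular_iff A).1 hA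
  have hdet : ∀ g' : Fin k → Fin m, ∃ s : ℤ, |s| ≤ 1 ∧ (A.submatrix f g').det = s := by
    intro g'
    obtain ⟨s, hs⟩ := hTU k f g'
    refine ⟨(s : ℤ), by cases s <;> simp, ?_⟩
    rw [← hs]
    cases s <;> simp
  choose z hz1 hz using fun j => hdet (Function.update g j e)
  obtain ⟨d, hd1, hd2⟩ := hdet g
  have hd0 : d ≠ 0 := by
    rintro rfl
    exact hd (by simpa using hd2)
  have hcr : ∀ j, (A.submatrix f g).cramer (fun i => A (f i) e) j = z j := by
    intro j
    rw [Matrix.cramer_apply, ← hz]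
    congr 1
    ext a b
    by_cases hb : b = j
    · subst hb
      simp
    · simp [hb]
  let h : Fin k ⊕ Fin 1 → Fin m := Sum.elim g fun _ => e
  let w : Fin k ⊕ Fin 1 → ℤ := Sum.elim (fun j => -z j) fun _ => d
  have hh : Function.Injective h := by
    refine hinj.sumElim (Function.injective_of_subsingleton _) ?_
    rintro a - rfl
    exact heg ⟨a, rfl⟩
  have hext : ∀ i ∉ Set.range h, Function.extend h w 0 i = 0 := fun i hi =>
    Function.extend_apply' _ _ _ hi
  have hhS : ∀ j, h j ∈ suppZ u := by
    rintro (j | j)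
    · exact hg j
    · exact heS
  refine ⟨Function.extend h w 0, ?_, ?_, ?_, ?_⟩
  · ext r
    have h1 : A.mulVec (fun i => ((Function.extend h w 0 i : ℤ) : ℝ)) r =
        ∑ j, A r (h j) * (w j : ℝ) := by
      symm
      refine Fintype.sum_of_injective h hh _ _ (fun i hi => ?_) fun i => ?_
      · simp [hext i hi]
      · simp [hh.extend_apply]
    have h2 : (A.submatrix (Sum.elim f fun _ : Fin 1 => r) h).det = 0 := by
      rw [← Matrix.det_submatrix_equiv_self finSumFinEquiv.symm, Matrix.submatrix_submatrix]
      exact hmax _ _ fun j => hhS _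
    rw [det_submatrix_border hd, hd2] at h2
    simp only [hcr] at h2
    rw [h1, Fintype.sum_sum_type]
    simp only [h, w, Sum.elim_inl, Sum.elim_inr, Finset.univ_unique, Finset.sum_singleton,
      Int.cast_neg, mul_neg, Finset.sum_neg_distrib, Pi.zero_apply]
    linarith
  · intro h0
    have h1 := congrFun h0 (h (Sum.inr 0))
    rw [hh.extend_apply] at h1
    exact hd0 h1
  · intro i hi
    by_contra hiu
    refine hi (hext i ?_)
    rintro ⟨j, rfl⟩
    exact hiu (hhS j)
  · intro i
    by_cases hi : i ∈ Set.range h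
    · obtain ⟨j, rfl⟩ := hi
      rw [hh.extend_apply]
      rcases j with j | j
      · simpa [w] using hz1 j
      · exact hd1
    · simp [hext i hi]

end SignVector

section Lattice

variable {n m : ℕ} {A : Matrix (Fin n) (Fin m) ℝ}

theorem sub_mul_mem_kerLattice {u x : Fin m → ℤ} (hu : u ∈ kerLattice A) (hx : x ∈ kerLattice A)
    (c : ℤ) : (fun i => u i - c * x i) ∈ kerLattice A := by
  have hu' : A.mulVec (fun i => (u i : ℝ)) = 0 := hu
  have hx' : A.mulVec (fun i => (x i : ℝ)) = 0 := hx
  have : (fun i => ((u i - c * x i : ℤ) : ℝ)) =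
      (fun i => (u i : ℝ)) - (c : ℝ) • fun i => (x i : ℝ) := by
    ext i
    simp
  show A.mulVec _ = 0
  rw [this, Matrix.mulVec_sub, Matrix.mulVec_smul, hu', hx']
  simp

theorem neg_mem_kerLattice {x : Fin m → ℤ} (hx : x ∈ kerLattice A) : -x ∈ kerLattice A := by
  have hx' : A.mulVec (fun i => (x i : ℝ)) = 0 := hx
  have : (fun i => (((-x) i : ℤ) : ℝ)) = -fun i => (x i : ℝ) := by
    ext i
    simp
  show A.mulVec _ = 0
  rw [this, Matrix.mulVec_neg, hx', neg_zero]

theorem lambda1_le_l1norm {E : Type*} [Fintype E] {L : Set (E → ℤ)} {u : E → ℤ} (hu : u ∈ L)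
    (hu0 : u ≠ 0) : lambda1 L ≤ l1norm u :=
  Nat.sInf_le ⟨u, hu, hu0, rfl⟩

/-- A vector shorter than twice the minimum has no proper conformal decomposition. -/
theorem eq_of_conformal {u v : Fin m → ℤ} (hu : u ∈ kerLattice A) (hu0 : u ≠ 0)
    (hv : v ∈ kerLattice A) (hlt : l1norm v < 2 * lambda1 (kerLattice A))
    (hc : ∀ i, (v i).natAbs = (u i).natAbs + (v i - u i).natAbs) : u = v := by
  by_contra hne
  have hw := sub_mul_mem_kerLattice hv hu 1
  have hw0 : (fun i => v i - 1 * u i) ≠ 0 := by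
    intro h
    refine hne (funext fun i => ?_)
    have := congrFun h i
    simp only [Pi.zero_apply] at this
    lia
  have h1 := lambda1_le_l1norm hu hu0
  have h2 := lambda1_le_l1norm hw hw0
  have h3 : l1norm v = l1norm u + l1norm (fun i => v i - 1 * u i) := by
    simp only [l1norm, ← Finset.sum_add_distrib, one_mul]
    exact Finset.sum_congr rfl fun i _ => hc i
  lia

/-- If no nonzero lattice vector sign-consistent with `u` has smaller support, then `u` is a
positive multiple of a `{0, ±1}`-vector supported in the support of any prescribed lattice vector
`w` with support in that of `u`. -/
theorem exists_eq_mul_sign_vector (hA : A.IsTotallyUnimodular) {u : Fin m → ℤ}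
    (hu : u ∈ kerLattice A)
    (hmin : ∀ y ∈ kerLattice A, (∀ i, y i ≠ 0 → 0 < y i * u i) → suppZ y ⊂ suppZ u → y = 0)
    {w : Fin m → ℤ} (hw : w ∈ kerLattice A) (hw0 : w ≠ 0) (hwu : suppZ w ⊆ suppZ u) :
    ∃ x ∈ kerLattice A, suppZ x ⊆ suppZ w ∧ (∀ i, |x i| ≤ 1) ∧
      ∃ c : ℤ, 0 < c ∧ ∀ i, u i = c * x i := by
  obtain ⟨x, hx, hxw, hx1, i, hi⟩ : ∃ x ∈ kerLattice A, suppZ x ⊆ suppZ w ∧ (∀ i, |x i| ≤ 1) ∧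
      ∃ i, 0 < x i * u i := by
    obtain ⟨x, hx, hx0, hxw, hx1⟩ := exists_sign_vector hA hw hw0
    obtain ⟨i, hi⟩ := Function.ne_iff.1 hx0
    have hui : u i ≠ 0 := hwu (hxw hi)
    rcases lt_or_gt_of_ne (mul_ne_zero hi hui) with h | h
    · refine ⟨-x, neg_mem_kerLattice hx, fun j hj => hxw ?_, by simpa using hx1, i, by simpa using h⟩
      simpa [suppZ] using hj
    · exact ⟨x, hx, hxw, hx1, i, h⟩
  obtain ⟨j, hj, hjmin⟩ := Finset.exists_min_image
    (Finset.univ.filter fun i => 0 < x i * u i) (fun i => |u i|) ⟨i, by simpa using hi⟩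
  simp only [Finset.mem_filter, Finset.mem_univ, true_and] at hj hjmin
  have hsign : ∀ l, x l = 0 ∨ x l = 1 ∨ x l = -1 := by
    intro l
    have := abs_le.1 (hx1 l)
    lia
  have hu_zero : ∀ l, u l = 0 → x l = 0 := by
    intro l hl
    by_contra h
    exact hwu (hxw h) hl
  have hpos : 0 < |u j| := abs_pos.2 fun h => by simp [h] at hj
  have hzero : u j - |u j| * x j = 0 := by
    rcases hsign j with h | h | h
    · simp [h] at hj
    · rw [h] at hj ⊢
      rw [abs_of_pos (by lia)]
      lia
    · rw [h] at hj ⊢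
      rw [abs_of_neg (by lia)]
      lia
  have hy : (fun l => u l - |u j| * x l) = 0 := by
    refine hmin _ (sub_mul_mem_kerLattice hu hx _) (fun l hl => ?_) ⟨fun l hl hul => ?_, fun h => ?_⟩
    · have hul : u l ≠ 0 := fun h => hl (by simp [h, hu_zero l h])
      have hsq : 0 < u l * u l := mul_self_pos.2 hul
      by_cases hxl : 0 < x l * u l
      · have h1 := hjmin l hxl
        rcases hsign l with h | h | h
        · simp [h] at hxl
        · simp only [h] at hl hxl ⊢
          rw [abs_of_pos (a := u l) (by lia)] at h1
          exact mul_pos (by lia) (by lia)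
        · simp only [h] at hl hxl ⊢
          rw [abs_of_neg (a := u l) (by lia)] at h1
          exact mul_pos_of_neg_of_neg (by lia) (by lia)
      · nlinarith
    · exact hl (by simp [hul, hu_zero l hul])
    · exact h (a := j) (fun h0 => by simp [h0] at hpos) hzero
  exact ⟨x, hx, hxw, hx1, |u j|, hpos, fun l => by
    have := congrFun hy l
    simp only [Pi.zero_apply] at this
    lia⟩

end Lattice

/-- Every nonzero vector of the kernel lattice of a totally unimodular matrix whose
`ℓ₁`-norm is less than twice the minimum is a circuit of the matrix. -/
theorem small_vectors_are_circuits {n m : ℕ} (A : Matrix (Fin n) (Fin m) ℝ)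
    (hA : A.IsTotallyUnimodular) (hL : kerLattice A ≠ {0}) :
    ∀ v ∈ kerLattice A, v ≠ 0 → l1norm v < 2 * lambda1 (kerLattice A) →
      IsMatrixCircuit A v := by
  intro v hv hv0 hlt
  obtain ⟨u, ⟨hu, hu0, huv⟩, hmin⟩ := exists_minimalFor_of_wellFoundedLT
    (fun y : Fin m → ℤ => y ∈ kerLattice A ∧ y ≠ 0 ∧ ∀ i, y i ≠ 0 → 0 < y i * v i) suppZ
    ⟨v, hv, hv0, fun i hi => mul_self_pos.2 hi⟩
  have hminu : ∀ y ∈ kerLattice A, (∀ i, y i ≠ 0 → 0 < y i * u i) → suppZ y ⊂ suppZ u →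
      y = 0 := by
    intro y hy hyu hss
    by_contra hy0
    refine hss.2 (hmin ⟨hy, hy0, fun i hi => ?_⟩ hss.1)
    have h1 := hyu i hi
    have h2 := huv i fun h => by simp [h] at h1
    have h3 : 0 < (y i * v i) * (u i * u i) := by nlinarith
    exact pos_of_mul_pos_left h3 (mul_self_nonneg _)
  obtain ⟨x, hx, -, hx1, c, hc, hcx⟩ :=
    exists_eq_mul_sign_vector hA hu hminu hu hu0 subset_rfl
  have hx0 : x ≠ 0 := by
    rintro rfl
    exact hu0 (funext fun i => by simp [hcx i])
  obtain rfl : x = v := by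
    refine eq_of_conformal hx hx0 hv hlt fun i => ?_
    have h1 := abs_le.1 (hx1 i)
    have h2 := huv i
    rw [hcx i] at h2
    obtain h | h | h : x i = 0 ∨ x i = 1 ∨ x i = -1 := by lia
    · simp [h]
    · rw [h] at h2 ⊢
      have := pos_of_mul_pos_right (h2 (by lia)) (by lia)
      lia
    · rw [h] at h2 ⊢
      have := neg_of_mul_pos_right (h2 (by lia)) (by lia)
      lia
  have hsupp : suppZ u = suppZ x := by
    ext i
    simp [suppZ, hcx i, hc.ne']
  refine ⟨hv, ?_, ?_⟩
  · rintro ⟨w, hw, hw0, hss⟩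
    rw [← hsupp] at hss
    obtain ⟨y, -, hyw, -, d, -, hdy⟩ := exists_eq_mul_sign_vector hA hu hminu hw hw0 hss.1
    exact hss.2 fun i hi => hyw fun h => hi (by simp [hdy i, h])
  · obtain ⟨i, hi⟩ := Function.ne_iff.1 hv0
    have h1 := abs_le.1 (hx1 i)
    simp only [Pi.zero_apply] at hi
    have hunit : IsUnit (x i) := Int.isUnit_iff.2 (by lia)
    rw [← Finset.normalize_gcd, normalize_eq_one]
    exact isUnit_of_dvd_unit (Finset.gcd_dvd (Finset.mem_univ i)) hunit
end

section
/- Let A be an n × m totally unimodular matrix. Then for every nonzero vector v ∈ L(A) there exists a circuit u of A that is conformal to v, i.e., u ⊑ v. -/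
/-- `u` is conformal to `v`: componentwise, `u` has the same sign as `v` and is no larger
in absolute value. -/
def IsConformal {m : ℕ} (u v : Fin m → ℤ) : Prop :=
  ∀ i, 0 ≤ u i * v i ∧ |u i| ≤ |v i|

namespace Matrix

/-- A matrix with linearly independent columns over a field has a nonsingular square submatrix
using all columns. -/
lemma exists_rows_det_ne_zero {K ι κ : Type*} [Field K] [Fintype ι] [DecidableEq ι]
    [Fintype κ] (C : Matrix κ ι K) (hC : LinearIndependent K C.col) :
    ∃ r : ι → κ, (C.submatrix r id).det ≠ 0 := by
  have hspan : Submodule.span K (Set.range C.row) = ⊤ := by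
    apply Submodule.eq_top_of_finrank_eq
    rw [← rank_eq_finrank_span_row, rank_eq_finrank_span_cols, finrank_span_eq_card hC,
      Module.finrank_pi]
  obtain ⟨τ, a, -, hs, hli⟩ := exists_linearIndependent' K C.row
  let b := Module.Basis.mk hli (by rw [hs, hspan])
  let e := (Pi.basisFun K ι).indexEquiv b
  refine ⟨a ∘ e, ?_⟩
  have hli' : LinearIndependent K (C.submatrix (a ∘ e) id).row := hli.comp e e.injective
  rw [linearIndependent_rows_iff_isUnit, isUnit_iff_isUnit_det] at hli'
  exact hli'.ne_zero

lemma IsTotallyUnimodular.abs_det_submatrix_le_one {ι κ τ : Type*} [Fintype τ] [DecidableEq τ]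
    {B : Matrix ι κ ℤ} (hB : B.IsTotallyUnimodular) (r : τ → ι) (c : τ → κ) :
    |(B.submatrix r c).det| ≤ 1 := by
  obtain ⟨s, hs⟩ := (isTotallyUnimodular_iff_fintype B).1 hB τ r c
  rw [← hs]
  cases s <;> simp

/-- A totally unimodular real matrix is the image of a totally unimodular integer matrix. -/
lemma IsTotallyUnimodular.exists_int {ι κ : Type*} {A : Matrix ι κ ℝ}
    (hA : A.IsTotallyUnimodular) :
    ∃ B : Matrix ι κ ℤ, B.IsTotallyUnimodular ∧ A = B.map (Int.cast : ℤ → ℝ) := by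
  choose s hs using hA.apply
  have hAB : A = (Matrix.of fun i j => (s i j : ℤ)).map (Int.cast : ℤ → ℝ) := by
    ext i j
    simp [← hs]
  refine ⟨_, fun k f g hf hg => ?_, hAB⟩
  obtain ⟨t, ht⟩ := hA k f g hf hg
  refine ⟨t, ?_⟩
  rw [hAB, submatrix_map, ← Int.cast_det] at ht
  have : ((t : ℤ) : ℝ) = t := by simp
  rw [← this] at ht
  exact_mod_cast ht

/-- Entries of a kernel vector of a totally unimodular matrix are bounded by any entry whose
removal makes the remaining support columns independent. -/
lemma IsTotallyUnimodular.abs_le_abs_of_mulVec_eq_zero {ι κ : Type*} [Fintype ι] [Fintype κ]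
    [DecidableEq κ] {B : Matrix ι κ ℤ} (hB : B.IsTotallyUnimodular) {u : κ → ℤ}
    (hu : B *ᵥ u = 0) {i j : κ} (hi : u i ≠ 0) (hij : i ≠ j)
    (hli : ∀ x : κ → ℤ, B *ᵥ x = 0 → (∀ k, u k = 0 → x k = 0) → x j = 0 → x = 0) :
    |u i| ≤ |u j| := by
  let T := {k : κ // u k ≠ 0 ∧ k ≠ j}
  have sum_T : ∀ y : κ → ℤ, (∀ k, u k = 0 → y k = 0) →
      ∑ k, y k = ∑ t : T, y t + y j := by
    intro y hy
    rw [← Finset.sum_erase_add _ _ (Finset.mem_univ j),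
      ← Finset.sum_filter_of_ne (p := fun k => u k ≠ 0) fun k _ hk h => hk (hy k h),
      Finset.sum_subtype (p := fun k => u k ≠ 0 ∧ k ≠ j) _ (by simp [and_comm])]
  let C : Matrix ι T ℚ := (B.submatrix id Subtype.val).map Int.cast
  have hC : LinearIndependent ℚ C.col := by
    rw [← LinearIndependent.iff_fractionRing ℤ ℚ, Fintype.linearIndependent_iff]
    intro g hg
    let x : κ → ℤ := fun k => if h : u k ≠ 0 ∧ k ≠ j then g ⟨k, h⟩ else 0
    have hxT : ∀ t : T, x t = g t := fun t => by simp [x, t.2]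
    have hxu : ∀ k, u k = 0 → x k = 0 := fun k hk => by simp [x, hk]
    have hxj : x j = 0 := by simp [x]
    have hx : x = 0 := by
      refine hli x ?_ hxu hxj
      ext l
      have := congrFun hg l
      simp only [Finset.sum_apply, Pi.smul_apply, Pi.zero_apply] at this
      simp only [mulVec, dotProduct, Pi.zero_apply]
      rw [sum_T _ (fun k hk => by simp [hxu k hk]), hxj]
      simp only [C, col_apply, map_apply, submatrix_apply, id, zsmul_eq_mul] at this
      simp only [hxT, mul_zero, add_zero]
      simp only [mul_comm (B _ _)]
      exact_mod_cast this
    intro t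
    rw [← hxT, hx, Pi.zero_apply]
  obtain ⟨r, hr⟩ := C.exists_rows_det_ne_zero hC
  let M : Matrix T T ℤ := B.submatrix r Subtype.val
  have hM : M.det ≠ 0 := by
    intro h
    apply hr
    have : C.submatrix r id = M.map Int.cast := rfl
    rw [this, ← Int.cast_det, h, Int.cast_zero]
  let w : T → ℤ := fun t => u t
  let b : T → ℤ := fun t => B (r t) j
  have hMw : M *ᵥ w = (-u j) • b := by
    ext t
    have := congrFun hu (r t)
    simp only [mulVec, dotProduct, Pi.zero_apply] at this
    rw [sum_T _ (fun k hk => by simp [hk])] at this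
    simp only [mulVec, dotProduct, M, w, b, submatrix_apply, Pi.smul_apply, smul_eq_mul]
    linarith
  let i' : T := ⟨i, hi, hij⟩
  have hcr : M.det * u i = -u j * (M.updateCol i' b).det := by
    have h1 : M.cramer (M *ᵥ w) = M.det • w := by
      rw [cramer_eq_adjugate_mulVec, mulVec_mulVec, adjugate_mul, smul_mulVec, one_mulVec]
    rw [hMw, map_smul] at h1
    have := congrFun h1 i'
    simpa [cramer_apply, w, i'] using this.symm
  have hsub : M.updateCol i' b =
      B.submatrix r (Function.update (Subtype.val : T → κ) i' j) := by
    ext s t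
    by_cases h : t = i'
    · subst h; simp [b]
    · simp [h, M]
  have hd := hB.abs_det_submatrix_le_one r (Function.update (Subtype.val : T → κ) i' j)
  rw [← hsub] at hd
  have := congrArg abs hcr
  rw [abs_mul, abs_mul, abs_neg] at this
  have h1 : 1 ≤ |M.det| := Int.one_le_abs hM
  nlinarith [abs_nonneg (u i), abs_nonneg (u j)]

end Matrix

lemma Matrix.mem_kerLattice_map_iff {n m : ℕ} (B : Matrix (Fin n) (Fin m) ℤ) (v : Fin m → ℤ) :
    v ∈ kerLattice (B.map (Int.cast : ℤ → ℝ)) ↔ B.mulVec v = 0 := by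
  simp only [kerLattice, Set.mem_ofPred_eq, funext_iff, Matrix.mulVec, dotProduct,
    Matrix.map_apply, Pi.zero_apply]
  exact forall_congr' fun i => by exact_mod_cast Iff.rfl

/-- A vector agreeing in sign with `u` somewhere can be scaled and subtracted from a multiple of
`u` so that a coordinate is cancelled and the signs of `u` are kept. -/
lemma exists_sign_preserving_elimination {κ : Type*} [Fintype κ] (u x : κ → ℤ)
    (hpos : ∃ i, 0 < x i * u i) :
    ∃ i, 0 < x i * u i ∧ |x i| * u i - |u i| * x i = 0 ∧
      ∀ j, 0 ≤ (|x i| * u j - |u i| * x j) * u j := by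
  obtain ⟨i₀, hi₀⟩ := hpos
  obtain ⟨i, hi, hmin⟩ := Finset.exists_min_image (Finset.univ.filter fun i => 0 < x i * u i)
    (fun i => (|u i| : ℚ) / |(x i : ℚ)|) ⟨i₀, by simpa using hi₀⟩
  simp only [Finset.mem_filter, Finset.mem_univ, true_and] at hi hmin
  refine ⟨i, hi, ?_, fun j => ?_⟩
  · rcases mul_pos_iff.1 hi with ⟨h1, h2⟩ | ⟨h1, h2⟩
    · rw [abs_of_pos h1, abs_of_pos h2]; ring
    · rw [abs_of_neg h1, abs_of_neg h2]; ring
  · have key : |u i| * (x j * u j) ≤ |x i| * (u j * u j) := by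
      rcases le_or_gt (x j * u j) 0 with h | h
      · exact (mul_nonpos_of_nonneg_of_nonpos (abs_nonneg _) h).trans
          (mul_nonneg (abs_nonneg _) (mul_self_nonneg _))
      · have hm := hmin j h
        have hxi : (0 : ℚ) < |(x i : ℚ)| := by
          have := left_ne_zero_of_mul hi.ne'
          positivity
        have hxj : (0 : ℚ) < |(x j : ℚ)| := by
          have := left_ne_zero_of_mul h.ne'
          positivity
        rw [div_le_div_iff₀ hxi hxj] at hm
        have hm' : |u i| * |x j| ≤ |u j| * |x i| := by exact_mod_cast hm
        rw [← abs_of_pos h, abs_mul, ← abs_mul_abs_self (u j)]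
        nlinarith [mul_le_mul_of_nonneg_right hm' (abs_nonneg (u j))]
    linarith

/-- A nonzero integer vector in the kernel of `B` dominates in sign a nonzero kernel vector
of minimal support. -/
lemma Matrix.exists_minimal_support_of_mulVec_eq_zero {ι κ : Type*} [Fintype κ]
    (B : Matrix ι κ ℤ) {v : κ → ℤ} (hv : B.mulVec v = 0) (hv0 : v ≠ 0) :
    ∃ u : κ → ℤ, B.mulVec u = 0 ∧ u ≠ 0 ∧ (∀ i, 0 ≤ u i * v i) ∧ (∀ i, v i = 0 → u i = 0) ∧
      ∀ x : κ → ℤ, B.mulVec x = 0 → (∀ k, u k = 0 → x k = 0) →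
        (∃ j, u j ≠ 0 ∧ x j = 0) → x = 0 := by
  classical
  let S : Set (κ → ℤ) := {w | B.mulVec w = 0 ∧ w ≠ 0 ∧ (∀ i, 0 ≤ w i * v i) ∧
    ∀ i, v i = 0 → w i = 0}
  let c : (κ → ℤ) → ℕ := fun w => (Finset.univ.filter fun i => w i ≠ 0).card
  have hS : S.Nonempty := ⟨v, hv, hv0, fun i => mul_self_nonneg _, fun _ h => h⟩
  obtain ⟨u, ⟨hu, hu0, huv, hsupp⟩, hmin⟩ :=
    (measure c).wf.has_min S hS
  refine ⟨u, hu, hu0, huv, hsupp, ?_⟩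
  have main : ∀ x : κ → ℤ, B.mulVec x = 0 → (∀ k, u k = 0 → x k = 0) →
      (∃ j, u j ≠ 0 ∧ x j = 0) → ¬ ∃ i, 0 < x i * u i := by
    rintro x hx hxu ⟨j, huj, hxj⟩ hpos
    obtain ⟨i, hi, hwi, hw⟩ := exists_sign_preserving_elimination u x hpos
    have hxi := left_ne_zero_of_mul hi.ne'
    have hui := right_ne_zero_of_mul hi.ne'
    have hw0 : ∀ k, u k = 0 → |x i| * u k - |u i| * x k = 0 := fun k hk => by
      simp [hk, hxu k hk]
    refine hmin (|x i| • u - |u i| • x) ⟨?_, fun h => ?_, fun k => ?_, fun k hk => ?_⟩ ?_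
    · rw [Matrix.mulVec_sub, Matrix.mulVec_smul, Matrix.mulVec_smul, hu, hx]
      simp
    · have := congrFun h j
      simp [hxj, huj, hxi] at this
    · simp only [Pi.sub_apply, Pi.smul_apply, smul_eq_mul]
      by_cases hk : u k = 0
      · simp [hw0 k hk]
      · have h1 := mul_nonneg (hw k) (huv k)
        have h2 : 0 < u k * u k := mul_self_pos.2 hk
        refine nonneg_of_mul_nonneg_left (b := u k * u k) ?_ h2
        linarith
    · simpa using hw0 k (hsupp k hk)
    · refine Finset.card_lt_card (Finset.ssubset_iff_of_subset ?_ |>.2 ⟨i, ?_, ?_⟩)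
      · intro k
        simp only [Finset.mem_filter, Finset.mem_univ, true_and, Pi.sub_apply, Pi.smul_apply,
          smul_eq_mul]
        exact mt (hw0 k)
      · simpa using hui
      · simpa using hwi
  intro x hx hxu hj
  by_contra hx0
  obtain ⟨i, hi⟩ := Function.ne_iff.1 hx0
  have hui : u i ≠ 0 := mt (hxu i) hi
  rcases lt_or_gt_of_ne (mul_ne_zero hi hui) with h | h
  · obtain ⟨j, huj, hxj⟩ := hj
    refine main (-x) (by rw [Matrix.mulVec_neg, hx, neg_zero]) (fun k hk => by simp [hxu k hk])
      ⟨j, huj, by simp [hxj]⟩ ⟨i, ?_⟩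
    simpa using h
  · exact main x hx hxu hj ⟨i, h⟩

/-- For a totally unimodular matrix `A`, every nonzero vector of `L(A)` has a circuit of
`A` conformal to it. -/
theorem exists_conformal_circuit {n m : ℕ} (A : Matrix (Fin n) (Fin m) ℝ)
    (hA : A.IsTotallyUnimodular) :
    ∀ v ∈ kerLattice A, v ≠ 0 → ∃ u, IsMatrixCircuit A u ∧ IsConformal u v := by
  intro v hv hv0
  obtain ⟨B, hB, rfl⟩ := hA.exists_int
  rw [Matrix.mem_kerLattice_map_iff] at hv
  obtain ⟨u, hu, hu0, huv, hsupp, hmin⟩ := B.exists_minimal_support_of_mulVec_eq_zero hv hv0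
  obtain ⟨i₀, hi₀⟩ := Function.ne_iff.1 hu0
  have hle : ∀ i j, u i ≠ 0 → u j ≠ 0 → |u i| ≤ |u j| := by
    intro i j hi hj
    by_cases hij : i = j
    · rw [hij]
    · exact hB.abs_le_abs_of_mulVec_eq_zero hu hi hij
        fun x hx hxu hxj => hmin x hx hxu ⟨j, hj, hxj⟩
  have hscale : u = |u i₀| • fun i => (u i).sign := by
    ext i
    by_cases hi : u i = 0
    · simp [hi]
    · have := (hle i i₀ hi hi₀).antisymm (hle i₀ i hi₀ hi)
      simp only [Pi.smul_apply, smul_eq_mul, ← this]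
      rw [mul_comm, Int.sign_mul_abs]
  have hz : ∀ i, (u i).sign = 0 ↔ u i = 0 := fun i => Int.sign_eq_zero_iff_zero
  refine ⟨fun i => (u i).sign, ⟨?_, ?_, ?_⟩, fun i => ⟨?_, ?_⟩⟩
  · rw [Matrix.mem_kerLattice_map_iff]
    rw [hscale, Matrix.mulVec_smul] at hu
    exact (smul_eq_zero.1 hu).resolve_left (by simpa using hi₀)
  · rintro ⟨x, hx, hx0, hxu⟩
    rw [Matrix.mem_kerLattice_map_iff] at hx
    obtain ⟨hsub, j, hj, hxj⟩ := Set.ssubset_iff_exists.1 hxu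
    refine hx0 (hmin x hx (fun k hk => ?_) ⟨j, ?_, ?_⟩)
    · by_contra h
      exact hsub (a := k) h ((hz k).2 hk)
    · exact mt (hz j).2 hj
    · exact not_not.1 hxj
  · have hd : Finset.univ.gcd (fun i => (u i).sign) ∣ (u i₀).sign :=
      Finset.gcd_dvd (Finset.mem_univ i₀)
    have hun : IsUnit (u i₀).sign := by
      rw [Int.isUnit_iff]
      rcases lt_or_gt_of_ne hi₀ with h | h
      · exact Or.inr (Int.sign_eq_neg_one_of_neg h)
      · exact Or.inl (Int.sign_eq_one_of_pos h)
    rw [← Finset.normalize_gcd]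
    exact normalize_eq_one.2 (isUnit_of_dvd_unit hd hun)
  · have h1 : 0 ≤ (u i * v i).sign := Int.sign_nonneg_iff.2 (huv i)
    rw [Int.sign_mul] at h1
    rw [← Int.sign_mul_abs (v i), ← mul_assoc]
    exact mul_nonneg h1 (abs_nonneg _)
  · by_cases hi : u i = 0
    · simp [hi]
    · have h1 : 1 ≤ |v i| := Int.one_le_abs (mt (hsupp i) hi)
      refine le_trans ?_ h1
      rcases lt_or_gt_of_ne hi with h | h
      · simp [Int.sign_eq_neg_one_of_neg h]
      · simp [Int.sign_eq_one_of_pos h]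
end

section
/- Let G = (V, E) be an undirected graph with m = |E| ≥ 2 edges, let w : E → ℕ be a weight function, let R ⊆ E with |R| ≤ 1 (possibly empty), and let r be a positive integer. Suppose that every simple cycle C of G with C ∩ R = ∅ satisfies w(C) ≥ r. Then for every integer α ≥ 2, the number of simple cycles C of G with R ⊆ C and w(C) < α·r/2 is at most (2(m − |R|))^α. -/
/-- The edge sets of simple cycles of a graph `G`. -/
def cycleEdgeSets {V : Type*} [DecidableEq V] (G : SimpleGraph V) : Set (Finset (Sym2 V)) :=
  { C | ∃ (v : V) (p : G.Walk v v), p.IsCycle ∧ C = p.edges.toFinset }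

namespace SimpleGraph.Walk

variable {V : Type*} {G : SimpleGraph V}

/-- The total weight of the edges of a walk, counted with multiplicity. -/
def edgeWeight (w : Sym2 V → ℕ) {u v : V} (p : G.Walk u v) : ℕ := (p.edges.map w).sum

theorem edgeWeight_eq_sum [DecidableEq V] (w : Sym2 V → ℕ) {u v : V} {p : G.Walk u v}
    (hp : p.edges.Nodup) : p.edgeWeight w = ∑ e ∈ p.edges.toFinset, w e :=
  (List.sum_toFinset w hp).symm

/-- Two distinct paths with the same ends span a cycle. -/
theorem exists_isCycle_of_isPath_ne {u v : V} {p q : G.Walk u v} (hp : p.IsPath) (hq : q.IsPath)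
    (hne : p ≠ q) :
    ∃ (x : V) (c : G.Walk x x), c.IsCycle ∧ ∀ e ∈ c.edges, e ∈ p.edges ∨ e ∈ q.edges := by
  by_contra! hcon
  let H : SimpleGraph V := fromEdgeSet {e | e ∈ p.edges ∨ e ∈ q.edges}
  have hHG : H ≤ G := by
    intro a b hab
    rcases ((fromEdgeSet_adj _).1 hab).1 with h | h
    · exact p.adj_of_mem_edges h
    · exact q.adj_of_mem_edges h
  have hmem {e : Sym2 V} (he : e ∈ p.edges ∨ e ∈ q.edges) : e ∈ H.edgeSet := by
    rw [edgeSet_fromEdgeSet]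
    refine ⟨he, fun hd => ?_⟩
    rcases he with h | h
    · exact G.not_isDiag_of_mem_edgeSet (p.edges_subset_edgeSet h) hd
    · exact G.not_isDiag_of_mem_edgeSet (q.edges_subset_edgeSet h) hd
  have hH : H.IsAcyclic := by
    intro x c hc
    obtain ⟨e, he, hep, heq⟩ := hcon x (c.mapLe hHG) (hc.mapLe hHG)
    have he' : e ∈ c.edges := by simpa using he
    have := c.edges_subset_edgeSet he'
    rw [edgeSet_fromEdgeSet] at this
    exact this.1.elim hep heq
  have h := congrArg (fun s : H.Path u v => s.1.edges)
    ((hH.subsingleton_path u v).elim ⟨p.transfer H fun e he => hmem (.inl he), hp.transfer _⟩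
      ⟨q.transfer H fun e he => hmem (.inr he), hq.transfer _⟩)
  simp only [edges_transfer] at h
  exact hne (edges_injective h)

theorem eq_of_isPath_of_two_mul_edgeWeight_lt {w : Sym2 V → ℕ} {r : ℕ}
    (hG : ∀ (x : V) (c : G.Walk x x), c.IsCycle → r ≤ c.edgeWeight w) {u v : V}
    {p q : G.Walk u v} (hp : p.IsPath) (hq : q.IsPath) (hpw : 2 * p.edgeWeight w < r)
    (hqw : 2 * q.edgeWeight w < r) : p = q := by
  classical
  by_contra hne
  obtain ⟨x, c, hc, hsub⟩ := exists_isCycle_of_isPath_ne hp hq hne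
  have h := hG x c hc
  rw [edgeWeight_eq_sum w hc.edges_nodup] at h
  rw [edgeWeight_eq_sum w hp.isTrail.edges_nodup] at hpw
  rw [edgeWeight_eq_sum w hq.isTrail.edges_nodup] at hqw
  have h1 : ∑ e ∈ c.edges.toFinset, w e ≤ ∑ e ∈ p.edges.toFinset ∪ q.edges.toFinset, w e :=
    Finset.sum_le_sum_of_subset fun e he => by simpa using hsub e (by simpa using he)
  have h2 := Finset.sum_union_inter (s₁ := p.edges.toFinset) (s₂ := q.edges.toFinset) (f := w)
  omega

/-- A nontrivial walk splits at its first dart where the doubled weight reaches `t`, or at its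
last dart if there is none. -/
theorem exists_eq_append_cons_of_edgeWeight (w : Sym2 V → ℕ) {u v : V} (p : G.Walk u v) (t : ℕ)
    (ht : 0 < t) (hp : ¬ p.Nil) :
    ∃ (d : G.Dart) (p₁ : G.Walk u d.fst) (p₂ : G.Walk d.snd v),
      p = p₁.append (cons d.adj p₂) ∧ 2 * p₁.edgeWeight w < t ∧
        (t + 2 * p₂.edgeWeight w ≤ 2 * p.edgeWeight w ∨ p₂.edgeWeight w = 0) := by
  induction p generalizing t with
  | nil => simp at hp
  | @cons a b c h q ih =>
    by_cases htw : t ≤ 2 * w s(a, b)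
    · refine ⟨⟨(a, b), h⟩, nil, q, rfl, by simpa [edgeWeight] using ht, .inl ?_⟩
      simp only [edgeWeight, edges_cons, List.map_cons, List.sum_cons]
      omega
    · by_cases hq : q.Nil
      · refine ⟨⟨(a, b), h⟩, nil, q, rfl, by simpa [edgeWeight] using ht, .inr ?_⟩
        cases hq
        simp [edgeWeight]
      · obtain ⟨d, p₁, p₂, rfl, h₁, h₂⟩ := ih (t - 2 * w s(a, b)) (by omega) hq
        refine ⟨d, cons h p₁, p₂, rfl, ?_, h₂.imp_left fun h₂ => ?_⟩
        · simp only [edgeWeight, edges_cons, List.map_cons, List.sum_cons] at h₁ ⊢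
          omega
        · simp only [edgeWeight, edges_cons, List.map_cons, List.sum_cons] at h₂ ⊢
          omega

/-- If all cycles weigh at least `r`, paths with fixed ends of weight less than `(n + 1) * r / 2`
are encoded by `n` darts. -/
theorem exists_injOn_isPath_darts [Nonempty G.Dart] {w : Sym2 V → ℕ} {r : ℕ} (hr : 0 < r)
    (hG : ∀ (x : V) (c : G.Walk x x), c.IsCycle → r ≤ c.edgeWeight w) (n : ℕ) (u v : V) :
    ∃ g : G.Walk u v → Fin n → G.Dart,
      Set.InjOn g {p | p.IsPath ∧ 2 * p.edgeWeight w < (n + 1) * r} := by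
  classical
  induction n generalizing u with
  | zero =>
    refine ⟨fun _ => Fin.elim0, fun p hp q hq _ => ?_⟩
    exact eq_of_isPath_of_two_mul_edgeWeight_lt hG hp.1 hq.1 (by simpa using hp.2)
      (by simpa using hq.2)
  | succ n ih =>
    choose g hg using ih
    by_cases huv : u = v
    · subst huv
      refine ⟨fun _ _ => Classical.arbitrary _, fun p hp q hq _ => ?_⟩
      rw [(isPath_iff_nil.1 hp.1).eq_nil, (isPath_iff_nil.1 hq.1).eq_nil]
    · choose d p₁ p₂ hsplit h₁ h₂ using fun p : G.Walk u v =>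
        exists_eq_append_cons_of_edgeWeight w p r hr (not_nil_of_ne huv)
      have hlight {p : G.Walk u v} (hp : 2 * p.edgeWeight w < ((n + 1 : ℕ) + 1) * r) :
          2 * (p₂ p).edgeWeight w < (n + 1) * r := by
        rcases h₂ p with h | h
        · linarith
        · rw [h]
          positivity
      have hpath {p : G.Walk u v} (hp : p.IsPath) : (p₁ p).IsPath ∧ (p₂ p).IsPath := by
        rw [hsplit p] at hp
        exact ⟨hp.of_append_left, hp.of_append_right.of_cons⟩
      refine ⟨fun p => Fin.cons (d p) (g _ (p₂ p)), fun p hp q hq hpq => ?_⟩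
      obtain ⟨hd, ht⟩ := Fin.cons_inj.1 hpq
      have key : ∀ (d₁ d₂ : G.Dart) (a : G.Walk u d₁.fst) (a' : G.Walk u d₂.fst)
          (b : G.Walk d₁.snd v) (b' : G.Walk d₂.snd v), d₁ = d₂ →
          a.IsPath → a'.IsPath → 2 * a.edgeWeight w < r → 2 * a'.edgeWeight w < r →
          b.IsPath → b'.IsPath → 2 * b.edgeWeight w < (n + 1) * r →
          2 * b'.edgeWeight w < (n + 1) * r → g _ b = g _ b' →
          a.append (cons d₁.adj b) = a'.append (cons d₂.adj b') := by
        rintro d₁ _ a a' b b' rfl ha ha' hwa hwa' hb hb' hwb hwb' hgb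
        rw [eq_of_isPath_of_two_mul_edgeWeight_lt hG ha ha' hwa hwa',
          hg _ ⟨hb, hwb⟩ ⟨hb', hwb'⟩ hgb]
      rw [hsplit p, hsplit q]
      exact key _ _ _ _ _ _ hd (hpath hp.1).1 (hpath hq.1).1 (h₁ p) (h₁ q) (hpath hp.1).2
        (hpath hq.1).2 (hlight hp.2) (hlight hq.2) ht

theorem exists_eq_append_cons_of_mem_darts {u v : V} (p : G.Walk u v) {d : G.Dart}
    (hd : d ∈ p.darts) :
    ∃ (p₁ : G.Walk u d.fst) (p₂ : G.Walk d.snd v), p = p₁.append (cons d.adj p₂) := by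
  induction p with
  | nil => simp at hd
  | @cons a b c h q ih =>
    rw [darts_cons, List.mem_cons] at hd
    rcases hd with rfl | hd
    · exact ⟨nil, q, rfl⟩
    · obtain ⟨p₁, p₂, rfl⟩ := ih hd
      exact ⟨cons h p₁, p₂, rfl⟩

/-- Removing an edge from a cycle leaves a path between its ends. -/
theorem IsCycle.exists_isPath_of_mem_edges [DecidableEq V] {x : V} {c : G.Walk x x}
    (hc : c.IsCycle) {a b : V} (hab : s(a, b) ∈ c.edges) :
    ∃ q : G.Walk b a, q.IsPath ∧ s(a, b) ∉ q.edges ∧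
      c.edges.toFinset = insert s(a, b) q.edges.toFinset := by
  obtain ⟨d, hd, hde⟩ := List.mem_map.1 hab
  obtain ⟨p₁, p₂, rfl⟩ := c.exists_eq_append_cons_of_mem_darts hd
  have hpath : (p₂.append p₁).IsPath := by
    have h := hc.support_nodup
    rw [support_append, support_cons, List.tail_cons, ← cons_tail_support p₁, List.cons_append,
      List.tail_cons] at h
    rw [isPath_def, support_append]
    exact (List.perm_append_comm.nodup_iff).1 h
  have hedges : (p₁.append (cons d.adj p₂)).edges = p₁.edges ++ d.edge :: p₂.edges := by
    rw [edges_append, edges_cons]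
    rfl
  have hnodup := hc.edges_nodup
  rw [hedges] at hnodup
  have hnot : d.edge ∉ (p₂.append p₁).edges := by
    rw [edges_append]
    have := (List.perm_middle.nodup_iff).1 hnodup
    simp only [List.nodup_cons, List.mem_append] at this ⊢
    tauto
  have hset : (p₁.append (cons d.adj p₂)).edges.toFinset =
      insert d.edge (p₂.append p₁).edges.toFinset := by
    rw [hedges, edges_append]
    ext e
    simp only [List.mem_toFinset, List.mem_append, List.mem_cons, Finset.mem_insert]
    tauto
  rw [hset, ← hde]
  rcases dart_edge_eq_mk'_iff'.1 hde with ⟨rfl, rfl⟩ | ⟨rfl, rfl⟩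
  · exact ⟨_, hpath, hnot, rfl⟩
  · exact ⟨(p₂.append p₁).reverse, hpath.reverse, by simpa [and_comm] using hnot,
      by simp [Finset.union_comm]⟩

end SimpleGraph.Walk

theorem exists_isPath_of_mem_cycleEdgeSets {V : Type*} [DecidableEq V] {G : SimpleGraph V}
    {C : Finset (Sym2 V)} (hC : C ∈ cycleEdgeSets G) {a b : V} (hab : s(a, b) ∈ C)
    (w : Sym2 V → ℕ) :
    ∃ q : G.Walk b a, q.IsPath ∧ s(a, b) ∉ q.edges ∧ C = insert s(a, b) q.edges.toFinset ∧
      q.edgeWeight w ≤ ∑ e ∈ C, w e := by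
  obtain ⟨x, c, hc, rfl⟩ := hC
  obtain ⟨q, hq, hnot, hset⟩ := hc.exists_isPath_of_mem_edges (List.mem_toFinset.1 hab)
  refine ⟨q, hq, hnot, hset, ?_⟩
  rw [q.edgeWeight_eq_sum w hq.isTrail.edges_nodup, hset]
  exact Finset.sum_le_sum_of_subset (Finset.subset_insert _ _)

/-- If all cycles weigh at least `r`, there are at most `(2m) ^ (n + 1)` cycles of weight less
than `(n + 1) * r / 2`. -/
theorem ncard_light_cycles_le {V : Type*} [Fintype V] [DecidableEq V] (G : SimpleGraph V)
    [DecidableRel G.Adj] [Nonempty G.Dart] (w : Sym2 V → ℕ) {r : ℕ} (hr : 0 < r)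
    (hG : ∀ C ∈ cycleEdgeSets G, r ≤ ∑ e ∈ C, w e) (n : ℕ) :
    {C | C ∈ cycleEdgeSets G ∧ 2 * ∑ e ∈ C, w e < (n + 1) * r}.ncard ≤
      (2 * G.edgeFinset.card) ^ (n + 1) := by
  have hG' (x : V) (c : G.Walk x x) (hc : c.IsCycle) : r ≤ c.edgeWeight w := by
    rw [c.edgeWeight_eq_sum w hc.edges_nodup]
    exact hG _ ⟨x, c, hc, rfl⟩
  choose g hg using SimpleGraph.Walk.exists_injOn_isPath_darts (G := G) hr hG' n
  have hex (C : Finset (Sym2 V)) : ∃ (d : G.Dart) (q : G.Walk d.snd d.fst),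
      C ∈ cycleEdgeSets G → q.IsPath ∧ C = insert d.edge q.edges.toFinset ∧
        q.edgeWeight w ≤ ∑ e ∈ C, w e := by
    by_cases hC : C ∈ cycleEdgeSets G
    · obtain ⟨x, c, hc, rfl⟩ := id hC
      obtain ⟨d, hd⟩ := List.exists_mem_of_ne_nil c.darts fun h => hc.not_nil (by simpa using h)
      obtain ⟨q, hq, -, hset, hqw⟩ := exists_isPath_of_mem_cycleEdgeSets hC
        (List.mem_toFinset.2 (List.mem_map_of_mem hd) : s(d.fst, d.snd) ∈ c.edges.toFinset) w
      exact ⟨d, q, fun _ => ⟨hq, hset, hqw⟩⟩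
    · exact ⟨Classical.arbitrary _, .cons (SimpleGraph.Dart.adj _).symm .nil, fun h => absurd h hC⟩
  choose d q hdq using hex
  have hinj : Set.InjOn (fun C => (d C, g _ _ (q C)))
      {C | C ∈ cycleEdgeSets G ∧ 2 * ∑ e ∈ C, w e < (n + 1) * r} := by
    rintro C ⟨hC, hCw⟩ C' ⟨hC', hCw'⟩ hCC'
    obtain ⟨hd, hgq⟩ := Prod.mk.inj hCC'
    obtain ⟨hp, hset, hqw⟩ := hdq C hC
    obtain ⟨hp', hset', hqw'⟩ := hdq C' hC'
    rw [hset, hset']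
    generalize q C = p at *
    generalize q C' = p' at *
    generalize d C = e at *
    subst hd
    rw [hg _ _ ⟨hp, by omega⟩ ⟨hp', by omega⟩ hgq]
  have h := Set.ncard_le_ncard_of_injOn (t := Set.univ) _ (fun _ _ => Set.mem_univ _) hinj
  simpa [Set.ncard_univ, SimpleGraph.dart_card_eq_twice_card_edges, pow_succ'] using h

/-- If all cycles avoiding the edge `e` weigh at least `r`, there are at most `(2(m - 1)) ^ n`
cycles through `e` of weight less than `(n + 1) * r / 2`. -/
theorem ncard_light_cycles_through_le {V : Type*} [Fintype V] [DecidableEq V] (G : SimpleGraph V)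
    [DecidableRel G.Adj] (w : Sym2 V → ℕ) {r : ℕ} (hr : 0 < r) {e : Sym2 V}
    (he : e ∈ G.edgeFinset) (hm : 2 ≤ G.edgeFinset.card)
    (hG : ∀ C ∈ cycleEdgeSets G, e ∉ C → r ≤ ∑ f ∈ C, w f) (n : ℕ) :
    {C | C ∈ cycleEdgeSets G ∧ e ∈ C ∧ 2 * ∑ f ∈ C, w f < (n + 1) * r}.ncard ≤
      (2 * (G.edgeFinset.card - 1)) ^ n := by
  classical
  induction e with | _ a b
  let H := G.deleteEdges {s(a, b)}
  have hcard : Fintype.card H.Dart = 2 * (G.edgeFinset.card - 1) := by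
    rw [SimpleGraph.dart_card_eq_twice_card_edges, ← Finset.card_erase_of_mem he]
    congr 2
    ext f
    simp [H, and_comm]
  have : Nonempty H.Dart := Fintype.card_pos_iff.1 (by omega)
  have hH (x : V) (c : H.Walk x x) (hc : c.IsCycle) : r ≤ c.edgeWeight w := by
    rw [c.edgeWeight_eq_sum w hc.edges_nodup]
    refine hG _ ⟨x, c.mapLe (G.deleteEdges_le _), hc.mapLe _, by simp⟩ fun h => ?_
    have := c.edges_subset_edgeSet (List.mem_toFinset.1 h)
    simp [H] at this
  obtain ⟨g, hg⟩ := SimpleGraph.Walk.exists_injOn_isPath_darts hr hH n b a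
  have hex (C) (hC : C ∈ {C | C ∈ cycleEdgeSets G ∧ s(a, b) ∈ C ∧
      2 * ∑ f ∈ C, w f < (n + 1) * r}) : ∃ q : H.Walk b a, (q.IsPath ∧
        2 * q.edgeWeight w < (n + 1) * r) ∧ C = insert s(a, b) q.edges.toFinset := by
    obtain ⟨q, hq, hnot, hset, hqw⟩ := exists_isPath_of_mem_cycleEdgeSets hC.1 hC.2.1 w
    have hqH : ∀ f ∈ q.edges, f ∈ H.edgeSet := fun f hf => by
      rw [SimpleGraph.edgeSet_deleteEdges]
      exact ⟨q.edges_subset_edgeSet hf, fun hfe => hnot (hfe ▸ hf)⟩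
    refine ⟨q.transfer H hqH, ⟨hq.transfer hqH, ?_⟩, ?_⟩
    · have := hC.2.2
      simp only [SimpleGraph.Walk.edgeWeight, SimpleGraph.Walk.edges_transfer] at hqw ⊢
      omega
    · simpa only [SimpleGraph.Walk.edges_transfer] using hset
  obtain hempty | ⟨C₀, hC₀⟩ := Set.eq_empty_or_nonempty
    {C | C ∈ cycleEdgeSets G ∧ s(a, b) ∈ C ∧ 2 * ∑ f ∈ C, w f < (n + 1) * r}
  · simp [hempty]
  have : Nonempty (H.Walk b a) := ⟨(hex C₀ hC₀).choose⟩
  choose! q hq hset using hex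
  have hinj : Set.InjOn (fun C => g (q C))
      {C | C ∈ cycleEdgeSets G ∧ s(a, b) ∈ C ∧ 2 * ∑ f ∈ C, w f < (n + 1) * r} := by
    intro C hC C' hC' hCC'
    rw [hset C hC, hset C' hC', hg (hq C hC) (hq C' hC') hCC']
  have h := Set.ncard_le_ncard_of_injOn (t := Set.univ) _ (fun _ _ => Set.mem_univ _) hinj
  simpa [Set.ncard_univ, hcard] using h


/-- **Base case, graphic matroids**: if every simple cycle of `G` avoiding `R` (where
`|R| ≤ 1`) has weight at least `r`, then for every integer `α ≥ 2` the number of simple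
cycles containing `R` of weight less than `α·r/2` is at most `(2(m − |R|))^α`. -/
theorem near_shortest_cycles_bound {V : Type*} [Fintype V] [DecidableEq V]
    (G : SimpleGraph V) [DecidableRel G.Adj] (m : ℕ) (hm : G.edgeFinset.card = m)
    (hm2 : 2 ≤ m) (w : Sym2 V → ℕ) (R : Finset (Sym2 V)) (hRE : R ⊆ G.edgeFinset)
    (hR : R.card ≤ 1) (r : ℕ) (hr : 0 < r)
    (hshort : ∀ C ∈ cycleEdgeSets G, Disjoint C R → r ≤ ∑ e ∈ C, w e) :
    ∀ α : ℕ, 2 ≤ α →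
      Set.ncard { C | C ∈ cycleEdgeSets G ∧ R ⊆ C ∧ 2 * ∑ e ∈ C, w e < α * r }
        ≤ (2 * (m - R.card)) ^ α := by
  subst hm
  intro α hα
  obtain ⟨n, rfl⟩ := Nat.exists_eq_add_of_le' (show 1 ≤ α by omega)
  obtain rfl | ⟨e, rfl⟩ := (Nat.le_one_iff_eq_zero_or_eq_one.1 hR).imp Finset.card_eq_zero.1
    Finset.card_eq_one.1
  · have : Nonempty G.Dart := Fintype.card_pos_iff.1 (by
      rw [SimpleGraph.dart_card_eq_twice_card_edges]
      omega)
    simpa using ncard_light_cycles_le G w hr (fun C hC => hshort C hC (by simp)) n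
  · refine le_trans ?_ (Nat.pow_le_pow_right (by simp; omega) n.le_succ)
    simpa using ncard_light_cycles_through_le G w hr (by simpa using hRE) hm2
      (fun C hC he => hshort C hC (by simpa using he)) n
end

section
/- Let G = (V, E) be an undirected graph with m = |E| ≥ 2 edges, let w : E → ℕ be a weight function, let R ⊆ E with |R| ≤ 1 (possibly empty), and let r be a positive integer. Suppose that every inclusionwise minimal cut-set C of G with C ∩ R = ∅ satisfies w(C) ≥ r. Then for every integer α ≥ 2, the number of inclusionwise minimal cut-sets C of G with R ⊆ C and w(C) < α·r/2 is at most (2(m − |R|))^α. -/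
/-- The cut-set of the cut `(V₁, V₁ᶜ)`: all edges of `G` with one endpoint in `V₁`
and the other outside `V₁`. -/
def cutSetOf {V : Type*} (G : SimpleGraph V) (V₁ : Set V) : Set (Sym2 V) :=
  { e | e ∈ G.edgeSet ∧ ∃ x y, e = s(x, y) ∧ x ∈ V₁ ∧ y ∉ V₁ }

/-- `C` is the cut-set of some cut of `G`, i.e. of a partition of the vertices into two
nonempty parts. -/
def IsCutSet {V : Type*} (G : SimpleGraph V) (C : Set (Sym2 V)) : Prop :=
  ∃ V₁ : Set V, V₁.Nonempty ∧ V₁ᶜ.Nonempty ∧ C = cutSetOf G V₁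

/-- `C` is an inclusionwise minimal (nonempty) cut-set of `G`. -/
def IsMinimalCutSet {V : Type*} (G : SimpleGraph V) (C : Set (Sym2 V)) : Prop :=
  IsCutSet G C ∧ C.Nonempty ∧ ∀ C', IsCutSet G C' → C'.Nonempty → C' ⊆ C → C' = C

/-- The weight of the support of a binary vector. -/
def suppWeight {E : Type*} [Fintype E] (w : E → ℕ) (c : E → ZMod 2) : ℕ :=
  ∑ e, if c e ≠ 0 then w e else 0

lemma suppWeight_le_of_support_subset {E : Type*} [Fintype E] (w : E → ℕ)
    {c d : E → ZMod 2} (h : Function.support c ⊆ Function.support d) :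
    suppWeight w c ≤ suppWeight w d := by
  refine Finset.sum_le_sum fun e _ => ?_
  by_cases hc : c e = 0
  · simp [hc]
  · rw [if_pos hc, if_pos (show d e ≠ 0 from h hc)]

/-- The subspace of those vectors of `D` that vanish at `e`. -/
def vanishAt {E : Type*} (D : Submodule (ZMod 2) (E → ZMod 2)) (e : E) :
    Submodule (ZMod 2) (E → ZMod 2) :=
  D ⊓ LinearMap.ker (LinearMap.proj e : (E → ZMod 2) →ₗ[ZMod 2] ZMod 2)

lemma mem_vanishAt {E : Type*} {D : Submodule (ZMod 2) (E → ZMod 2)} {e : E}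
    {c : E → ZMod 2} : c ∈ vanishAt D e ↔ c ∈ D ∧ c e = 0 := by
  simp [vanishAt]

/-- `D` is spanned by a family indexed by `V` in which every coordinate is nonzero in at
most two members. -/
def IsTwoSparse (V : Type*) [Fintype V] {E : Type*}
    (D : Submodule (ZMod 2) (E → ZMod 2)) : Prop :=
  ∃ g : V → E → ZMod 2, Submodule.span (ZMod 2) (Set.range g) = D ∧
    ∀ e, (Finset.univ.filter fun v => g v e ≠ 0).card ≤ 2

lemma ZMod.eq_one_of_ne_zero_mod_two {x : ZMod 2} (h : x ≠ 0) : x = 1 := by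
  revert x; decide

lemma IsTwoSparse.vanishAt {V : Type*} [Fintype V] {E : Type*}
    {D : Submodule (ZMod 2) (E → ZMod 2)} (hD : IsTwoSparse V D) (e : E) :
    IsTwoSparse V (vanishAt D e) := by
  classical
  obtain ⟨g, hg, hs⟩ := hD
  by_cases hi : ∃ i, g i e ≠ 0
  swap
  · push Not at hi
    refine ⟨g, ?_, hs⟩
    have hle : D ≤ LinearMap.ker (LinearMap.proj e : (E → ZMod 2) →ₗ[ZMod 2] ZMod 2) := by
      rw [← hg, Submodule.span_le]
      rintro _ ⟨v, rfl⟩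
      simpa using hi v
    rw [_root_.vanishAt, inf_eq_left.mpr hle, hg]
  · obtain ⟨i, hi⟩ := hi
    have hi1 := ZMod.eq_one_of_ne_zero_mod_two hi
    have hiD : g i ∈ D := hg ▸ Submodule.subset_span ⟨i, rfl⟩
    let T : (E → ZMod 2) →ₗ[ZMod 2] (E → ZMod 2) :=
      LinearMap.id - (LinearMap.proj e : (E → ZMod 2) →ₗ[ZMod 2] ZMod 2).smulRight (g i)
    have hT : ∀ x, T x = x - x e • g i := fun x => by simp [T]
    refine ⟨fun v => T (g v), ?_, fun e' => ?_⟩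
    · have hr : (Set.range fun v => T (g v)) = T '' Set.range g := by
        rw [← Set.range_comp]; rfl
      rw [hr, Submodule.span_image, hg]
      ext x
      rw [Submodule.mem_map, mem_vanishAt]
      constructor
      · rintro ⟨y, hy, rfl⟩
        rw [hT]
        exact ⟨D.sub_mem hy (D.smul_mem _ hiD), by simp [hi1]⟩
      · rintro ⟨hx, hxe⟩
        exact ⟨x, hx, by simp [hT, hxe]⟩
    · by_cases h0 : g i e' = 0
      · simpa [hT, h0] using hs e'
      · have h1 := ZMod.eq_one_of_ne_zero_mod_two h0
        have hsub : (Finset.univ.filter fun v => T (g v) e' ≠ 0) ⊆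
            ((Finset.univ.filter fun v => g v e' ≠ 0).erase i) ∪
              ((Finset.univ.filter fun v => g v e ≠ 0).erase i) := by
          intro v hv
          simp only [Finset.mem_filter, Finset.mem_univ, true_and, hT, Pi.sub_apply,
            Pi.smul_apply, smul_eq_mul, h1, mul_one] at hv
          have hvi : v ≠ i := by
            rintro rfl
            exact hv (by rw [h1, hi1, sub_self])
          simp only [Finset.mem_union, Finset.mem_erase, Finset.mem_filter,
            Finset.mem_univ, true_and]
          by_contra hc
          push Not at hc
          exact hv (by rw [hc.1 hvi, hc.2 hvi, sub_self])
        refine (Finset.card_le_card hsub).trans ((Finset.card_union_le _ _).trans ?_)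
        rw [Finset.card_erase_of_mem (by simpa using h0),
          Finset.card_erase_of_mem (by simpa using hi)]
        have := hs e
        have := hs e'
        omega

/-- If all nonzero vectors of a two-sparse space have weight at least `r`, the coordinates
on which the space does not vanish have total weight at least `r / 2` times its dimension. -/
lemma IsTwoSparse.finrank_mul_le {V : Type*} [Fintype V] {E : Type*} [Fintype E]
    {D : Submodule (ZMod 2) (E → ZMod 2)} (hD : IsTwoSparse V D) (w : E → ℕ) (r : ℕ)
    (hr : ∀ d ∈ D, d ≠ 0 → r ≤ suppWeight w d) (F : Finset E)
    (hF : ∀ e, e ∉ F → ∀ d ∈ D, d e = 0) :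
    Module.finrank (ZMod 2) D * r ≤ 2 * ∑ e ∈ F, w e := by
  classical
  obtain ⟨g, hg, hs⟩ := hD
  have hgD : ∀ v, g v ∈ D := fun v => hg ▸ Submodule.subset_span ⟨v, rfl⟩
  let N : Finset V := Finset.univ.filter fun v => g v ≠ 0
  have hspan : Submodule.span (ZMod 2) ((N.image g : Finset (E → ZMod 2)) : Set (E → ZMod 2))
      = D := by
    apply le_antisymm
    · rw [Submodule.span_le]
      intro x hx
      simp only [Finset.coe_image, Set.mem_image] at hx
      obtain ⟨v, -, rfl⟩ := hx
      exact hgD v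
    · rw [← hg, Submodule.span_le]
      rintro _ ⟨v, rfl⟩
      by_cases hv : g v = 0
      · rw [hv]; exact Submodule.zero_mem _
      · apply Submodule.subset_span
        simp only [Finset.coe_image, Set.mem_image]
        exact ⟨v, by simp [N, hv], rfl⟩
  have hcard : Module.finrank (ZMod 2) D ≤ N.card := by
    rw [← hspan]
    exact (finrank_span_finset_le_card _).trans Finset.card_image_le
  calc Module.finrank (ZMod 2) D * r ≤ N.card * r := Nat.mul_le_mul_right _ hcard
    _ = ∑ v ∈ N, r := by simp
    _ ≤ ∑ v ∈ N, suppWeight w (g v) := Finset.sum_le_sum fun v hv =>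
        hr _ (hgD v) (by simpa [N] using hv)
    _ ≤ ∑ v, suppWeight w (g v) :=
        Finset.sum_le_sum_of_subset (Finset.subset_univ _)
    _ = ∑ e, ∑ v, (if g v e ≠ 0 then w e else 0) := by
        unfold suppWeight; exact Finset.sum_comm
    _ = ∑ e, (Finset.univ.filter fun v => g v e ≠ 0).card * w e := by
        refine Finset.sum_congr rfl fun e _ => ?_
        rw [← Finset.sum_filter, Finset.sum_const, smul_eq_mul]
    _ = ∑ e ∈ F, (Finset.univ.filter fun v => g v e ≠ 0).card * w e := by
        refine (Finset.sum_subset (Finset.subset_univ F) fun e _ he => ?_).symm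
        simp [hF e he _ (hgD _)]
    _ ≤ ∑ e ∈ F, 2 * w e := Finset.sum_le_sum fun e _ => Nat.mul_le_mul_right _ (hs e)
    _ = 2 * ∑ e ∈ F, w e := by rw [Finset.mul_sum]

open Classical in
/-- The vectors of light weight in the coset `a + D`. -/
noncomputable def lightCoset {E : Type*} [Fintype E] (w : E → ℕ) (b : ℕ)
    (D : Submodule (ZMod 2) (E → ZMod 2)) (a : E → ZMod 2) : Finset (E → ZMod 2) :=
  Finset.univ.filter fun c => c - a ∈ D ∧ 2 * suppWeight w c < b

lemma mem_lightCoset {E : Type*} [Fintype E] {w : E → ℕ} {b : ℕ}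
    {D : Submodule (ZMod 2) (E → ZMod 2)} {a c : E → ZMod 2} :
    c ∈ lightCoset w b D a ↔ c - a ∈ D ∧ 2 * suppWeight w c < b := by
  simp [lightCoset]

lemma card_lightCoset_le_two_pow {E : Type*} [Fintype E] (w : E → ℕ) (b : ℕ)
    (D : Submodule (ZMod 2) (E → ZMod 2)) (a : E → ZMod 2) :
    (lightCoset w b D a).card ≤ 2 ^ Module.finrank (ZMod 2) D := by
  classical
  have h : Nat.card D = 2 ^ Module.finrank (ZMod 2) D := by
    rw [Module.natCard_eq_pow_finrank (K := ZMod 2), Nat.card_zmod]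
  rw [← h, Nat.card_eq_fintype_card, ← Fintype.card_coe]
  refine Fintype.card_le_of_injective
    (fun c => (⟨c.1 - a, (mem_lightCoset.1 c.2).1⟩ : D)) fun c c' hcc => ?_
  exact Subtype.ext (sub_left_injective (congrArg Subtype.val hcc))

/-- One contraction step: the arithmetic of averaging over the removed coordinate. -/
lemma card_le_choose_of_average {n W k α r : ℕ} (hr : 0 < r) (hk : α ≤ k)
    (hW : (k + 1) * r ≤ 2 * W)
    (h : n * (2 * W) ≤ 2 * W * (2 ^ α * k.choose α) + n * (α * r)) :
    n ≤ 2 ^ α * (k + 1).choose α := by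
  obtain ⟨j, rfl⟩ := Nat.exists_eq_add_of_le hk
  have hc : (α + j).choose α * (α + j + 1) = (α + j + 1).choose α * (j + 1) := by
    rw [Nat.choose_mul_succ_eq]; congr 1; omega
  set B := (α + j).choose α
  set B' := (α + j + 1).choose α
  have hW0 : 0 < 2 * W := lt_of_lt_of_le (by positivity) hW
  have key : n * ((2 * W) * (j + 1)) ≤ 2 ^ α * B' * ((2 * W) * (j + 1)) := by
    have h1 := Nat.mul_le_mul_right (α + j + 1) h
    have h2 : n * α * ((α + j + 1) * r) ≤ n * α * (2 * W) := Nat.mul_le_mul_left _ hW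
    have h3 : 2 * W * (2 ^ α * B) * (α + j + 1) = 2 ^ α * B' * ((2 * W) * (j + 1)) := by
      calc _ = 2 * W * 2 ^ α * (B * (α + j + 1)) := by ring
        _ = _ := by rw [hc]; ring
    rw [← h3]
    nlinarith
  exact Nat.le_of_mul_le_mul_right key (by positivity)

lemma card_lightCoset_le {V : Type*} [Fintype V] {E : Type*} [Fintype E] (w : E → ℕ)
    {r α : ℕ} (hr : 0 < r) {k : ℕ} (hk : α ≤ k)
    {D : Submodule (ZMod 2) (E → ZMod 2)} (hD : IsTwoSparse V D)
    (hw : ∀ d ∈ D, d ≠ 0 → r ≤ suppWeight w d) (hfr : Module.finrank (ZMod 2) D ≤ k)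
    (a : E → ZMod 2) :
    (lightCoset w (α * r) D a).card ≤ 2 ^ α * k.choose α := by
  classical
  induction k, hk using Nat.le_induction generalizing D a with
  | base =>
    rw [Nat.choose_self, mul_one]
    exact (card_lightCoset_le_two_pow _ _ _ _).trans (Nat.pow_le_pow_right two_pos hfr)
  | succ k hk ih =>
    rcases Nat.lt_or_ge (Module.finrank (ZMod 2) D) (k + 1) with hlt | hge
    · exact (ih hD hw (Nat.le_of_lt_succ hlt) a).trans
        (Nat.mul_le_mul_left _ (Nat.choose_le_succ k α))
    set F : Finset E := Finset.univ.filter fun e => ∃ d ∈ D, d e ≠ 0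
    set A := lightCoset w (α * r) D a
    have hW : (k + 1) * r ≤ 2 * ∑ e ∈ F, w e := by
      refine (Nat.mul_le_mul_right r hge).trans (hD.finrank_mul_le w r hw F ?_)
      intro e he d hd
      by_contra hne
      exact he (by simpa [F] using ⟨d, hd, hne⟩)
    refine card_le_choose_of_average hr hk hW ?_
    have hN : ∀ e ∈ F, (A.filter fun c => c e = 0).card ≤ 2 ^ α * k.choose α := by
      intro e he
      rcases (A.filter fun c => c e = 0).eq_empty_or_nonempty with h0 | ⟨a', ha'⟩
      · simp [h0]
      simp only [Finset.mem_filter, A, mem_lightCoset] at ha'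
      obtain ⟨d, hd, hde⟩ : ∃ d ∈ D, d e ≠ 0 := by simpa [F] using he
      have hlt : vanishAt D e < D := by
        refine lt_of_le_of_ne inf_le_left fun heq => hde ?_
        rw [← heq, mem_vanishAt] at hd
        exact hd.2
      have hfr' : Module.finrank (ZMod 2) (vanishAt D e) ≤ k :=
        Nat.le_of_lt_succ ((Submodule.finrank_lt_finrank_of_lt hlt).trans_le hfr)
      refine (Finset.card_le_card ?_).trans
        (ih (hD.vanishAt e) (fun d hd => hw d (mem_vanishAt.1 hd).1) hfr' a')
      intro c hc
      simp only [Finset.mem_filter, A, mem_lightCoset] at hc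
      rw [mem_lightCoset, mem_vanishAt]
      refine ⟨⟨?_, by simp [hc.2, ha'.2]⟩, hc.1.2⟩
      simpa using D.sub_mem hc.1.1 ha'.1.1
    have hc : ∀ c ∈ A, 2 * ∑ e ∈ F, w e ≤
        2 * (∑ e ∈ F, if c e = 0 then w e else 0) + α * r := by
      intro c hcA
      have h1 : 2 * suppWeight w c < α * r := (mem_lightCoset.1 hcA).2
      have h2 : ∑ e ∈ F, w e ≤ (∑ e ∈ F, if c e = 0 then w e else 0) + suppWeight w c := by
        calc ∑ e ∈ F, w e = (∑ e ∈ F, if c e = 0 then w e else 0)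
              + ∑ e ∈ F, (if c e ≠ 0 then w e else 0) := by
              rw [← Finset.sum_add_distrib]
              refine Finset.sum_congr rfl fun e _ => ?_
              by_cases h : c e = 0 <;> simp [h]
          _ ≤ _ := Nat.add_le_add_left
              (Finset.sum_le_sum_of_subset (Finset.subset_univ _)) _
      omega
    calc A.card * (2 * ∑ e ∈ F, w e) = ∑ c ∈ A, 2 * ∑ e ∈ F, w e := by simp
      _ ≤ ∑ c ∈ A, (2 * (∑ e ∈ F, if c e = 0 then w e else 0) + α * r) :=
          Finset.sum_le_sum hc
      _ = 2 * (∑ e ∈ F, ∑ c ∈ A, if c e = 0 then w e else 0) + A.card * (α * r) := by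
          rw [Finset.sum_add_distrib, ← Finset.mul_sum, Finset.sum_comm]; simp
      _ = 2 * (∑ e ∈ F, w e * (A.filter fun c => c e = 0).card) + A.card * (α * r) := by
          congr 2
          refine Finset.sum_congr rfl fun e _ => ?_
          rw [← Finset.sum_filter, Finset.sum_const, smul_eq_mul, mul_comm]
      _ ≤ 2 * (∑ e ∈ F, w e * (2 ^ α * k.choose α)) + A.card * (α * r) := by
          gcongr with e he
          exact hN e he
      _ = _ := by rw [← Finset.sum_mul]; ring

/-- The coboundary of a binary vertex labelling: the edges joining different labels. -/
def coboundary {V : Type*} (G : SimpleGraph V) [DecidableRel G.Adj] :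
    (V → ZMod 2) →ₗ[ZMod 2] (Sym2 V → ZMod 2) where
  toFun φ e := if e ∈ G.edgeSet then
    Sym2.lift ⟨fun x y => φ x + φ y, fun _ _ => add_comm _ _⟩ e else 0
  map_add' φ ψ := by
    ext e
    induction e with | _ x y
    by_cases h : G.Adj x y <;> simp [h]; ring
  map_smul' t φ := by
    ext e
    induction e with | _ x y
    by_cases h : G.Adj x y <;> simp [h]; ring

lemma coboundary_mk {V : Type*} (G : SimpleGraph V) [DecidableRel G.Adj] (φ : V → ZMod 2)
    (x y : V) : coboundary G φ s(x, y) = if G.Adj x y then φ x + φ y else 0 := rfl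

lemma isTwoSparse_range_coboundary {V : Type*} [Fintype V] [DecidableEq V]
    (G : SimpleGraph V) [DecidableRel G.Adj] :
    IsTwoSparse V (LinearMap.range (coboundary G)) := by
  refine ⟨fun v => coboundary G (Pi.single v 1), ?_, fun e => ?_⟩
  · have hr : (Set.range fun v => coboundary G (Pi.single v 1)) =
        coboundary G '' Set.range fun v => (Pi.single v 1 : V → ZMod 2) := by
      rw [← Set.range_comp]; rfl
    have hb : Submodule.span (ZMod 2) (Set.range fun v => (Pi.single v 1 : V → ZMod 2)) = ⊤ := by
      have := (Pi.basisFun (ZMod 2) V).span_eq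
      simpa [funext (Pi.basisFun_apply (ZMod 2) V)] using this
    rw [hr, Submodule.span_image, hb, LinearMap.range_eq_map]
  · induction e with | _ x y
    refine (Finset.card_le_card (t := {x, y}) ?_).trans Finset.card_le_two
    intro v hv
    by_contra hn
    simp only [Finset.mem_insert, Finset.mem_singleton, not_or] at hn
    simp [coboundary_mk, Pi.single_apply, Ne.symm hn.1, Ne.symm hn.2] at hv

lemma support_coboundary {V : Type*} (G : SimpleGraph V) [DecidableRel G.Adj]
    (φ : V → ZMod 2) : Function.support (coboundary G φ) = cutSetOf G {v | φ v ≠ 0} := by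
  have h2 : ∀ a b : ZMod 2, a + b ≠ 0 ↔ (a ≠ 0 ∧ b = 0) ∨ (b ≠ 0 ∧ a = 0) := by decide
  ext e
  induction e with | _ x y
  simp only [Function.mem_support, coboundary_mk, cutSetOf, Set.mem_ofPred_eq,
    SimpleGraph.mem_edgeSet, ne_eq, ite_eq_right_iff, Classical.not_imp, not_not]
  refine and_congr_right fun _ => ?_
  rw [← ne_eq, h2]
  constructor
  · rintro (h | h)
    · exact ⟨x, y, rfl, h⟩
    · exact ⟨y, x, Sym2.eq_swap, h⟩
  · rintro ⟨a, b, hab, h⟩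
    rcases Sym2.eq_iff.1 hab with ⟨rfl, rfl⟩ | ⟨rfl, rfl⟩
    · exact Or.inl h
    · exact Or.inr h

lemma exists_support_coboundary_eq {V : Type*} (G : SimpleGraph V) [DecidableRel G.Adj]
    {C : Set (Sym2 V)} (hC : IsCutSet G C) :
    ∃ φ, Function.support (coboundary G φ) = C := by
  classical
  obtain ⟨S, -, -, rfl⟩ := hC
  exact ⟨S.indicator 1, by rw [support_coboundary]; congr 1; ext v; simp⟩

lemma isCutSet_support_coboundary {V : Type*} (G : SimpleGraph V) [DecidableRel G.Adj]
    {φ : V → ZMod 2} (h : (Function.support (coboundary G φ)).Nonempty) :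
    IsCutSet G (Function.support (coboundary G φ)) := by
  rw [support_coboundary] at h ⊢
  obtain ⟨e, -, x, y, -, hx, hy⟩ := h
  exact ⟨_, ⟨x, hx⟩, ⟨y, hy⟩, rfl⟩

lemma IsCutSet.exists_isMinimalCutSet_subset {V : Type*} [Finite V] {G : SimpleGraph V}
    {C : Set (Sym2 V)} (hC : IsCutSet G C) (hne : C.Nonempty) :
    ∃ C' ⊆ C, IsMinimalCutSet G C' := by
  obtain ⟨C', hle, hmin⟩ := (Set.toFinite {C | IsCutSet G C ∧ C.Nonempty}).exists_le_minimal
    (⟨hC, hne⟩ : C ∈ {C | IsCutSet G C ∧ C.Nonempty})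
  exact ⟨C', hle, hmin.prop.1, hmin.prop.2, fun C'' h1 h2 h3 =>
    subset_antisymm h3 (hmin.le_of_le ⟨h1, h2⟩ h3)⟩

lemma finsum_mem_support_eq_suppWeight {E : Type*} [Fintype E] (w : E → ℕ)
    (c : E → ZMod 2) : ∑ᶠ e ∈ Function.support c, w e = suppWeight w c := by
  classical
  rw [finsum_mem_def, finsum_eq_sum_of_fintype]
  refine Finset.sum_congr rfl fun e _ => ?_
  by_cases h : c e = 0 <;> simp [h]

/-- The cut space of `G` restricted to cuts avoiding `R`. -/
def cutSpaceAvoiding {V : Type*} (G : SimpleGraph V) [DecidableRel G.Adj]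
    (R : Set (Sym2 V)) : Submodule (ZMod 2) (Sym2 V → ZMod 2) where
  carrier := {d | d ∈ LinearMap.range (coboundary G) ∧ ∀ e ∈ R, d e = 0}
  add_mem' := fun h1 h2 => ⟨Submodule.add_mem _ h1.1 h2.1, fun e he => by
    simp [h1.2 e he, h2.2 e he]⟩
  zero_mem' := ⟨Submodule.zero_mem _, fun _ _ => rfl⟩
  smul_mem' := fun t _ h => ⟨Submodule.smul_mem _ t h.1, fun e he => by simp [h.2 e he]⟩

lemma mem_cutSpaceAvoiding {V : Type*} {G : SimpleGraph V} [DecidableRel G.Adj]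
    {R : Set (Sym2 V)} {d : Sym2 V → ZMod 2} : d ∈ cutSpaceAvoiding G R ↔
      d ∈ LinearMap.range (coboundary G) ∧ ∀ e ∈ R, d e = 0 := Iff.rfl

lemma isTwoSparse_cutSpaceAvoiding {V : Type*} [Fintype V] [DecidableEq V]
    (G : SimpleGraph V) [DecidableRel G.Adj] {R : Set (Sym2 V)} (hR : R.ncard ≤ 1) :
    IsTwoSparse V (cutSpaceAvoiding G R) := by
  rcases (Set.ncard_le_one_iff_subsingleton.1 hR).eq_empty_or_singleton
    with rfl | ⟨f, rfl⟩
  · convert isTwoSparse_range_coboundary G using 1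
    ext d
    simp [mem_cutSpaceAvoiding]
  · convert (isTwoSparse_range_coboundary G).vanishAt f using 1
    ext d
    simp [mem_cutSpaceAvoiding, mem_vanishAt]

lemma finrank_cutSpaceAvoiding_le {V : Type*} [Fintype V] [DecidableEq V]
    (G : SimpleGraph V) [DecidableRel G.Adj] {R : Set (Sym2 V)} (hR : R ⊆ G.edgeSet) :
    Module.finrank (ZMod 2) (cutSpaceAvoiding G R) ≤ G.edgeFinset.card - R.ncard := by
  classical
  let T : Set (Sym2 V) := G.edgeSet \ R
  let f : cutSpaceAvoiding G R →ₗ[ZMod 2] (T → ZMod 2) :=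
    (LinearMap.funLeft (ZMod 2) (ZMod 2) (Subtype.val : T → Sym2 V)).comp
      (cutSpaceAvoiding G R).subtype
  have hf : Function.Injective f := by
    rw [← LinearMap.ker_eq_bot, LinearMap.ker_eq_bot']
    rintro ⟨d, ⟨φ, rfl⟩, hd⟩ h0
    ext e
    by_cases he : e ∈ T
    · exact congrFun h0 ⟨e, he⟩
    by_cases heR : e ∈ R
    · exact hd e heR
    have heG : e ∉ G.edgeSet := fun h => he ⟨h, heR⟩
    exact if_neg heG
  refine (LinearMap.finrank_le_finrank_of_injective hf).trans ?_
  rw [Module.finrank_fintype_fun_eq_card, ← Nat.card_eq_fintype_card, Nat.card_coe_set_eq,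
    Set.ncard_sdiff hR (Set.toFinite R), ← SimpleGraph.coe_edgeFinset, Set.ncard_coe_finset]

/-- **Base case, cographic matroids**: if every inclusionwise minimal cut-set of `G`
avoiding `R` (where `|R| ≤ 1`) has weight at least `r`, then for every integer `α ≥ 2`
the number of inclusionwise minimal cut-sets containing `R` of weight less than `α·r/2`
is at most `(2(m − |R|))^α`. -/
theorem near_minimum_cutsets_bound {V : Type*} [Fintype V] [DecidableEq V]
    (G : SimpleGraph V) [DecidableRel G.Adj] (m : ℕ) (hm : G.edgeFinset.card = m)
    (hm2 : 2 ≤ m) (w : Sym2 V → ℕ) (R : Set (Sym2 V)) (hRE : R ⊆ G.edgeSet)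
    (hR : R.ncard ≤ 1) (r : ℕ) (hr : 0 < r)
    (hshort : ∀ C, IsMinimalCutSet G C → Disjoint C R → r ≤ ∑ᶠ e ∈ C, w e) :
    ∀ α : ℕ, 2 ≤ α →
      Set.ncard { C | IsMinimalCutSet G C ∧ R ⊆ C ∧ 2 * ∑ᶠ e ∈ C, w e < α * r }
        ≤ (2 * (m - R.ncard)) ^ α := by
  intro α _
  set 𝒞 := { C | IsMinimalCutSet G C ∧ R ⊆ C ∧ 2 * ∑ᶠ e ∈ C, w e < α * r }
  set M := m - R.ncard
  have hM : 1 ≤ M := by omega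
  set D := cutSpaceAvoiding G R
  rcases 𝒞.eq_empty_or_nonempty with h0 | ⟨C₀, hC₀⟩
  · simp [h0]
  obtain ⟨φ₀, hφ₀⟩ := exists_support_coboundary_eq G hC₀.1.1
  have hw : ∀ d ∈ D, d ≠ 0 → r ≤ suppWeight w d := by
    rintro d ⟨⟨φ, rfl⟩, hd⟩ hne
    have hsupp := Function.support_nonempty_iff.2 hne
    obtain ⟨C, hsub, hC⟩ :=
      (isCutSet_support_coboundary G hsupp).exists_isMinimalCutSet_subset hsupp
    refine (hshort C hC ?_).trans ?_
    · exact Set.disjoint_left.2 fun e he heR => hsub he (hd e heR)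
    · obtain ⟨ψ, rfl⟩ := exists_support_coboundary_eq G hC.1
      rw [finsum_mem_support_eq_suppWeight]
      exact suppWeight_le_of_support_subset w hsub
  have hsub : 𝒞 ⊆ Function.support ''
      (lightCoset w (α * r) D (coboundary G φ₀) : Set (Sym2 V → ZMod 2)) := by
    rintro C ⟨hC, hRC, hlight⟩
    obtain ⟨φ, rfl⟩ := exists_support_coboundary_eq G hC.1
    refine ⟨_, ?_, rfl⟩
    rw [Finset.mem_coe, mem_lightCoset, ← finsum_mem_support_eq_suppWeight]
    refine ⟨⟨⟨φ - φ₀, map_sub _ _ _⟩, fun e he => ?_⟩, hlight⟩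
    have h1 := ZMod.eq_one_of_ne_zero_mod_two (hRC he)
    have h2 := ZMod.eq_one_of_ne_zero_mod_two (hφ₀ ▸ hC₀.2.1 he : e ∈ Function.support _)
    rw [Pi.sub_apply, h1, h2, sub_self]
  have hfr : Module.finrank (ZMod 2) D ≤ M := by
    simpa only [hm] using finrank_cutSpaceAvoiding_le G hRE
  calc 𝒞.ncard ≤ (Function.support ''
        (lightCoset w (α * r) D (coboundary G φ₀) : Set (Sym2 V → ZMod 2))).ncard :=
        Set.ncard_le_ncard hsub (Set.toFinite _)
    _ ≤ (lightCoset w (α * r) D (coboundary G φ₀)).card :=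
        (Set.ncard_image_le (Set.toFinite _)).trans_eq (Set.ncard_coe_finset _)
    _ ≤ 2 ^ α * (max M α).choose α :=
        card_lightCoset_le w hr (le_max_right _ _) (isTwoSparse_cutSpaceAvoiding G hR) hw
          (hfr.trans (le_max_left _ _)) _
    _ ≤ 2 ^ α * M ^ α := by
        refine Nat.mul_le_mul_left _ ?_
        rcases le_total α M with h | h
        · rw [max_eq_left h]; exact Nat.choose_le_pow M α
        · rw [max_eq_right h, Nat.choose_self]; exact Nat.one_le_pow _ _ hM
    _ = (2 * M) ^ α := (mul_pow _ _ _).symm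
end
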